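/- Let P_n be a graph sampled uniformly at random from 𝒫_n and let H(G) = max{α(G), ω(G)}, where α is the independence number and ω the clique number. Then the total variation distance between the distribution of H(P_n) and L(n) is e^{−Ω(n)}: there exist c > 0 and n₀ such that for all n ≥ n₀, (1/2)·Σ_{k=0}^{n} |P(H(P_n) = k) − ℓ_{n,k}/𝓛_n| ≤ e^{−cn}. -/

import Mathlib

open scoped Classical
open Filter

noncomputable section

/-- A finite simple graph is perfect if every induced subgraph has chromatic number
equal to clique number. -/
def IsPerfect {V : Type*} (G : SimpleGraph V) : Prop :=
  ∀ s : Set V, (G.induce s).chromaticNumber = ((G.induce s).cliqueNum : ℕ∞)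

/-- `(G, C)` is a unipolar arrangement: `C` is a clique (the central clique) and every
connected component of the subgraph induced on the complement of `C` is a clique. -/
def IsUnipolarArrangement {V : Type*} (G : SimpleGraph V) (C : Set V) : Prop :=
  G.IsClique C ∧
    ∀ u v : (Cᶜ : Set V), (G.induce Cᶜ).Reachable u v → u ≠ v → (G.induce Cᶜ).Adj u v

def IsUnipolar {V : Type*} (G : SimpleGraph V) : Prop :=
  ∃ C : Set V, IsUnipolarArrangement G C

def IsCoUnipolar {V : Type*} (G : SimpleGraph V) : Prop := IsUnipolar Gᶜ

def IsGenSplit {V : Type*} (G : SimpleGraph V) : Prop := IsUnipolar G ∨ IsCoUnipolar G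

/-- the `m`-th Bell number: the number of partitions of an `m`-element set. -/
def bell (m : ℕ) : ℕ := Nat.card (Finpartition (Finset.univ : Finset (Fin m)))

/-- `ℓ_{n,k} = C(n,k) · 2^{k(n-k)} · B_{n-k}` -/
def ell (n k : ℕ) : ℕ := Nat.choose n k * 2 ^ (k * (n - k)) * bell (n - k)

/-- `𝓛_n = Σ_{k=0}^n ℓ_{n,k}` -/
def scrL (n : ℕ) : ℕ := ∑ k ∈ Finset.range (n + 1), ell n k

/-- the number of perfect graphs on `{1,…,n}` -/
def perfectCount (n : ℕ) : ℕ := Nat.card {G : SimpleGraph (Fin n) // IsPerfect G}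

/-- independence number -/
def indepNum {V : Type*} (G : SimpleGraph V) : ℕ := Gᶜ.cliqueNum

/-- `H(G) = max{α(G), ω(G)}` -/
def HNum {V : Type*} (G : SimpleGraph V) : ℕ := max (indepNum G) G.cliqueNum

section Counting

variable {α β ι : Type*}

/-- The number of elements of `α` satisfying `P`. -/
def cnt (P : α → Prop) : ℕ := Nat.card {x // P x}

theorem cnt_mono [Finite α] {P Q : α → Prop} (h : ∀ x, P x → Q x) : cnt P ≤ cnt Q :=
  Nat.card_le_card_of_injective (fun x : {x // P x} => (⟨x.1, h _ x.2⟩ : {x // Q x}))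
    (fun x y hxy => Subtype.ext (by simpa using hxy))

theorem cnt_eq_card_filter [Fintype α] (P : α → Prop) [DecidablePred P] :
    cnt P = (Finset.univ.filter P).card := by
  rw [cnt, Nat.card_eq_fintype_card, Fintype.card_subtype]

theorem cnt_le_of_injOn [Finite β] {P : α → Prop} {Q : β → Prop} (f : α → β)
    (hf : ∀ x, P x → Q (f x)) (hinj : ∀ x y, P x → P y → f x = f y → x = y) :
    cnt P ≤ cnt Q :=
  Nat.card_le_card_of_injective (fun x : {x // P x} => (⟨f x.1, hf _ x.2⟩ : {x // Q x}))
    (fun x y hxy => Subtype.ext (hinj _ _ x.2 y.2 (congrArg Subtype.val hxy)))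

theorem cnt_le_card [Finite α] (P : α → Prop) : cnt P ≤ Nat.card α :=
  Nat.card_le_card_of_injective _ Subtype.val_injective

theorem cnt_or_le [Finite α] (P Q : α → Prop) :
    cnt (fun x => P x ∨ Q x) ≤ cnt P + cnt Q := by
  have := Fintype.ofFinite α
  simp only [cnt_eq_card_filter]
  refine le_trans (Finset.card_le_card fun x hx => ?_) (Finset.card_union_le _ _)
  simpa using hx

theorem cnt_add_le [Finite α] {P Q R : α → Prop} (hd : ∀ x, P x → ¬Q x) (hP : ∀ x, P x → R x)
    (hQ : ∀ x, Q x → R x) : cnt P + cnt Q ≤ cnt R := by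
  have := Fintype.ofFinite α
  simp only [cnt_eq_card_filter]
  rw [← Finset.card_union_of_disjoint
    (Finset.disjoint_filter.2 fun x _ hx => hd x hx)]
  refine Finset.card_le_card fun x hx => Finset.mem_filter.2 ⟨Finset.mem_univ _, ?_⟩
  exact (Finset.mem_union.1 hx).elim (fun h => hP x (Finset.mem_filter.1 h).2)
    (fun h => hQ x (Finset.mem_filter.1 h).2)

theorem cnt_le_sum [Finite α] {P : α → Prop} (s : Finset ι) (Q : ι → α → Prop)
    (h : ∀ x, P x → ∃ i ∈ s, Q i x) : cnt P ≤ ∑ i ∈ s, cnt (Q i) := by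
  have := Fintype.ofFinite α
  simp only [cnt_eq_card_filter]
  refine le_trans (Finset.card_le_card (t := s.biUnion fun i => Finset.univ.filter (Q i)) ?_)
    Finset.card_biUnion_le
  intro x hx
  obtain ⟨i, hi, hq⟩ := h x (Finset.mem_filter.1 hx).2
  exact Finset.mem_biUnion.2 ⟨i, hi, by simpa using hq⟩

/-- A count is bounded by (number of values of an invariant) times (largest fibre). -/
theorem cnt_le_mul [Finite α] [Finite β] {P : α → Prop} {Q : β → Prop} (f : α → β) (k : ℕ)
    (hf : ∀ x, P x → Q (f x)) (hk : ∀ y, Q y → cnt (fun x => P x ∧ f x = y) ≤ k) :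
    cnt P ≤ cnt Q * k := by
  have := Fintype.ofFinite β
  calc cnt P ≤ ∑ y ∈ Finset.univ.filter Q, cnt (fun x => P x ∧ f x = y) :=
        cnt_le_sum _ _ fun x hx => ⟨f x, by simpa using hf x hx, hx, rfl⟩
    _ ≤ ∑ _y ∈ Finset.univ.filter Q, k :=
        Finset.sum_le_sum fun y hy => hk y (Finset.mem_filter.1 hy).2
    _ = cnt Q * k := by rw [Finset.sum_const, cnt_eq_card_filter, smul_eq_mul]

/-- A count is bounded by (number of codes) times (largest number of objects per code). -/
theorem cnt_le_mul_of_exists [Finite α] [Finite β] {P : α → Prop} {Q : β → Prop}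
    {R : β → α → Prop} (k : ℕ) (hf : ∀ x, P x → ∃ y, Q y ∧ R y x)
    (hk : ∀ y, Q y → cnt (R y) ≤ k) : cnt P ≤ cnt Q * k := by
  have := Fintype.ofFinite β
  calc cnt P ≤ ∑ y ∈ Finset.univ.filter Q, cnt (R y) :=
        cnt_le_sum _ _ fun x hx => by
          obtain ⟨y, hy, hr⟩ := hf x hx
          exact ⟨y, by simpa using hy, hr⟩
    _ ≤ ∑ _y ∈ Finset.univ.filter Q, k :=
        Finset.sum_le_sum fun y hy => hk y (Finset.mem_filter.1 hy).2
    _ = cnt Q * k := by rw [Finset.sum_const, cnt_eq_card_filter, smul_eq_mul]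

theorem cnt_prod (P : α → Prop) (Q : β → Prop) :
    cnt (fun x : α × β => P x.1 ∧ Q x.2) = cnt P * cnt Q := by
  rw [cnt, cnt, cnt, ← Nat.card_prod]
  exact Nat.card_congr
    { toFun := fun x => (⟨x.1.1, x.2.1⟩, ⟨x.1.2, x.2.2⟩)
      invFun := fun x => ⟨(x.1.1, x.2.1), x.1.2, x.2.2⟩
      left_inv := fun _ => rfl
      right_inv := fun _ => rfl }

theorem cnt_true (α : Type*) : cnt (fun _ : α => True) = Nat.card α :=
  Nat.card_congr (Equiv.subtypeUnivEquiv fun _ => trivial)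

theorem cnt_le_one {P : α → Prop} (h : ∀ x y, P x → P y → x = y) : cnt P ≤ 1 := by
  have : Subsingleton {x // P x} := ⟨fun x y => Subtype.ext (h _ _ x.2 y.2)⟩
  exact Finite.card_le_one_iff_subsingleton.2 this

theorem cnt_equiv (e : α ≃ β) (P : β → Prop) : cnt (fun x => P (e x)) = cnt P :=
  Nat.card_congr (e.subtypeEquiv fun _ => Iff.rfl)

end Counting

section Tame

variable {V W : Type*}

/-- `G` has no induced path on three vertices inside `U`. -/
def ClusterOn (G : SimpleGraph V) (U : Set V) : Prop :=
  ∀ x ∈ U, ∀ y ∈ U, ∀ z ∈ U, G.Adj x y → G.Adj y z → x ≠ z → G.Adj x z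

/-- No induced five-cycle, and every ten vertices contain a homogeneous quadruple. -/
structure Tame (G : SimpleGraph V) : Prop where
  c5 : ∀ a b c d e, G.Adj a b → G.Adj b c → G.Adj c d → G.Adj d e → G.Adj e a →
    ¬G.Adj a c → ¬G.Adj b d → ¬G.Adj c e → ¬G.Adj d a → ¬G.Adj e b → False
  hom : ∀ s : Finset V, s.card = 10 → ∃ t ⊆ s, t.card = 4 ∧
    (G.IsClique (t : Set V) ∨ Gᶜ.IsClique (t : Set V))

theorem Tame.compl {G : SimpleGraph V} (h : Tame G) : Tame Gᶜ where
  c5 := by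
    intro a b c d e hab hbc hcd hde hea hac hbd hce hda heb
    have key : ∀ x y, x ≠ y → ¬Gᶜ.Adj x y → G.Adj x y := fun x y hne hn => by
      by_contra h
      exact hn ((SimpleGraph.compl_adj _ _ _).2 ⟨hne, h⟩)
    have ac : a ≠ c := fun h => hda (h ▸ hcd.symm)
    have bd : b ≠ d := fun h => heb (h ▸ hde.symm)
    have ce : c ≠ e := fun h => hac (h ▸ hea.symm)
    have da : d ≠ a := fun h => hbd (h ▸ hab.symm)
    have eb : e ≠ b := fun h => hce (h ▸ hbc.symm)
    exact h.c5 a c e b d (key _ _ ac hac) (key _ _ ce hce) (key _ _ eb heb) (key _ _ bd hbd)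
      (key _ _ da hda) (fun h => hea.2 h.symm) (fun h => hbc.2 h.symm) (fun h => hde.2 h.symm)
      (fun h => hab.2 h.symm) (fun h => hcd.2 h.symm)
  hom := by
    intro s hs
    obtain ⟨t, hts, ht, h⟩ := h.hom s hs
    exact ⟨t, hts, ht, by rw [compl_compl]; exact h.symm⟩

theorem Tame.comap {G : SimpleGraph W} (h : Tame G) (f : V ↪ W) : Tame (G.comap f) where
  c5 := fun a b c d e => h.c5 (f a) (f b) (f c) (f d) (f e)
  hom := by
    intro s hs
    obtain ⟨t, hts, ht, h⟩ := h.hom (s.map f) (by simpa using hs)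
    obtain ⟨u, hus, rfl⟩ := Finset.subset_map_iff.1 hts
    refine ⟨u, hus, by simpa using ht, ?_⟩
    refine h.imp (fun h x hx y hy hne => ?_) (fun h x hx y hy hne => ?_)
    · exact h (by simpa using hx) (by simpa using hy) (f.injective.ne hne)
    · have := h (by simpa using hx) (by simpa using hy) (f.injective.ne hne)
      exact ⟨hne, this.2⟩

theorem SimpleGraph.isClique_induce_map {G : SimpleGraph V} {s : Set V} {t : Finset s}
    (h : (G.induce s).IsClique (t : Set s)) :
    G.IsClique ((t.map (Function.Embedding.subtype _) : Finset V) : Set V) := by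
  intro x hx y hy hne
  simp only [Finset.coe_map, Function.Embedding.subtype_apply, Set.mem_image] at hx hy
  obtain ⟨x', hx', rfl⟩ := hx
  obtain ⟨y', hy', rfl⟩ := hy
  exact h hx' hy' (fun h => hne (congrArg _ h))

theorem IsPerfect.exists_coloring [Finite V] {G : SimpleGraph V} (h : IsPerfect G)
    (s : Finset V) : ∃ t ⊆ s, G.IsClique (t : Set V) ∧ ∃ c : V → ℕ,
      (∀ x ∈ s, c x < t.card) ∧ ∀ x ∈ s, ∀ y ∈ s, G.Adj x y → c x ≠ c y := by
  have := Fintype.ofFinite V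
  obtain ⟨t, ht⟩ := (G.induce (s : Set V)).exists_isNClique_cliqueNum
  have hcol : (G.induce (s : Set V)).Colorable t.card :=
    SimpleGraph.chromaticNumber_le_iff_colorable.1 (by rw [h s, ht.card_eq])
  obtain ⟨c⟩ := hcol
  refine ⟨t.map (Function.Embedding.subtype _), ?_,
    SimpleGraph.isClique_induce_map ht.isClique,
    fun x => if hx : x ∈ s then c ⟨x, hx⟩ else 0, fun x hx => ?_, fun x hx y hy hxy => ?_⟩
  · intro x hx
    simp only [Finset.mem_map, Function.Embedding.subtype_apply] at hx
    obtain ⟨y, -, rfl⟩ := hx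
    exact y.2
  · simp only [dif_pos hx, Finset.card_map]
    exact (c ⟨x, hx⟩).2
  · simp only [dif_pos hx, dif_pos hy]
    exact fun he => c.valid (show (G.induce (s : Set V)).Adj ⟨x, hx⟩ ⟨y, hy⟩ from hxy)
      (Fin.ext he)

theorem IsPerfect.tame [Finite V] {G : SimpleGraph V} (h : IsPerfect G) : Tame G where
  c5 := by
    intro a b c d e hab hbc hcd hde hea hac hbd hce hda heb
    obtain ⟨t, hts, ht, col, hlt, hcol⟩ := h.exists_coloring {a, b, c, d, e}
    have h2 : t.card ≤ 2 := by
      by_contra! h3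
      obtain ⟨x, y, z, hx, hy, hz, hxy, hxz, hyz⟩ := Finset.two_lt_card_iff.1 h3
      have hX := hts hx
      have hY := hts hy
      have hZ := hts hz
      have h1 := ht hx hy hxy
      have h2 := ht hx hz hxz
      have h3 := ht hy hz hyz
      simp only [Finset.mem_insert, Finset.mem_singleton] at hX hY hZ
      have := hab.symm
      have := hbc.symm
      have := hcd.symm
      have := hde.symm
      have := hea.symm
      have n1 : ¬G.Adj c a := fun h => hac h.symm
      have n2 : ¬G.Adj d b := fun h => hbd h.symm
      have n3 : ¬G.Adj e c := fun h => hce h.symm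
      have n4 : ¬G.Adj a d := fun h => hda h.symm
      have n5 : ¬G.Adj b e := fun h => heb h.symm
      rcases hX with rfl | rfl | rfl | rfl | rfl <;> rcases hY with rfl | rfl | rfl | rfl | rfl <;>
        first
        | contradiction
        | (rcases hZ with rfl | rfl | rfl | rfl | rfl <;> contradiction)
    have e1 := hcol a (by simp) b (by simp) hab
    have e2 := hcol b (by simp) c (by simp) hbc
    have e3 := hcol c (by simp) d (by simp) hcd
    have e4 := hcol d (by simp) e (by simp) hde
    have e5 := hcol e (by simp) a (by simp) hea
    have := hlt a (by simp)
    have := hlt b (by simp)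
    have := hlt c (by simp)
    have := hlt d (by simp)
    have := hlt e (by simp)
    omega
  hom := by
    intro s hs
    obtain ⟨t, hts, ht, col, hlt, hcol⟩ := h.exists_coloring s
    by_cases h4 : 4 ≤ t.card
    · obtain ⟨u, hut, hu⟩ := Finset.exists_subset_card_eq h4
      exact ⟨u, hut.trans hts, hu, Or.inl (ht.subset (by exact_mod_cast hut))⟩
    · obtain ⟨y, -, hy⟩ := Finset.exists_lt_card_fiber_of_mul_lt_card_of_maps_to
        (f := col) (s := s) (t := Finset.range t.card) (n := 3)
        (fun x hx => Finset.mem_range.2 (hlt x hx)) (by rw [Finset.card_range, hs]; omega)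
      obtain ⟨u, huf, hu⟩ := Finset.exists_subset_card_eq (Nat.succ_le_of_lt hy)
      refine ⟨u, huf.trans (Finset.filter_subset _ _), hu, Or.inr ?_⟩
      intro x hx z hz hne
      have hx' := Finset.mem_filter.1 (huf hx)
      have hz' := Finset.mem_filter.1 (huf hz)
      exact ⟨hne, fun h => hcol x hx'.1 z hz'.1 h (hx'.2.trans hz'.2.symm)⟩

end Tame

section GenSplit

variable {V : Type*}

theorem ClusterOn.mono {G : SimpleGraph V} {U W : Set V} (h : ClusterOn G U) (hW : W ⊆ U) :
    ClusterOn G W :=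
  fun x hx y hy z hz => h x (hW hx) y (hW hy) z (hW hz)

theorem isUnipolarArrangement_iff {G : SimpleGraph V} {C : Set V} :
    IsUnipolarArrangement G C ↔ G.IsClique C ∧ ClusterOn G Cᶜ := by
  refine and_congr_right fun _ => ⟨fun h x hx y hy z hz hxy hyz hne => ?_, fun h u v huv hne => ?_⟩
  · have h1 : (G.induce Cᶜ).Adj ⟨x, hx⟩ ⟨y, hy⟩ := hxy
    have h2 : (G.induce Cᶜ).Adj ⟨y, hy⟩ ⟨z, hz⟩ := hyz
    exact h ⟨x, hx⟩ ⟨z, hz⟩ (h1.reachable.trans h2.reachable)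
      (fun he => hne (congrArg Subtype.val he))
  · obtain ⟨p⟩ := huv
    have key : ∀ a b : (Cᶜ : Set V), (G.induce Cᶜ).Walk a b → a = b ∨ (G.induce Cᶜ).Adj a b := by
      intro a b p
      induction p with
      | nil => exact Or.inl rfl
      | @cons a b c hab _ ih =>
        by_cases hac : a = c
        · exact Or.inl hac
        · right
          rcases ih with rfl | hbc
          · exact hab
          · exact h a.1 a.2 b.1 b.2 c.1 c.2 hab hbc (fun he => hac (Subtype.ext he))
    exact (key u v p).resolve_left hne

/-- Being equal or adjacent is an equivalence relation on a set on which `G` is a disjoint union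
of cliques. -/
def ClusterOn.setoid {G : SimpleGraph V} {U : Set V} (h : ClusterOn G U) : Setoid U where
  r u v := u = v ∨ G.Adj u v
  iseqv :=
    { refl := fun _ => Or.inl rfl
      symm := fun h => h.imp Eq.symm fun h => h.symm
      trans := by
        intro u v w huv hvw
        by_cases huw : u = w
        · exact Or.inl huw
        · rcases huv with rfl | huv
          · exact hvw
          · rcases hvw with rfl | hvw
            · exact Or.inr huv
            · exact Or.inr (h u u.2 v v.2 w w.2 huv hvw fun he => huw (Subtype.ext he)) }

theorem exists_matching_to_centre [Finite V] {G : SimpleGraph V} {C K : Finset V}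
    (hC : G.IsClique (C : Set V)) (hK : G.IsClique (K : Set V)) (hKC : Disjoint K C) :
    ∃ f : V → C ⊕ Fin (G.cliqueNum - C.card), Set.InjOn f K ∧
      ∀ v ∈ K, ∀ c, f v = Sum.inl c → ¬G.Adj v c := by
  have := Fintype.ofFinite V
  have hCle : C.card ≤ G.cliqueNum := SimpleGraph.IsClique.card_le_cliqueNum (t := C) (tc := hC)
  let t : K → Finset (C ⊕ Fin (G.cliqueNum - C.card)) := fun v =>
    (Finset.univ.filter fun c : C => ¬G.Adj v c).disjSum Finset.univ
  have hall : ∀ s : Finset K, s.card ≤ (s.biUnion t).card := by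
    intro s
    rcases s.eq_empty_or_nonempty with rfl | ⟨v₀, hv₀⟩
    · simp
    let N : Finset C := Finset.univ.filter fun c => ∃ v ∈ s, ¬G.Adj v c
    have hsub : N.disjSum Finset.univ ⊆ s.biUnion t := by
      intro x hx
      rcases Finset.mem_disjSum.1 hx with ⟨c, hc, rfl⟩ | ⟨i, -, rfl⟩
      · obtain ⟨v, hv, hvc⟩ := (Finset.mem_filter.1 hc).2
        exact Finset.mem_biUnion.2 ⟨v, hv, Finset.inl_mem_disjSum.2 (by simpa using hvc)⟩
      · exact Finset.mem_biUnion.2 ⟨v₀, hv₀, Finset.inr_mem_disjSum.2 (Finset.mem_univ _)⟩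
    refine le_trans ?_ (Finset.card_le_card hsub)
    rw [Finset.card_disjSum, Finset.card_univ, Fintype.card_fin]
    let S : Finset V := s.map (Function.Embedding.subtype _)
    let D : Finset V := (Nᶜ).map (Function.Embedding.subtype _)
    have hSK : ∀ x ∈ S, x ∈ K := by
      intro x hx
      obtain ⟨y, -, rfl⟩ := Finset.mem_map.1 hx
      exact y.2
    have hDC : ∀ x ∈ D, x ∈ C := by
      intro x hx
      obtain ⟨y, -, rfl⟩ := Finset.mem_map.1 hx
      exact y.2
    have hSD : ∀ x ∈ S, ∀ y ∈ D, G.Adj x y := by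
      intro x hx y hy
      obtain ⟨x', hx', rfl⟩ := Finset.mem_map.1 hx
      obtain ⟨y', hy', rfl⟩ := Finset.mem_map.1 hy
      by_contra hn
      exact (Finset.mem_compl.1 hy') (Finset.mem_filter.2 ⟨Finset.mem_univ _, x', hx', hn⟩)
    have hdis : Disjoint S D := Finset.disjoint_left.2 fun x hx hx' =>
      Finset.disjoint_left.1 hKC (hSK x hx) (hDC x hx')
    have hcl : G.IsClique ((S ∪ D : Finset V) : Set V) := by
      intro x hx y hy hne
      rcases Finset.mem_union.1 hx with hx | hx <;> rcases Finset.mem_union.1 hy with hy | hy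
      · exact hK (hSK x hx) (hSK y hy) hne
      · exact hSD x hx y hy
      · exact (hSD y hy x hx).symm
      · exact hC (hDC x hx) (hDC y hy) hne
    have h1 := SimpleGraph.IsClique.card_le_cliqueNum (t := S ∪ D) (tc := hcl)
    rw [Finset.card_union_of_disjoint hdis, Finset.card_map, Finset.card_map,
      Finset.card_compl, Fintype.card_coe] at h1
    have h2 : N.card ≤ C.card := by simpa using Finset.card_le_univ N
    omega
  obtain ⟨f, hf, hft⟩ := (Finset.all_card_le_biUnion_card_iff_exists_injective t).1 hall
  by_cases hne : K.Nonempty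
  · obtain ⟨k₀, hk₀⟩ := hne
    refine ⟨fun v => if hv : v ∈ K then f ⟨v, hv⟩ else f ⟨k₀, hk₀⟩, fun u hu v hv huv => ?_,
      fun v hv c hc => ?_⟩
    · have hu' : u ∈ K := hu
      have hv' : v ∈ K := hv
      simp only [dif_pos hu', dif_pos hv'] at huv
      exact congrArg Subtype.val (hf huv)
    · simp only [dif_pos hv] at hc
      have := hft ⟨v, hv⟩
      rw [hc] at this
      simpa using Finset.inl_mem_disjSum.1 this
  · rw [Finset.not_nonempty_iff_eq_empty] at hne
    subst hne
    by_cases hV : Nonempty V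
    · obtain ⟨v⟩ := hV
      have hpos : 1 ≤ G.cliqueNum := by
        have h := SimpleGraph.IsClique.card_le_cliqueNum (G := G) (t := {v}) (tc := by simp)
        simpa using h
      by_cases hC0 : C.Nonempty
      · obtain ⟨c, hc⟩ := hC0
        exact ⟨fun _ => Sum.inl ⟨c, hc⟩, by simp, by simp⟩
      · rw [Finset.not_nonempty_iff_eq_empty] at hC0
        subst hC0
        exact ⟨fun _ => Sum.inr ⟨0, by simp only [Finset.card_empty]; omega⟩, by simp, by simp⟩
    · exact ⟨fun v => (hV ⟨v⟩).elim, by simp, by simp⟩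

theorem IsUnipolar.colorable [Finite V] {G : SimpleGraph V} (h : IsUnipolar G) :
    G.Colorable G.cliqueNum := by
  have := Fintype.ofFinite V
  obtain ⟨C', hC'⟩ := h
  obtain ⟨hC, hU⟩ := isUnipolarArrangement_iff.1 hC'
  let C : Finset V := C'.toFinset
  have hmem : ∀ v, v ∈ C ↔ v ∈ C' := fun v => Set.mem_toFinset
  have hCc : G.IsClique (C : Set V) := by simpa [C] using hC
  let K : V → Finset V := fun v => Finset.univ.filter fun u => u ∉ C ∧ (u = v ∨ G.Adj u v)
  have hKcl : ∀ v, v ∉ C → G.IsClique (K v : Set V) := by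
    intro v hv x hx y hy hne
    obtain ⟨hx, hxv⟩ := (Finset.mem_filter.1 hx).2
    obtain ⟨hy, hyv⟩ := (Finset.mem_filter.1 hy).2
    rw [hmem] at hx hy hv
    rcases hxv with rfl | hxv
    · exact (hyv.resolve_left (Ne.symm hne)).symm
    · rcases hyv with rfl | hyv
      · exact hxv
      · exact hU x hx v hv y hy hxv hyv.symm hne
  have hKC : ∀ v, Disjoint (K v) C := fun v => Finset.disjoint_left.2 fun x hx =>
    (Finset.mem_filter.1 hx).2.1
  have hsame : ∀ u v, u ∉ C → v ∉ C → G.Adj u v → K u = K v := by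
    have half : ∀ u v, u ∉ C → v ∉ C → G.Adj u v → K u ⊆ K v := by
      intro u v hu hv huv x hx
      obtain ⟨hx, hxu⟩ := (Finset.mem_filter.1 hx).2
      refine Finset.mem_filter.2 ⟨Finset.mem_univ _, hx, ?_⟩
      by_cases hxv : x = v
      · exact Or.inl hxv
      · right
        rcases hxu with rfl | hxu
        · exact huv
        · exact hU x (fun h => hx ((hmem _).2 h)) u (fun h => hu ((hmem _).2 h)) v
            (fun h => hv ((hmem _).2 h)) hxu huv hxv
    exact fun u v hu hv huv => (half u v hu hv huv).antisymm (half v u hv hu huv.symm)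
  have hsel : ∀ L : Finset V, ∃ f : V → C ⊕ Fin (G.cliqueNum - C.card),
      G.IsClique (L : Set V) → Disjoint L C → Set.InjOn f L ∧
        ∀ v ∈ L, ∀ c, f v = Sum.inl c → ¬G.Adj v c := by
    intro L
    by_cases h1 : G.IsClique (L : Set V)
    · by_cases h2 : Disjoint L C
      · obtain ⟨f, hf⟩ := exists_matching_to_centre hCc h1 h2
        exact ⟨f, fun _ _ => hf⟩
      · obtain ⟨f, -⟩ := exists_matching_to_centre (K := ∅) hCc (by simp) (by simp)
        exact ⟨f, fun _ h => (h2 h).elim⟩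
    · obtain ⟨f, -⟩ := exists_matching_to_centre (K := ∅) hCc (by simp) (by simp)
      exact ⟨f, fun h => (h1 h).elim⟩
  choose f hf using hsel
  have hself : ∀ v, v ∉ C → v ∈ K v := fun v hv =>
    Finset.mem_filter.2 ⟨Finset.mem_univ _, hv, Or.inl rfl⟩
  let col : V → C ⊕ Fin (G.cliqueNum - C.card) := fun v =>
    if hv : v ∈ C then Sum.inl ⟨v, hv⟩ else f (K v) v
  have hcross : ∀ u v, u ∈ C → v ∉ C → G.Adj u v → col u ≠ col v := by
    intro u v hu hv huv he
    simp only [col, dif_pos hu, dif_neg hv] at he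
    exact (hf (K v) (hKcl v hv) (hKC v)).2 v (hself v hv) _ he.symm huv.symm
  have hvalid : ∀ u v, G.Adj u v → col u ≠ col v := by
    intro u v huv
    by_cases hu : u ∈ C <;> by_cases hv : v ∈ C
    · simp only [col, dif_pos hu, dif_pos hv]
      intro he
      exact huv.ne (congrArg Subtype.val (Sum.inl.inj he))
    · exact hcross u v hu hv huv
    · exact (hcross v u hv hu huv.symm).symm
    · simp only [col, dif_neg hu, dif_neg hv]
      rw [hsame u v hu hv huv]
      intro he
      refine huv.ne ((hf (K v) (hKcl v hv) (hKC v)).1 ?_ (hself v hv) he)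
      rw [← hsame u v hu hv huv]
      exact hself u hu
  have hCle : C.card ≤ G.cliqueNum := SimpleGraph.IsClique.card_le_cliqueNum (t := C) (tc := hCc)
  have hc := (SimpleGraph.Coloring.mk col (fun {u v} h => hvalid u v h)).colorable
  rw [Fintype.card_sum, Fintype.card_coe, Fintype.card_fin, Nat.add_sub_cancel' hCle] at hc
  exact hc

theorem IsUnipolar.colorable_compl [Finite V] {H : SimpleGraph V} (h : IsUnipolar H) :
    Hᶜ.Colorable Hᶜ.cliqueNum := by
  have := Fintype.ofFinite V
  obtain ⟨C, hC'⟩ := h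
  obtain ⟨hC, hU⟩ := isUnipolarArrangement_iff.1 hC'
  let Q := Quotient hU.setoid
  have := Fintype.ofFinite Q
  let mk : (Cᶜ : Set V) → Q := Quotient.mk hU.setoid
  have hmk : ∀ u v : (Cᶜ : Set V), mk u = mk v → u = v ∨ H.Adj u v := fun u v h =>
    Quotient.exact h
  have htrans : ∀ g : Q → (Cᶜ : Set V), (∀ q, mk (g q) = q) → ∃ T : Finset V,
      T.card = Fintype.card Q ∧ Hᶜ.IsClique (T : Set V) ∧ ∀ x ∈ T, ∃ q, x = g q := by
    intro g hg
    have hinj : Function.Injective fun q => (g q : V) := fun p q hpq => by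
      have : g p = g q := Subtype.ext hpq
      rw [← hg p, this, hg q]
    refine ⟨Finset.univ.map ⟨_, hinj⟩, by rw [Finset.card_map, Finset.card_univ], ?_, ?_⟩
    · intro x hx y hy hne
      obtain ⟨p, -, rfl⟩ := Finset.mem_map.1 hx
      obtain ⟨q, -, rfl⟩ := Finset.mem_map.1 hy
      refine ⟨hne, fun hadj => hne ?_⟩
      have : mk (g p) = mk (g q) := Quotient.sound (Or.inr hadj)
      rw [hg, hg] at this
      rw [this]
    · intro x hx
      obtain ⟨q, -, rfl⟩ := Finset.mem_map.1 hx
      exact ⟨q, rfl⟩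
  have hr : Fintype.card Q ≤ Hᶜ.cliqueNum := by
    obtain ⟨T, hT, hTc, -⟩ := htrans Quotient.out fun q => Quotient.out_eq q
    rw [← hT]
    exact SimpleGraph.IsClique.card_le_cliqueNum (t := T) (tc := hTc)
  by_cases hlt : Fintype.card Q + 1 ≤ Hᶜ.cliqueNum
  · let col : V → Option Q := fun v => if hv : v ∈ C then none else some (mk ⟨v, hv⟩)
    have hvalid : ∀ u v, Hᶜ.Adj u v → col u ≠ col v := by
      intro u v huv he
      by_cases hu : u ∈ C <;> by_cases hv : v ∈ C <;>
        simp only [col, dif_pos, dif_neg, hu, hv, not_false_eq_true, reduceCtorEq,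
          Option.some.injEq] at he
      · exact huv.2 (hC hu hv huv.1)
      · rcases hmk _ _ he with he | he
        · exact huv.1 (congrArg Subtype.val he)
        · exact huv.2 he
    have hc := (SimpleGraph.Coloring.mk col (fun {u v} h => hvalid u v h)).colorable
    rw [Fintype.card_option] at hc
    exact hc.mono hlt
  · have hcomp : ∀ v, v ∈ C → ∃ q : Q, ∀ u : (Cᶜ : Set V), mk u = q → H.Adj v u := by
      intro v hv
      by_contra! hno
      choose g hg hgv using hno
      obtain ⟨T, hT, hTc, hTm⟩ := htrans g hg
      have hvT : v ∉ T := fun h => by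
        obtain ⟨q, rfl⟩ := hTm v h
        exact (g q).2 hv
      have hcl : Hᶜ.IsClique ((insert v T : Finset V) : Set V) := by
        rw [Finset.coe_insert, SimpleGraph.isClique_insert]
        refine ⟨hTc, fun x hx hne => ⟨hne, ?_⟩⟩
        obtain ⟨q, rfl⟩ := hTm x hx
        exact hgv q
      have := SimpleGraph.IsClique.card_le_cliqueNum (t := insert v T) (tc := hcl)
      rw [Finset.card_insert_of_notMem hvT] at this
      omega
    choose q hq using hcomp
    let col : V → Q := fun v => if hv : v ∈ C then q v hv else mk ⟨v, hv⟩
    have hvalid : ∀ u v, Hᶜ.Adj u v → col u ≠ col v := by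
      intro u v huv he
      by_cases hu : u ∈ C <;> by_cases hv : v ∈ C <;>
        simp only [col, dif_pos, dif_neg, hu, hv, not_false_eq_true] at he
      · exact huv.2 (hC hu hv huv.1)
      · exact huv.2 (hq u hu ⟨v, hv⟩ he.symm)
      · exact huv.2 (hq v hv ⟨u, hu⟩ he).symm
      · rcases hmk _ _ he with he | he
        · exact huv.1 (congrArg Subtype.val he)
        · exact huv.2 he
    exact (SimpleGraph.Coloring.mk col (fun {u v} h => hvalid u v h)).colorable.mono hr

theorem IsUnipolar.induce {G : SimpleGraph V} (h : IsUnipolar G) (s : Set V) :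
    IsUnipolar (G.induce s) := by
  obtain ⟨C, hC'⟩ := h
  obtain ⟨hC, hU⟩ := isUnipolarArrangement_iff.1 hC'
  refine ⟨{x | x.1 ∈ C}, isUnipolarArrangement_iff.2 ⟨?_, ?_⟩⟩
  · exact fun x hx y hy hne => hC hx hy (fun h => hne (Subtype.ext h))
  · exact fun x hx y hy z hz hxy hyz hne => hU x hx y hy z hz hxy hyz
      (fun h => hne (Subtype.ext h))

theorem isPerfect_of_colorable [Finite V] {G : SimpleGraph V}
    (h : ∀ s : Set V, (G.induce s).Colorable (G.induce s).cliqueNum) : IsPerfect G :=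
  fun s => le_antisymm (SimpleGraph.chromaticNumber_le_iff_colorable.2 (h s))
    SimpleGraph.cliqueNum_le_chromaticNumber

theorem IsUnipolar.isPerfect [Finite V] {G : SimpleGraph V} (h : IsUnipolar G) : IsPerfect G :=
  isPerfect_of_colorable fun s => (h.induce s).colorable

theorem IsCoUnipolar.isPerfect [Finite V] {G : SimpleGraph V} (h : IsCoUnipolar G) :
    IsPerfect G := by
  refine isPerfect_of_colorable fun s => ?_
  have hc : (G.induce s) = (Gᶜ.induce s)ᶜ := by
    ext x y
    simp only [SimpleGraph.comap_adj, SimpleGraph.compl_adj, Function.Embedding.subtype_apply]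
    constructor
    · exact fun hxy => ⟨fun he => hxy.ne (congrArg _ he), fun hn => hn.2 hxy⟩
    · rintro ⟨hne, hn⟩
      by_contra hxy
      exact hn ⟨fun he => hne (Subtype.ext he), hxy⟩
  rw [hc]
  exact (IsUnipolar.induce h s).colorable_compl

end GenSplit

section DisjointTuples

variable {V : Type*} {r : ℕ}

/-- A family of pairwise disjoint injective `r`-tuples. -/
structure DisjFam (M : Finset (Fin r → V)) : Prop where
  inj : ∀ e ∈ M, Function.Injective e
  disj : ∀ e ∈ M, ∀ e' ∈ M, e ≠ e' → ∀ a b, e a ≠ e' b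

theorem DisjFam.subset {M N : Finset (Fin r → V)} (h : DisjFam M) (hN : N ⊆ M) : DisjFam N :=
  ⟨fun e he => h.inj e (hN he), fun e he e' he' => h.disj e (hN he) e' (hN he')⟩

/-- Either there are `k` disjoint tuples with property `P`, or few vertices meet all of them. -/
theorem exists_disjFam_or_hitting [NeZero r] (P : (Fin r → V) → Prop)
    (hP : ∀ e, P e → Function.Injective e) (k : ℕ) :
    (∃ M : Finset (Fin r → V), DisjFam M ∧ M.card = k ∧ ∀ e ∈ M, P e) ∨
      ∃ E : Finset V, E.card ≤ r * k ∧ ∀ e, P e → ∃ a, e a ∈ E := by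
  induction k with
  | zero => exact Or.inl ⟨∅, ⟨by simp, by simp⟩, by simp, by simp⟩
  | succ k ih =>
    rcases ih with ⟨M, hM, hk, hMP⟩ | ⟨E, hE, hEP⟩
    · let E : Finset V := M.biUnion fun e => Finset.univ.image e
      by_cases hall : ∀ e, P e → ∃ a, e a ∈ E
      · refine Or.inr ⟨E, ?_, hall⟩
        calc E.card ≤ M.card * r := Finset.card_biUnion_le_card_mul _ _ _ fun e _ =>
              Finset.card_image_le.trans (by simp)
          _ ≤ r * (k + 1) := by rw [hk, mul_comm]; exact Nat.mul_le_mul_left _ (Nat.le_succ k)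
      · push Not at hall
        obtain ⟨e, he, hne⟩ := hall
        have hdis : ∀ e' ∈ M, ∀ a b, e a ≠ e' b := fun e' he' a b hab =>
          hne a (Finset.mem_biUnion.2 ⟨e', he', Finset.mem_image.2 ⟨b, Finset.mem_univ _, hab.symm⟩⟩)
        have heM : e ∉ M := fun h => hdis e h 0 0 rfl
        refine Or.inl ⟨insert e M, ⟨?_, ?_⟩, by rw [Finset.card_insert_of_notMem heM, hk], ?_⟩
        · intro f hf
          rcases Finset.mem_insert.1 hf with rfl | hf
          exacts [hP _ he, hM.inj f hf]
        · intro f hf g hg hfg a b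
          rcases Finset.mem_insert.1 hf with hf | hf <;> rcases Finset.mem_insert.1 hg with hg | hg
          · exact (hfg (hf.trans hg.symm)).elim
          · exact hf ▸ hdis g hg a b
          · exact hg ▸ fun h => hdis f hf b a h.symm
          · exact hM.disj _ hf _ hg hfg a b
        · intro f hf
          rcases Finset.mem_insert.1 hf with rfl | hf
          exacts [he, hMP f hf]
    · exact Or.inr ⟨E, hE.trans (Nat.mul_le_mul_left _ (Nat.le_succ k)), hEP⟩

end DisjointTuples

section Avoiding

variable {X ι : Type*} {r : ℕ}

/-- The number of Boolean functions avoiding a prescribed pattern on each of several disjoint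
cells of size `r`. -/
theorem cnt_avoid [Finite X] (s : Finset ι) (D : ι → Fin r → X) (p : ι → Fin r → Bool)
    (hinj : ∀ i ∈ s, Function.Injective (D i))
    (hdisj : ∀ i ∈ s, ∀ j ∈ s, i ≠ j → ∀ a b, D i a ≠ D j b) :
    cnt (fun f : X → Bool => ∀ i ∈ s, ∃ a, f (D i a) ≠ p i a) * (2 ^ r) ^ s.card ≤
      2 ^ Nat.card X * (2 ^ r - 1) ^ s.card := by
  induction s using Finset.induction_on with
  | empty =>
    simp only [Finset.card_empty, pow_zero, mul_one]
    refine (cnt_le_card _).trans (le_of_eq ?_)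
    have := Fintype.ofFinite X
    simp
  | insert i s hi ih =>
    have ih := ih (fun j hj => hinj j (Finset.mem_insert_of_mem hj))
      (fun j hj k hk => hdisj j (Finset.mem_insert_of_mem hj) k (Finset.mem_insert_of_mem hk))
    set A := cnt (fun f : X → Bool => ∀ i ∈ s, ∃ a, f (D i a) ≠ p i a) with hA
    set B := cnt (fun f : X → Bool => ∀ j ∈ insert i s, ∃ a, f (D j a) ≠ p j a) with hB
    set M := cnt (fun f : X → Bool => (∀ i ∈ s, ∃ a, f (D i a) ≠ p i a) ∧
      ∀ a, f (D i a) = p i a) with hM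
    have hDi := hinj i (Finset.mem_insert_self i s)
    have h1 : A ≤ 2 ^ r * M := by
      have hcard : cnt (fun _ : Fin r → Bool => True) = 2 ^ r := by rw [cnt_true]; simp
      rw [hA, hM, ← hcard, ← cnt_prod]
      refine cnt_le_of_injOn (fun f => (fun a => f (D i a), Function.extend (D i) (p i) f)) ?_ ?_
      · intro f hf
        refine ⟨trivial, fun j hj => ?_, fun a => hDi.extend_apply _ _ a⟩
        obtain ⟨a, ha⟩ := hf j hj
        refine ⟨a, ?_⟩
        have hne : ¬∃ b, D i b = D j a := fun ⟨b, hb⟩ =>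
          hdisj i (Finset.mem_insert_self i s) j (Finset.mem_insert_of_mem hj)
            (fun h => hi (h ▸ hj)) b a hb
        simpa only [Function.extend_apply' _ _ _ hne] using ha
      · intro f g _ _ hfg
        obtain ⟨h1, h2⟩ := Prod.mk.inj hfg
        funext x
        by_cases hx : ∃ b, D i b = x
        · obtain ⟨b, rfl⟩ := hx
          exact congrFun h1 b
        · have := congrFun h2 x
          rwa [Function.extend_apply' _ _ _ hx, Function.extend_apply' _ _ _ hx] at this
    have h2 : B + M ≤ A := by
      refine cnt_add_le (fun f hf hf' => ?_)
        (fun f hf j hj => hf j (Finset.mem_insert_of_mem hj)) (fun f hf => hf.1)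
      obtain ⟨a, ha⟩ := hf i (Finset.mem_insert_self i s)
      exact ha (hf'.2 a)
    have h3 : B * 2 ^ r ≤ A * (2 ^ r - 1) := by
      have hpos : 1 ≤ 2 ^ r := Nat.one_le_two_pow
      obtain ⟨t, ht⟩ := Nat.exists_eq_add_of_le hpos
      rw [ht] at h1 ⊢
      rw [Nat.add_sub_cancel_left]
      nlinarith
    rw [Finset.card_insert_of_notMem hi, pow_succ, pow_succ]
    calc B * ((2 ^ r) ^ s.card * 2 ^ r) = (B * 2 ^ r) * (2 ^ r) ^ s.card := by ring
      _ ≤ A * (2 ^ r - 1) * (2 ^ r) ^ s.card := Nat.mul_le_mul_right _ h3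
      _ = (A * (2 ^ r) ^ s.card) * (2 ^ r - 1) := by ring
      _ ≤ 2 ^ Nat.card X * (2 ^ r - 1) ^ s.card * (2 ^ r - 1) := Nat.mul_le_mul_right _ ih
      _ = _ := by ring

variable {V : Type*}

/-- `G` and `H` agree on pairs that do not cross the cut `(U, Uᶜ)`. -/
def AgreeOff (G H : SimpleGraph V) (U : Finset V) : Prop :=
  ∀ x y, (x ∈ U ↔ y ∈ U) → (G.Adj x y ↔ H.Adj x y)

theorem cnt_agreeOff_avoid [Fintype V] (H : SimpleGraph V) (U : Finset V) (s : Finset ι)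
    (D : ι → Fin r → V × V) (p : ι → Fin r → Bool)
    (hD : ∀ i ∈ s, ∀ a, (D i a).1 ∈ U ∧ (D i a).2 ∉ U)
    (hinj : ∀ i ∈ s, Function.Injective (D i))
    (hdisj : ∀ i ∈ s, ∀ j ∈ s, i ≠ j → ∀ a b, D i a ≠ D j b) :
    cnt (fun G : SimpleGraph V => AgreeOff G H U ∧
      ∀ i ∈ s, ∃ a, ¬(G.Adj (D i a).1 (D i a).2 ↔ p i a = true)) * (2 ^ r) ^ s.card ≤
      2 ^ (U.card * Uᶜ.card) * (2 ^ r - 1) ^ s.card := by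
  let X := {x : V × V // x.1 ∈ U ∧ x.2 ∉ U}
  have hX : Nat.card X = U.card * Uᶜ.card := by
    rw [← Finset.card_product, Nat.card_eq_fintype_card, Fintype.card_subtype]
    congr 1
    ext x
    simp [Finset.mem_product]
  have hav := cnt_avoid (X := X) s.attach (fun i a => ⟨D i.1 a, hD i.1 i.2 a⟩)
    (fun i => p i.1)
    (fun i _ a b hab => hinj i.1 i.2 (congrArg Subtype.val hab))
    (fun i _ j _ hij a b hab => hdisj i.1 i.2 j.1 j.2 (fun h => hij (Subtype.ext h)) a b
      (congrArg Subtype.val hab))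
  rw [Finset.card_attach, hX] at hav
  refine le_trans (Nat.mul_le_mul_right _ ?_) hav
  refine cnt_le_of_injOn (fun G x => decide (G.Adj x.1.1 x.1.2)) ?_ ?_
  · rintro G ⟨-, hG⟩ i -
    obtain ⟨a, ha⟩ := hG i.1 i.2
    exact ⟨a, fun h => ha (by rw [← h]; simp)⟩
  · rintro G G' ⟨h, -⟩ ⟨h', -⟩ hGG
    have hc : ∀ x y, x ∈ U → y ∉ U → (G.Adj x y ↔ G'.Adj x y) := fun x y hx hy => by
      simpa using congrFun hGG ⟨(x, y), hx, hy⟩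
    ext x y
    by_cases hx : x ∈ U <;> by_cases hy : y ∈ U
    · rw [h x y (by simp [hx, hy]), h' x y (by simp [hx, hy])]
    · exact hc x y hx hy
    · rw [G.adj_comm, G'.adj_comm]
      exact hc y x hy hx
    · rw [h x y (by simp [hx, hy]), h' x y (by simp [hx, hy])]

theorem four_mul_card_mul_card_compl_le [Fintype V] (U : Finset V) :
    4 * (U.card * Uᶜ.card) ≤ Fintype.card V ^ 2 := by
  rw [← U.card_add_card_compl]
  nlinarith [sq_nonneg ((U.card : ℤ) - Uᶜ.card)]

end Avoiding

section Vol

/-- The number of subsets of size at most `k` of an `N`-element set. -/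
def vol (N k : ℕ) : ℕ := ∑ i ∈ Finset.range (k + 1), N.choose i

theorem cnt_card_le {X : Type*} [Fintype X] (k : ℕ) :
    cnt (fun E : Finset X => E.card ≤ k) = vol (Fintype.card X) k := by
  rw [cnt_eq_card_filter, vol]
  have h : ({E : Finset X | E.card ≤ k} : Finset (Finset X)) =
      (Finset.range (k + 1)).biUnion fun i => Finset.powersetCard i Finset.univ := by
    ext E
    simp
  rw [h, Finset.card_biUnion]
  · simp
  · intro i _ j _ hij
    refine Finset.disjoint_left.2 fun E hi hj => hij ?_
    rw [← (Finset.mem_powersetCard.1 hi).2, (Finset.mem_powersetCard.1 hj).2]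

theorem vol_mono {N M k l : ℕ} (h : N ≤ M) (hk : k ≤ l) : vol N k ≤ vol M l :=
  (Finset.sum_le_sum fun i _ => Nat.choose_le_choose i h).trans
    (Finset.sum_le_sum_of_subset (Finset.range_mono (Nat.succ_le_succ hk)))

theorem one_le_vol (N k : ℕ) : 1 ≤ vol N k := by
  calc 1 = vol 0 0 := by simp [vol]
    _ ≤ vol N k := vol_mono (Nat.zero_le _) (Nat.zero_le _)

theorem vol_mul_pow_le (N k : ℕ) {x : ℝ} (hx : 0 < x) (hx1 : x ≤ 1) :
    (vol N k : ℝ) * x ^ k ≤ (1 + x) ^ N := by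
  have h1 : (vol N k : ℝ) * x ^ k ≤ ∑ i ∈ Finset.range (k + 1), x ^ i * (N.choose i : ℝ) := by
    rw [vol, Nat.cast_sum, Finset.sum_mul]
    refine Finset.sum_le_sum fun i hi => ?_
    rw [mul_comm]
    exact mul_le_mul_of_nonneg_right
      (pow_le_pow_of_le_one hx.le hx1 (Nat.lt_succ_iff.1 (Finset.mem_range.1 hi)))
      (Nat.cast_nonneg _)
  refine h1.trans ?_
  rw [add_comm 1 x, add_pow]
  simp only [one_pow, mul_one]
  rcases le_total (k + 1) (N + 1) with h | h
  · exact Finset.sum_le_sum_of_subset_of_nonneg (Finset.range_mono h) fun _ _ _ => by positivity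
  · rw [← Finset.sum_subset (Finset.range_mono h)]
    intro i _ hi
    rw [Finset.mem_range, not_lt] at hi
    rw [Nat.choose_eq_zero_of_lt (Nat.lt_of_succ_le hi)]
    simp

theorem exists_vol_le {ε : ℝ} (hε : 0 < ε) :
    ∃ μ : ℝ, 0 < μ ∧ ∀ N k : ℕ, (k : ℝ) ≤ μ * N → (vol N k : ℝ) ≤ 2 ^ (ε * N) := by
  have hl2 : 0 < Real.log 2 := Real.log_pos (by norm_num)
  set x : ℝ := min 1 (ε / 2 * Real.log 2) with hx
  have hx0 : 0 < x := lt_min one_pos (by positivity)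
  have hx1 : x ≤ 1 := min_le_left _ _
  have hlogx : 0 ≤ -Real.log x := by
    have := Real.log_nonpos hx0.le hx1
    linarith
  set μ : ℝ := (ε / 2 * Real.log 2) / (1 - Real.log x) with hμ
  have hμ0 : 0 < μ := div_pos (by positivity) (by linarith)
  refine ⟨μ, hμ0, fun N k hk => ?_⟩
  have hvpos : (0 : ℝ) < vol N k := by exact_mod_cast one_le_vol N k
  rw [Real.le_rpow_iff_log_le hvpos two_pos]
  have h := Real.log_le_log (mul_pos hvpos (pow_pos hx0 k)) (vol_mul_pow_le N k hx0 hx1)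
  rw [Real.log_mul hvpos.ne' (pow_pos hx0 k).ne', Real.log_pow, Real.log_pow] at h
  have h1 : Real.log (1 + x) ≤ ε / 2 * Real.log 2 := by
    have := Real.log_le_sub_one_of_pos (show 0 < 1 + x by linarith)
    have := min_le_right 1 (ε / 2 * Real.log 2)
    linarith
  have h2 : (k : ℝ) * -Real.log x ≤ ε / 2 * Real.log 2 * N := by
    calc (k : ℝ) * -Real.log x ≤ μ * N * (1 - Real.log x) := by
          apply mul_le_mul hk (by linarith) hlogx (by positivity)
      _ = ε / 2 * Real.log 2 * N := by
          have h0 : 1 - Real.log x ≠ 0 := by linarith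
          rw [hμ]
          field_simp
  have h3 : (N : ℝ) * Real.log (1 + x) ≤ N * (ε / 2 * Real.log 2) :=
    mul_le_mul_of_nonneg_left h1 (Nat.cast_nonneg _)
  linarith

end Vol

section Mixing

variable {V : Type*}

/-- The vertices of `B` whose neighbourhood or non-neighbourhood in `T` is unusually small. -/
def atypical (G : SimpleGraph V) (d : ℝ) (B T : Finset V) : Finset V :=
  {b ∈ B | ((T.filter fun a => G.Adj b a).card : ℝ) < d * T.card ∨
    ((T.filter fun a => ¬G.Adj b a).card : ℝ) < d * T.card}

/-- Every large subset of `A` has few atypical vertices in `B`. -/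
def Mix (G : SimpleGraph V) (ε d : ℝ) (B A : Finset V) : Prop :=
  ∀ T ⊆ A, ε * A.card ≤ T.card → ((atypical G d B T).card : ℝ) ≤ 2 * ε * B.card

theorem card_filter_adj_iff_of_notMem_atypical {G : SimpleGraph V} {d : ℝ} {B T : Finset V} {b : V}
    (hb : b ∈ B) (h : b ∉ atypical G d B T) (s : Bool) :
    d * T.card ≤ (T.filter fun a => G.Adj b a ↔ s = true).card := by
  have h' : ¬(_ ∨ _) := fun hor => h (Finset.mem_filter.2 ⟨hb, hor⟩)
  push Not at h'
  cases s
  · simpa using h'.2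
  · simpa using h'.1

theorem card_interedges_eq_sum (G : SimpleGraph V) (Y T : Finset V) :
    (G.interedges Y T).card = ∑ b ∈ Y, (T.filter fun a => G.Adj b a).card := by
  rw [SimpleGraph.interedges_def, Finset.card_filter, Finset.sum_product]
  exact Finset.sum_congr rfl fun b _ => (Finset.card_filter _ _).symm

theorem Mix.of_isUniform {G : SimpleGraph V} {ε d : ℝ} {A B : Finset V} (hε : 0 ≤ ε)
    (h : G.IsUniform ε B A) (h1 : d ≤ (G.edgeDensity B A : ℝ))
    (h2 : (G.edgeDensity B A : ℝ) ≤ 1 - d) : Mix G ε (d - ε) B A := by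
  intro T hT hTA
  set Y₁ : Finset V := {b ∈ B | ((T.filter fun a => G.Adj b a).card : ℝ) < (d - ε) * T.card}
    with hY₁
  set Y₂ : Finset V := {b ∈ B | ((T.filter fun a => ¬G.Adj b a).card : ℝ) < (d - ε) * T.card}
    with hY₂
  have hTpos : ∀ b : V, (((T.filter fun a => G.Adj b a).card : ℝ) < (d - ε) * T.card ∨
      ((T.filter fun a => ¬G.Adj b a).card : ℝ) < (d - ε) * T.card) → (0 : ℝ) < T.card := by
    intro b hb
    rcases T.eq_empty_or_nonempty with rfl | hne
    · simp at hb
    · exact_mod_cast hne.card_pos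
  have dens : ∀ Y : Finset V, (G.edgeDensity Y T : ℝ) * (Y.card * T.card) =
      ∑ b ∈ Y, ((T.filter fun a => G.Adj b a).card : ℝ) := by
    intro Y
    rw [← Nat.cast_sum, ← card_interedges_eq_sum, SimpleGraph.edgeDensity_def]
    push_cast
    rcases Y.eq_empty_or_nonempty with rfl | hY
    · simp [SimpleGraph.interedges_def]
    rcases T.eq_empty_or_nonempty with rfl | hT
    · simp [SimpleGraph.interedges_def]
    have : (0 : ℝ) < Y.card := by exact_mod_cast hY.card_pos
    have : (0 : ℝ) < T.card := by exact_mod_cast hT.card_pos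
    field_simp
  have hb1 : (Y₁.card : ℝ) ≤ ε * B.card := by
    by_contra! hlt
    have hYpos : (0 : ℝ) < Y₁.card := lt_of_le_of_lt (by positivity) hlt
    obtain ⟨b, hb⟩ := Finset.card_pos.1 (by exact_mod_cast hYpos : 0 < Y₁.card)
    have hT0 := hTpos b (Or.inl (Finset.mem_filter.1 hb).2)
    have hu := h (Finset.filter_subset _ _ : Y₁ ⊆ B) hT (by rw [mul_comm]; exact hlt.le)
      (by rw [mul_comm]; exact hTA)
    have hs : ∑ b ∈ Y₁, ((T.filter fun a => G.Adj b a).card : ℝ) ≤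
        ∑ _b ∈ Y₁, (d - ε) * T.card :=
      Finset.sum_le_sum fun b hb => (Finset.mem_filter.1 hb).2.le
    rw [← dens, Finset.sum_const, nsmul_eq_mul] at hs
    have hs' : (G.edgeDensity Y₁ T : ℝ) ≤ d - ε := by
      have : 0 < (Y₁.card : ℝ) * T.card := by positivity
      nlinarith
    have := (abs_lt.1 hu).1
    linarith
  have hb2 : (Y₂.card : ℝ) ≤ ε * B.card := by
    by_contra! hlt
    have hYpos : (0 : ℝ) < Y₂.card := lt_of_le_of_lt (by positivity) hlt
    obtain ⟨b, hb⟩ := Finset.card_pos.1 (by exact_mod_cast hYpos : 0 < Y₂.card)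
    have hT0 := hTpos b (Or.inr (Finset.mem_filter.1 hb).2)
    have hu := h (Finset.filter_subset _ _ : Y₂ ⊆ B) hT (by rw [mul_comm]; exact hlt.le)
      (by rw [mul_comm]; exact hTA)
    have hs : ∑ _b ∈ Y₂, (1 - (d - ε)) * T.card ≤
        ∑ b ∈ Y₂, ((T.filter fun a => G.Adj b a).card : ℝ) := by
      refine Finset.sum_le_sum fun b hb => ?_
      have h3 := (Finset.mem_filter.1 hb).2
      have h4 : ((T.filter fun a => G.Adj b a).card : ℝ) +
          (T.filter fun a => ¬G.Adj b a).card = T.card := by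
        exact_mod_cast Finset.card_filter_add_card_filter_not (s := T) (fun a => G.Adj b a)
      linarith
    rw [← dens, Finset.sum_const, nsmul_eq_mul] at hs
    have hs' : 1 - (d - ε) ≤ (G.edgeDensity Y₂ T : ℝ) := by
      have : 0 < (Y₂.card : ℝ) * T.card := by positivity
      nlinarith
    have := (abs_lt.1 hu).2
    linarith
  have hsub : atypical G (d - ε) B T ⊆ Y₁ ∪ Y₂ := by
    intro b hb
    obtain ⟨hbB, hb⟩ := Finset.mem_filter.1 hb
    rw [hY₁, hY₂, Finset.mem_union, Finset.mem_filter, Finset.mem_filter]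
    exact hb.imp (fun h => ⟨hbB, h⟩) (fun h => ⟨hbB, h⟩)
  have h5 : ((atypical G (d - ε) B T).card : ℝ) ≤ Y₁.card + Y₂.card := by
    exact_mod_cast (Finset.card_le_card hsub).trans (Finset.card_union_le _ _)
  linarith

/-- The vertices of `A` with prescribed adjacencies to `b 0, b 1, …`. -/
def patternClass (G : SimpleGraph V) {k : ℕ} (A : Finset V) (b : Fin k → V) (σ : Fin k → Bool) :
    Finset V :=
  A.filter fun a => ∀ i, G.Adj (b i) a ↔ σ i = true

theorem mem_patternClass {G : SimpleGraph V} {k : ℕ} {A : Finset V} {b : Fin k → V}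
    {σ : Fin k → Bool} {a : V} :
    a ∈ patternClass G A b σ ↔ a ∈ A ∧ ∀ i, G.Adj (b i) a ↔ σ i = true :=
  Finset.mem_filter

theorem Mix.exists_typical {ι : Type*} {G : SimpleGraph V} {ε d : ℝ} {B : Finset V}
    (s : Finset ι) (A T : ι → Finset V) (hM : ∀ i ∈ s, Mix G ε d B (A i))
    (hT : ∀ i ∈ s, T i ⊆ A i) (hTA : ∀ i ∈ s, ε * (A i).card ≤ (T i).card)
    (X E : Finset V) (hlt : s.card * (2 * ε * B.card) + E.card < X.card) :
    ∃ b ∈ X, b ∉ E ∧ ∀ i ∈ s, b ∉ atypical G d B (T i) := by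
  by_contra! hno
  have hsub : X ⊆ E ∪ s.biUnion fun i => atypical G d B (T i) := by
    intro b hb
    by_cases hE : b ∈ E
    · exact Finset.mem_union_left _ hE
    · obtain ⟨i, hi, hbi⟩ := hno b hb hE
      exact Finset.mem_union_right _ (Finset.mem_biUnion.2 ⟨i, hi, hbi⟩)
  have h1 := (Finset.card_le_card hsub).trans ((Finset.card_union_le _ _).trans
    (Nat.add_le_add_left Finset.card_biUnion_le _))
  have h2 : (X.card : ℝ) ≤ E.card + ∑ i ∈ s, ((atypical G d B (T i)).card : ℝ) := by
    exact_mod_cast h1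
  have h3 : ∑ i ∈ s, ((atypical G d B (T i)).card : ℝ) ≤ ∑ _i ∈ s, 2 * ε * B.card :=
    Finset.sum_le_sum fun i hi => hM i hi (T i) (hT i hi) (hTA i hi)
  rw [Finset.sum_const, nsmul_eq_mul] at h3
  linarith

theorem Mix.exists_shattered {G : SimpleGraph V} {ε d : ℝ} {A B C : Finset V}
    (hA : Mix G ε d B A) (hC : Mix G ε d B C) (hε : 0 ≤ ε) (hd : 0 ≤ d) (hd1 : d ≤ 1) (k : ℕ)
    (hεd : ε ≤ d ^ k) (hB : 2 ^ (k + 1) * (2 * ε * B.card) + k < B.card) :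
    ∀ j ≤ k, ∃ b : Fin j → V, Function.Injective b ∧ ∀ σ,
      d ^ j * A.card ≤ (patternClass G A b σ).card ∧
        d ^ j * C.card ≤ (patternClass G C b σ).card := by
  intro j hj
  induction j with
  | zero =>
    refine ⟨Fin.elim0, fun i => i.elim0, fun σ => ?_⟩
    simp [patternClass]
  | succ j ih =>
    obtain ⟨b, hb, hσ⟩ := ih (Nat.le_of_succ_le hj)
    let AC : Bool → Finset V := fun t => if t then A else C
    have hpow : ε ≤ d ^ j := hεd.trans (pow_le_pow_of_le_one hd hd1 (Nat.le_of_succ_le hj))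
    have hbig : ∀ t σ, d ^ j * (AC t).card ≤ (patternClass G (AC t) b σ).card := by
      intro t σ
      cases t
      exacts [(hσ σ).2, (hσ σ).1]
    obtain ⟨x, hxB, hxE, hx⟩ := Mix.exists_typical (B := B) (d := d) (G := G)
      (Finset.univ : Finset (Bool × (Fin j → Bool)))
      (fun i => AC i.1) (fun i => patternClass G (AC i.1) b i.2)
      (by rintro ⟨t, σ⟩ -; cases t; exacts [hC, hA])
      (fun i _ => Finset.filter_subset _ _)
      (fun i _ => (mul_le_mul_of_nonneg_right hpow (Nat.cast_nonneg _)).trans (hbig i.1 i.2))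
      B (Finset.univ.image b) (by
        refine lt_of_le_of_lt ?_ hB
        have h1 : ((Finset.univ.image b).card : ℝ) ≤ k := by
          have : (Finset.univ.image b).card ≤ j := Finset.card_image_le.trans (by simp)
          exact_mod_cast this.trans (Nat.le_of_succ_le hj)
        have h2 : (2 : ℝ) ^ (j + 1) ≤ 2 ^ (k + 1) :=
          pow_le_pow_right₀ (by norm_num) (by omega)
        have h3 : (((Finset.univ : Finset (Bool × (Fin j → Bool))).card : ℕ) : ℝ) =
            2 ^ (j + 1) := by
          simp [pow_succ, mul_comm]
        rw [h3]
        have : 0 ≤ 2 * ε * B.card := by positivity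
        nlinarith)
    refine ⟨Fin.cons x b, ?_, fun σ => ?_⟩
    · rw [Fin.cons_injective_iff]
      exact ⟨fun ⟨i, hi⟩ => hxE (Finset.mem_image.2 ⟨i, Finset.mem_univ _, hi⟩), hb⟩
    · have key : ∀ t, d ^ (j + 1) * (AC t).card ≤
          (patternClass G (AC t) (Fin.cons x b : Fin (j + 1) → V) σ).card := by
        intro t
        have h1 := card_filter_adj_iff_of_notMem_atypical hxB
          (hx (t, Fin.tail σ) (Finset.mem_univ _)) (σ 0)
        have h2 : (patternClass G (AC t) (Fin.cons x b : Fin (j + 1) → V) σ) =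
            (patternClass G (AC t) b (Fin.tail σ)).filter fun a => G.Adj x a ↔ σ 0 = true := by
          ext a
          simp only [mem_patternClass, Finset.mem_filter, Fin.forall_fin_succ, Fin.cons_zero,
            Fin.cons_succ, Fin.tail]
          tauto
        rw [h2]
        refine le_trans ?_ h1
        rw [pow_succ, mul_comm (d ^ j) d, mul_assoc]
        exact mul_le_mul_of_nonneg_left (hbig t _) hd
      exact ⟨key true, key false⟩

theorem Tame.not_mix {G : SimpleGraph V} (hG : Tame G) {ε d : ℝ} {A B C : Finset V}
    (hBA : Mix G ε d B A) (hBC : Mix G ε d B C) (hAC : Mix G ε d A C) (hε : 0 < ε) (hd : 0 < d)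
    (hd1 : d ≤ 1) (hεd : 2 ^ 13 * ε ≤ d ^ 12) (hA : A.Nonempty) (hC : C.Nonempty)
    (hB : 20 < B.card) : False := by
  have hA0 : (0 : ℝ) < A.card := by exact_mod_cast hA.card_pos
  have hC0 : (0 : ℝ) < C.card := by exact_mod_cast hC.card_pos
  have hB0 : (20 : ℝ) < B.card := by exact_mod_cast hB
  have hd12 : d ^ 12 ≤ d ^ 11 := pow_le_pow_of_le_one hd.le hd1 (by norm_num)
  have hd11 : d ^ 11 ≤ d ^ 10 := pow_le_pow_of_le_one hd.le hd1 (by norm_num)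
  have hd10 : d ^ 10 ≤ 1 := pow_le_one₀ hd.le hd1
  obtain ⟨b, hb, hσ⟩ := Mix.exists_shattered hBA hBC hε.le hd.le hd1 10 (by linarith)
    (by norm_num; nlinarith) 10 le_rfl
  obtain ⟨t, htb, ht, hhom⟩ := hG.hom (Finset.univ.image b) (by
    rw [Finset.card_image_of_injective _ hb]; simp)
  let e : Fin 4 ≃ t := (Fintype.equivFinOfCardEq (by simpa using ht)).symm
  have hidx : ∀ i, ∃ l, b l = e i := fun i => by
    simpa using htb (e i).2
  choose idx hidx using hidx
  have hidxinj : Function.Injective idx := fun i j hij => by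
    have : (e i : V) = e j := by rw [← hidx, ← hidx, hij]
    exact e.injective (Subtype.ext this)
  let β : Fin 4 → V := fun i => e i
  have hβinj : Function.Injective β := fun i j hij => e.injective (Subtype.ext hij)
  have hβ : ∀ (S : Finset V), (∀ σ, d ^ 10 * S.card ≤ (patternClass G S b σ).card) →
      ∀ π, d ^ 10 * S.card ≤ (patternClass G S β π).card := by
    intro S hS π
    refine (hS (Function.extend idx π fun _ => false)).trans ?_
    have : patternClass G S b (Function.extend idx π fun _ => false) ⊆ patternClass G S β π := by
      intro a ha
      obtain ⟨haS, ha⟩ := Finset.mem_filter.1 ha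
      refine Finset.mem_filter.2 ⟨haS, fun i => ?_⟩
      have := ha (idx i)
      rwa [hidxinj.extend_apply, hidx] at this
    exact_mod_cast Finset.card_le_card this
  have hAβ := hβ A fun σ => (hσ σ).1
  have hCβ := hβ C fun σ => (hσ σ).2
  obtain ⟨a, haA, -, ha⟩ := Mix.exists_typical (B := A) (d := d) (G := G)
    (Finset.univ : Finset (Fin 4 → Bool)) (fun _ => C) (fun π => patternClass G C β π)
    (fun _ _ => hAC) (fun _ _ => Finset.filter_subset _ _)
    (fun π _ => (mul_le_mul_of_nonneg_right (by linarith) hC0.le).trans (hCβ π))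
    (patternClass G A β ![false, false, true, true]) ∅ (by
      refine lt_of_lt_of_le ?_ (hAβ _)
      norm_num
      nlinarith)
  have hC2 : ∀ π s, d ^ 11 * C.card ≤
      ((patternClass G C β π).filter fun c => G.Adj a c ↔ s = true).card := by
    intro π s
    refine le_trans ?_ (card_filter_adj_iff_of_notMem_atypical (Finset.filter_subset _ _ haA)
      (ha π (Finset.mem_univ _)) s)
    rw [show d ^ 11 = d * d ^ 10 by ring, mul_assoc]
    exact mul_le_mul_of_nonneg_left (hCβ π) hd.le
  obtain ⟨a', haA', -, ha'⟩ := Mix.exists_typical (B := A) (d := d) (G := G)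
    (Finset.univ : Finset ((Fin 4 → Bool) × Bool)) (fun _ => C)
    (fun π => (patternClass G C β π.1).filter fun c => G.Adj a c ↔ π.2 = true)
    (fun _ _ => hAC) (fun _ _ => (Finset.filter_subset _ _).trans (Finset.filter_subset _ _))
    (fun π _ => (mul_le_mul_of_nonneg_right (by linarith) hC0.le).trans (hC2 π.1 π.2))
    (patternClass G A β ![false, true, false, true]) ∅ (by
      refine lt_of_lt_of_le ?_ (hAβ _)
      norm_num
      nlinarith)
  have hc : ∀ (π : Fin 4 → Bool) (s s' : Bool),
      ∃ c, (∀ i, G.Adj (β i) c ↔ π i = true) ∧ (G.Adj a c ↔ s = true) ∧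
      (G.Adj a' c ↔ s' = true) := by
    intro π s s'
    have h1 := card_filter_adj_iff_of_notMem_atypical (Finset.filter_subset _ _ haA')
      (ha' (π, s) (Finset.mem_univ _)) s'
    have h2 : (0 : ℝ) < (((patternClass G C β π).filter fun c => G.Adj a c ↔ s = true).filter
        fun c => G.Adj a' c ↔ s' = true).card := by
      refine lt_of_lt_of_le ?_ h1
      exact mul_pos hd (lt_of_lt_of_le (by positivity) (hC2 π s))
    obtain ⟨c, hc⟩ := Finset.card_pos.1 (by exact_mod_cast h2)
    obtain ⟨hc, hc3⟩ := Finset.mem_filter.1 hc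
    obtain ⟨hc, hc2⟩ := Finset.mem_filter.1 hc
    exact ⟨c, (Finset.mem_filter.1 hc).2, hc2, hc3⟩
  have pa := (Finset.mem_filter.1 haA).2
  have pa' := (Finset.mem_filter.1 haA').2
  have pa0 : ¬G.Adj (β 0) a := by simpa using pa 0
  have pa1 : ¬G.Adj (β 1) a := by simpa using pa 1
  have pa2 : G.Adj (β 2) a := by simpa using pa 2
  have pa3 : G.Adj (β 3) a := by simpa using pa 3
  have qa0 : ¬G.Adj (β 0) a' := by simpa using pa' 0
  have qa1 : G.Adj (β 1) a' := by simpa using pa' 1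
  have qa2 : ¬G.Adj (β 2) a' := by simpa using pa' 2
  have qa3 : G.Adj (β 3) a' := by simpa using pa' 3
  have hmem : ∀ i, β i ∈ (t : Set V) := fun i => (e i).2
  have sy : ∀ x y, ¬G.Adj x y → ¬G.Adj y x := fun x y h h' => h h'.symm
  rcases hhom with hcl | hcl
  · have hadj : ∀ i j, i ≠ j → G.Adj (β i) (β j) := fun i j hij =>
      hcl (hmem i) (hmem j) (hβinj.ne hij)
    by_cases haa : G.Adj a a'
    · obtain ⟨c, h1, h2, h3⟩ := hc ![true, false, false, false] false true
      have c0 : G.Adj (β 0) c := by simpa using h1 0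
      have c2 : ¬G.Adj (β 2) c := by simpa using h1 2
      have h2 : ¬G.Adj a c := by simpa using h2
      have h3 : G.Adj a' c := by simpa using h3
      exact hG.c5 (β 0) (β 2) a a' c (hadj _ _ (by decide)) pa2 haa h3 c0.symm pa0 qa2 h2
        (sy _ _ qa0) (sy _ _ c2)
    · obtain ⟨c, h1, h2, h3⟩ := hc ![false, false, false, false] true true
      have c1 : ¬G.Adj (β 1) c := by simpa using h1 1
      have c2 : ¬G.Adj (β 2) c := by simpa using h1 2
      have h2 : G.Adj a c := by simpa using h2
      have h3 : G.Adj a' c := by simpa using h3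
      exact hG.c5 (β 1) (β 2) a c a' (hadj _ _ (by decide)) pa2 h2 h3.symm qa1.symm pa1 c2 haa
        (sy _ _ c1) (sy _ _ qa2)
  · have hadj : ∀ i j, i ≠ j → ¬G.Adj (β i) (β j) := fun i j hij =>
      (hcl (hmem i) (hmem j) (hβinj.ne hij)).2
    by_cases haa : G.Adj a a'
    · obtain ⟨c, h1, h2, h3⟩ := hc ![true, true, true, true] false false
      have c1 : G.Adj (β 1) c := by simpa using h1 1
      have c2 : G.Adj (β 2) c := by simpa using h1 2
      have h2 : ¬G.Adj a c := by simpa using h2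
      have h3 : ¬G.Adj a' c := by simpa using h3
      exact hG.c5 a a' (β 1) c (β 2) haa qa1.symm c1 c2.symm pa2 (sy _ _ pa1) h3
        (hadj _ _ (by decide)) (sy _ _ h2) qa2
    · obtain ⟨c, h1, h2, h3⟩ := hc ![false, true, false, false] true false
      have c1 : G.Adj (β 1) c := by simpa using h1 1
      have c3 : ¬G.Adj (β 3) c := by simpa using h1 3
      have h2 : G.Adj a c := by simpa using h2
      have h3 : ¬G.Adj a' c := by simpa using h3
      exact hG.c5 (β 3) a c (β 1) a' pa3 h2 c1.symm qa1 qa3.symm c3 (sy _ _ pa1) (sy _ _ h3)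
        (hadj _ _ (by decide)) (sy _ _ haa)

end Mixing

section Regularity

theorem card_filter_discordant_le {V : Type*} (G : SimpleGraph V) {d : ℝ} (hd : d ≤ 1 / 2)
    (U W : Finset V) (h : (G.edgeDensity U W : ℝ) < d ∨ 1 - d < (G.edgeDensity U W : ℝ)) :
    (((U ×ˢ W).filter fun p => ¬(G.Adj p.1 p.2 ↔ 1 / 2 < (G.edgeDensity U W : ℝ))).card : ℝ) ≤
      d * (U.card * W.card) := by
  have hI : (G.edgeDensity U W : ℝ) * (U.card * W.card) =
      (((U ×ˢ W).filter fun p => G.Adj p.1 p.2).card : ℝ) := by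
    rw [SimpleGraph.edgeDensity_def, SimpleGraph.interedges_def]
    push_cast
    rcases U.eq_empty_or_nonempty with rfl | hU
    · simp
    rcases W.eq_empty_or_nonempty with rfl | hW
    · simp
    have : (0 : ℝ) < U.card := by exact_mod_cast hU.card_pos
    have : (0 : ℝ) < W.card := by exact_mod_cast hW.card_pos
    field_simp
  have hpos : (0 : ℝ) ≤ U.card * W.card := by positivity
  rcases h with h | h
  · have hn : ¬(1 / 2 < (G.edgeDensity U W : ℝ)) := by linarith
    simp only [hn, iff_false, not_not]
    rw [← hI]
    exact mul_le_mul_of_nonneg_right h.le hpos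
  · have hn : 1 / 2 < (G.edgeDensity U W : ℝ) := by linarith
    simp only [hn, iff_true]
    have h4 : (((U ×ˢ W).filter fun p => G.Adj p.1 p.2).card : ℝ) +
        ((U ×ˢ W).filter fun p => ¬G.Adj p.1 p.2).card = U.card * W.card := by
      rw [← Nat.cast_mul, ← Finset.card_product]
      exact_mod_cast Finset.card_filter_add_card_filter_not (s := U ×ˢ W)
        (fun p => G.Adj p.1 p.2)
    nlinarith

/-- Every tame graph is, up to few pairs, a blow-up of bounded size outside a triangle-free
blow-up. -/
theorem Tame.exists_blowup {ζ : ℝ} (hζ : 0 < ζ) (hζ1 : ζ ≤ 1) :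
    ∃ M n₁ : ℕ, 0 < M ∧ ∀ n ≥ n₁, ∀ G : SimpleGraph (Fin n), Tame G →
      ∃ (f : Fin n → Fin M) (T R : Fin M → Fin M → Bool) (Γ : SimpleGraph (Fin n)),
        (∀ x y, Γ.Adj x y ↔ R (f x) (f y) = true) ∧
        (∀ x y z, Γ.Adj x y → Γ.Adj x z → Γ.Adj y z → False) ∧
        ((Finset.univ.filter fun p : Fin n × Fin n => ¬Γ.Adj p.1 p.2 ∧
          ¬(G.Adj p.1 p.2 ↔ T (f p.1) (f p.2) = true)).card : ℝ) ≤ ζ * n ^ 2 := by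
  set d : ℝ := ζ / 4 with hd
  set ε : ℝ := (d / 2) ^ 12 / 2 ^ 13 with hε
  have hd0 : 0 < d := by positivity
  have hd14 : d ≤ 1 / 4 := by linarith
  have hε0 : 0 < ε := by positivity
  have hdp : (d / 2) ^ 12 ≤ d / 2 := by
    calc (d / 2) ^ 12 ≤ (d / 2) ^ 1 :=
          pow_le_pow_of_le_one (by positivity) (by linarith) (by norm_num)
      _ = d / 2 := pow_one _
  have hεd : ε ≤ d / 2 ^ 14 := by
    rw [hε]
    linarith
  obtain ⟨l, hl⟩ := exists_nat_ge (4 / (ζ / 2))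
  set M := SzemerediRegularity.bound ε l with hM
  have hM0 : 0 < M := SzemerediRegularity.bound_pos _ _
  obtain ⟨n₂, hn₂⟩ := exists_nat_ge (4 / ζ)
  refine ⟨M, l + 21 * M + n₂ + 1, hM0, fun n hn G hG => ?_⟩
  obtain ⟨P, hPe, hPl, hPM, hPu⟩ := szemeredi_regularity (G := G) hε0
    (show l ≤ Fintype.card (Fin n) by rw [Fintype.card_fin]; omega)
  have hpm : ∀ x, P.part x ∈ P.parts := fun x => P.part_mem.2 (Finset.mem_univ x)
  have hxp : ∀ x, x ∈ P.part x := fun x => P.mem_part (Finset.mem_univ x)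
  let e := P.parts.equivFin
  let f : Fin n → Fin M := fun x => Fin.castLE hPM (e ⟨P.part x, hpm x⟩)
  let h : Fin M → Finset (Fin n) := fun i =>
    if hi : i.1 < P.parts.card then (e.symm ⟨i, hi⟩).1 else ∅
  have hf : ∀ x, h (f x) = P.part x := fun x => by
    have : (f x).1 < P.parts.card := (e ⟨P.part x, hpm x⟩).2
    simp only [h, dif_pos this]
    have h2 : (⟨(f x).1, this⟩ : Fin P.parts.card) = e ⟨P.part x, hpm x⟩ := rfl
    rw [h2, Equiv.symm_apply_apply]
  let grey : Finset (Fin n) → Finset (Fin n) → Prop := fun U W =>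
    U ≠ W ∧ G.IsUniform ε U W ∧ d ≤ (G.edgeDensity U W : ℝ) ∧ (G.edgeDensity U W : ℝ) ≤ 1 - d
  have hsymm : ∀ U W, grey U W → grey W U := fun U W hg =>
    ⟨hg.1.symm, hg.2.1.symm, by rw [SimpleGraph.edgeDensity_comm]; exact hg.2.2⟩
  let Γ : SimpleGraph (Fin n) :=
    { Adj := fun x y => grey (P.part x) (P.part y)
      symm := ⟨fun x y => hsymm _ _⟩
      loopless := ⟨fun x hx => hx.1 rfl⟩ }
  refine ⟨f, fun i j => decide (1 / 2 < (G.edgeDensity (h i) (h j) : ℝ)),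
    fun i j => decide (grey (h i) (h j)), Γ, fun x y => ?_, fun x y z hxy hxz hyz => ?_, ?_⟩
  · rw [decide_eq_true_eq, hf, hf]
  · have hmix : ∀ U W, grey U W → Mix G ε (d - ε) U W := fun U W hg =>
      Mix.of_isUniform hε0.le hg.2.1 hg.2.2.1 hg.2.2.2
    have hbig : 20 < (P.part x).card := by
      have h1 := hPe.average_le_card_part (hpm x)
      have h2 : 21 ≤ n / P.parts.card := by
        rw [Nat.le_div_iff_mul_le (Finset.card_pos.2 ⟨_, hpm x⟩)]
        have := Nat.mul_le_mul_left 21 hPM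
        omega
      rw [Finset.card_univ, Fintype.card_fin] at h1
      omega
    refine hG.not_mix (hmix _ _ hxy) (hmix _ _ hxz) (hmix _ _ hyz) hε0 (by linarith)
      (by linarith) ?_ ⟨y, hxp y⟩ ⟨z, hxp z⟩ hbig
    calc (2 : ℝ) ^ 13 * ε = (d / 2) ^ 12 := by rw [hε]; field_simp
      _ ≤ (d - ε) ^ 12 := pow_le_pow_left₀ (by positivity) (by linarith) _
  · have hn1 : (1 : ℝ) ≤ n := by exact_mod_cast (by omega : 1 ≤ n)
    have hnn2 : (n₂ : ℝ) ≤ n := by exact_mod_cast (by omega : n₂ ≤ n)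
    let S₁ : Finset (Fin n × Fin n) := Finset.univ.image fun x => (x, x)
    let S₂ : Finset (Fin n × Fin n) := P.parts.biUnion Finset.offDiag
    let S₃ : Finset (Fin n × Fin n) := (P.nonUniforms G ε).biUnion fun (U, W) => U ×ˢ W
    let S₄ : Finset (Fin n × Fin n) := ((P.parts ×ˢ P.parts).filter fun q =>
        (G.edgeDensity q.1 q.2 : ℝ) < d ∨ 1 - d < (G.edgeDensity q.1 q.2 : ℝ)).biUnion fun q =>
      (q.1 ×ˢ q.2).filter fun p => ¬(G.Adj p.1 p.2 ↔ 1 / 2 < (G.edgeDensity q.1 q.2 : ℝ))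
    have hsub : (Finset.univ.filter fun p : Fin n × Fin n => ¬Γ.Adj p.1 p.2 ∧
        ¬(G.Adj p.1 p.2 ↔ decide (1 / 2 < (G.edgeDensity (h (f p.1)) (h (f p.2)) : ℝ)) = true)) ⊆
        S₁ ∪ S₂ ∪ S₃ ∪ S₄ := by
      rintro ⟨x, y⟩ hp
      obtain ⟨hp1, hp2⟩ := (Finset.mem_filter.1 hp).2
      simp only [hf, decide_eq_true_eq] at hp2
      rw [Finset.mem_union, Finset.mem_union, Finset.mem_union]
      by_cases hxy : x = y
      · subst hxy
        exact Or.inl (Or.inl (Or.inl (Finset.mem_image.2 ⟨x, Finset.mem_univ _, rfl⟩)))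
      by_cases hU : P.part x = P.part y
      · refine Or.inl (Or.inl (Or.inr (Finset.mem_biUnion.2 ⟨_, hpm x, ?_⟩)))
        exact Finset.mem_offDiag.2 ⟨hxp x, by rw [hU]; exact hxp y, hxy⟩
      by_cases hu : G.IsUniform ε (P.part x) (P.part y)
      · refine Or.inr (Finset.mem_biUnion.2 ⟨(P.part x, P.part y), Finset.mem_filter.2
          ⟨Finset.mem_product.2 ⟨hpm x, hpm y⟩, ?_⟩, Finset.mem_filter.2
          ⟨Finset.mem_product.2 ⟨hxp x, hxp y⟩, hp2⟩⟩)
        by_contra! hcon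
        exact hp1 ⟨hU, hu, hcon.1, hcon.2⟩
      · exact Or.inl (Or.inr (Finset.mem_biUnion.2 ⟨(P.part x, P.part y),
          (Finpartition.mk_mem_nonUniforms _ _).2 ⟨hpm x, hpm y, hU, hu⟩,
          Finset.mem_product.2 ⟨hxp x, hxp y⟩⟩))
    have hc1 : (S₁.card : ℝ) ≤ ζ / 4 * n ^ 2 := by
      have h1 : (S₁.card : ℝ) ≤ n := by
        have := Finset.card_image_le (s := (Finset.univ : Finset (Fin n))) (f := fun x => (x, x))
        rw [Finset.card_univ, Fintype.card_fin] at this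
        exact_mod_cast this
      have h2 : 4 / ζ ≤ n := hn₂.trans hnn2
      rw [div_le_iff₀ hζ] at h2
      nlinarith
    have hc2 : (S₂.card : ℝ) ≤ ζ / 4 * n ^ 2 := by
      have := hPe.card_biUnion_offDiag_le (ε := ζ / 2) (by positivity)
        (hl.trans (by exact_mod_cast hPl))
      rw [Finset.card_univ, Fintype.card_fin] at this
      refine this.trans (le_of_eq (by ring))
    have hc3 : (S₃.card : ℝ) ≤ ζ / 4 * n ^ 2 := by
      have := hPe.sum_nonUniforms_lt (A := Finset.univ) (ε := ε)
        ⟨⟨0, by omega⟩, Finset.mem_univ _⟩ hε0 hPu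
      rw [Finset.card_univ, Fintype.card_fin] at this
      have h5 : 4 * ε ≤ ζ / 4 := by linarith
      calc (S₃.card : ℝ) ≤ 4 * ε * n ^ 2 := this.le
        _ ≤ ζ / 4 * n ^ 2 := mul_le_mul_of_nonneg_right h5 (by positivity)
    have hc4 : (S₄.card : ℝ) ≤ ζ / 4 * n ^ 2 := by
      have h1 : (S₄.card : ℝ) ≤ ∑ q ∈ (P.parts ×ˢ P.parts), d * (q.1.card * q.2.card : ℝ) := by
        refine (Nat.cast_le.2 Finset.card_biUnion_le).trans ?_
        rw [Nat.cast_sum]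
        refine (Finset.sum_le_sum fun q hq => card_filter_discordant_le G (by linarith) q.1 q.2
          (Finset.mem_filter.1 hq).2).trans ?_
        exact Finset.sum_le_sum_of_subset_of_nonneg (Finset.filter_subset _ _)
          fun _ _ _ => by positivity
      rw [← Finset.mul_sum, Finset.sum_product] at h1
      simp only at h1
      rw [← Finset.sum_mul_sum, ← Nat.cast_sum, P.sum_card_parts, Finset.card_univ,
        Fintype.card_fin] at h1
      rw [sq]
      exact h1
    have h6 := Finset.card_le_card hsub
    have h7 : (S₁ ∪ S₂ ∪ S₃ ∪ S₄).card ≤ S₁.card + S₂.card + S₃.card + S₄.card :=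
      (Finset.card_union_le _ _).trans (Nat.add_le_add_right ((Finset.card_union_le _ _).trans
        (Nat.add_le_add_right (Finset.card_union_le _ _) _)) _)
    have h8 : ((Finset.univ.filter fun p : Fin n × Fin n => ¬Γ.Adj p.1 p.2 ∧
        ¬(G.Adj p.1 p.2 ↔ decide (1 / 2 < (G.edgeDensity (h (f p.1)) (h (f p.2)) : ℝ)) = true)
        ).card : ℝ) ≤ S₁.card + S₂.card + S₃.card + S₄.card := by
      exact_mod_cast h6.trans h7
    have h9 := h8.trans (show _ ≤ ζ * (n : ℝ) ^ 2 by linarith)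
    refine le_trans (le_of_eq (congrArg Nat.cast (congrArg Finset.card ?_))) h9
    ext p
    simp only [Finset.mem_filter]

end Regularity

section Furedi

variable {V : Type*} [Fintype V]

theorem card_filter_adj (Γ : SimpleGraph V) :
    (Finset.univ.filter fun p : V × V => Γ.Adj p.1 p.2).card = 2 * Γ.edgeFinset.card := by
  rw [← Γ.sum_degrees_eq_twice_card_edges, ← Finset.univ_product_univ,
    Finset.card_filter, Finset.sum_product]
  refine Finset.sum_congr rfl fun x _ => ?_
  rw [← Finset.card_filter, ← SimpleGraph.card_neighborFinset_eq_degree]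
  congr 1
  ext y
  simp

/-- A triangle-free graph is close to bipartite, in terms of how close its number of edges is to
the maximum. -/
theorem exists_bipartition_of_triangleFree (Γ : SimpleGraph V)
    (hΓ : ∀ x y z, Γ.Adj x y → Γ.Adj x z → Γ.Adj y z → False) :
    ∃ U : Finset V, 2 * (2 * Γ.edgeFinset.card + cnt (fun p : V × V =>
      Γ.Adj p.1 p.2 ∧ (p.1 ∈ U ↔ p.2 ∈ U))) ≤ Fintype.card V ^ 2 := by
  simp only [cnt_eq_card_filter]
  rcases isEmpty_or_nonempty V with hV | hV
  · refine ⟨∅, ?_⟩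
    have h1 : Γ.edgeFinset = ∅ := by
      ext e
      induction e with | _ x y => exact hV.elim x
    rw [h1, Finset.univ_eq_empty]
    simp
  obtain ⟨v, hv⟩ := Γ.exists_maximal_degree_vertex
  set U := (Γ.neighborFinset v)ᶜ with hU
  have hUc : Uᶜ = Γ.neighborFinset v := compl_compl _
  have hind : ∀ x y, x ∉ U → y ∉ U → ¬Γ.Adj x y := fun x y hx hy h => by
    rw [hU, Finset.mem_compl, not_not, SimpleGraph.mem_neighborFinset] at hx hy
    exact hΓ v x y hx hy h
  refine ⟨U, ?_⟩
  set A := Finset.univ.filter fun p : V × V => Γ.Adj p.1 p.2 ∧ (p.1 ∈ U ↔ p.2 ∈ U) with hA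
  set B := Finset.univ.filter fun p : V × V => Γ.Adj p.1 p.2 ∧ (p.1 ∈ U ∧ p.2 ∉ U) with hB
  set B' := Finset.univ.filter fun p : V × V => Γ.Adj p.1 p.2 ∧ (p.1 ∉ U ∧ p.2 ∈ U) with hB'
  have hBB : B'.card ≤ B.card := by
    refine Finset.card_le_card_of_injOn Prod.swap (fun p hp => ?_) Prod.swap_injective.injOn
    have hp := (Finset.mem_filter.1 (Finset.mem_coe.1 hp)).2
    exact Finset.mem_filter.2 ⟨Finset.mem_univ _, hp.1.symm, hp.2.2, hp.2.1⟩
  have htot : 2 * Γ.edgeFinset.card ≤ A.card + B.card + B'.card := by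
    rw [← card_filter_adj]
    refine (Finset.card_le_card (t := A ∪ B ∪ B') fun p hp => ?_).trans
      ((Finset.card_union_le _ _).trans (Nat.add_le_add_right (Finset.card_union_le _ _) _))
    have hp := (Finset.mem_filter.1 hp).2
    simp only [hA, hB, hB', Finset.mem_union, Finset.mem_filter, Finset.mem_univ, true_and]
    tauto
  have hdeg : A.card + B.card ≤ U.card * Uᶜ.card := by
    have hdisj : Disjoint A B := Finset.disjoint_left.2 fun p hp hq => by
      have hp := (Finset.mem_filter.1 hp).2
      have hq := (Finset.mem_filter.1 hq).2
      exact hq.2.2 (hp.2.1 hq.2.1)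
    rw [← Finset.card_union_of_disjoint hdisj, hUc, SimpleGraph.card_neighborFinset_eq_degree,
      ← hv, ← smul_eq_mul, ← Finset.sum_const]
    calc (A ∪ B).card ≤ (U.sigma fun x => Γ.neighborFinset x).card := by
          refine Finset.card_le_card_of_injOn (fun p => ⟨p.1, p.2⟩) (fun p hp => ?_)
            (fun p _ q _ h => by
              simp only [Sigma.mk.injEq, heq_eq_eq] at h
              exact Prod.ext h.1 h.2)
          have hp := Finset.mem_union.1 (Finset.mem_coe.1 hp)
          refine Finset.mem_coe.2 (Finset.mem_sigma.2 ⟨?_, ?_⟩)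
          · rcases hp with hp | hp
            · have hp := (Finset.mem_filter.1 hp).2
              by_contra hc
              exact hind _ _ hc (fun h => hc (hp.2.2 h)) hp.1
            · exact (Finset.mem_filter.1 hp).2.2.1
          · rw [SimpleGraph.mem_neighborFinset]
            rcases hp with hp | hp
            · exact (Finset.mem_filter.1 hp).2.1
            · exact (Finset.mem_filter.1 hp).2.1
      _ = ∑ x ∈ U, Γ.degree x := by
          rw [Finset.card_sigma]
          exact Finset.sum_congr rfl fun x _ => SimpleGraph.card_neighborFinset_eq_degree _ _
      _ ≤ ∑ x ∈ U, Γ.maxDegree := Finset.sum_le_sum fun x _ => Γ.degree_le_maxDegree x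
  have h4 := four_mul_card_mul_card_compl_le U
  omega

/-- The number of graphs that are prescribed off the edges of `Γ`. -/
theorem cnt_prescribed_off_le (Γ : SimpleGraph V) (H : V → V → Prop) :
    cnt (fun G : SimpleGraph V => ∀ x y, ¬Γ.Adj x y → (G.Adj x y ↔ H x y)) ≤
      2 ^ Γ.edgeFinset.card := by
  calc _ ≤ cnt (fun E : Finset (Sym2 V) => E ∈ Γ.edgeFinset.powerset) := by
        refine cnt_le_of_injOn (fun G => G.edgeFinset ∩ Γ.edgeFinset)
          (fun G _ => Finset.mem_powerset.2 Finset.inter_subset_right) ?_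
        intro G G' h h' he
        ext x y
        by_cases hxy : Γ.Adj x y
        · have := Finset.ext_iff.1 he s(x, y)
          simpa [hxy] using this
        · rw [h x y hxy, h' x y hxy]
    _ = 2 ^ Γ.edgeFinset.card := by
        rw [cnt_eq_card_filter, Finset.filter_mem_eq_inter, Finset.univ_inter,
          Finset.card_powerset]

end Furedi

section Family

/-- `H` has no edges between `U` and its complement and is otherwise, up to `D` ordered pairs, a
blow-up of size `M`. -/
def BlowupCode (n M D : ℕ) (p : Finset (Fin n) × SimpleGraph (Fin n)) : Prop :=
  (∀ x y, p.2.Adj x y → (x ∈ p.1 ↔ y ∈ p.1)) ∧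
    ∃ (f : Fin n → Fin M) (T : Fin M → Fin M → Bool),
      cnt (fun q : Fin n × Fin n => (q.1 ∈ p.1 ↔ q.2 ∈ p.1) ∧
        ¬(p.2.Adj q.1 q.2 ↔ T (f q.1) (f q.2) = true)) ≤ D

theorem cnt_blowupCode_le (n M D : ℕ) :
    cnt (BlowupCode n M D) ≤ 2 ^ n * (M ^ n * (2 ^ (M * M) * vol (n ^ 2) D)) := by
  let Q : Finset (Fin n) × (Fin n → Fin M) × (Fin M → Fin M → Bool) × Finset (Fin n × Fin n) →
    Prop := fun c => True ∧ True ∧ True ∧ c.2.2.2.card ≤ D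
  have hQ : cnt Q = 2 ^ n * (M ^ n * (2 ^ (M * M) * vol (n ^ 2) D)) := by
    have hv := cnt_card_le (X := Fin n × Fin n) D
    rw [Fintype.card_prod, Fintype.card_fin, ← sq] at hv
    rw [← hv]
    change cnt (fun c : Finset (Fin n) × (Fin n → Fin M) × (Fin M → Fin M → Bool) ×
      Finset (Fin n × Fin n) => True ∧ True ∧ True ∧ c.2.2.2.card ≤ D) = _
    rw [cnt_prod (fun _ => True) (fun c : (Fin n → Fin M) × (Fin M → Fin M → Bool) ×
        Finset (Fin n × Fin n) => True ∧ True ∧ c.2.2.card ≤ D),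
      cnt_prod (fun _ => True) (fun c : (Fin M → Fin M → Bool) ×
        Finset (Fin n × Fin n) => True ∧ c.2.card ≤ D),
      cnt_prod (fun _ => True) (fun c : Finset (Fin n × Fin n) => c.card ≤ D),
      cnt_true, cnt_true, cnt_true]
    simp [pow_mul]
  rw [← hQ, ← mul_one (cnt Q)]
  refine cnt_le_mul_of_exists (R := fun c p => (∀ x y, p.2.Adj x y → (x ∈ p.1 ↔ y ∈ p.1)) ∧
    p.1 = c.1 ∧ ∀ x y, (x ∈ c.1 ↔ y ∈ c.1) →
      (¬(p.2.Adj x y ↔ c.2.2.1 (c.2.1 x) (c.2.1 y) = true) ↔ (x, y) ∈ c.2.2.2)) 1 ?_ ?_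
  · rintro p ⟨hp, f, T, hD⟩
    rw [cnt_eq_card_filter] at hD
    refine ⟨⟨p.1, f, T, Finset.univ.filter _⟩, ⟨trivial, trivial, trivial, hD⟩, hp, rfl,
      fun x y hxy => ?_⟩
    simp only [Finset.mem_filter, Finset.mem_univ, true_and]
    tauto
  · rintro c -
    refine cnt_le_one fun p q hp hq => ?_
    obtain ⟨h1, h2, h3⟩ := hp
    obtain ⟨k1, k2, k3⟩ := hq
    refine Prod.ext (h2.trans k2.symm) ?_
    ext x y
    by_cases hxy : x ∈ c.1 ↔ y ∈ c.1
    · have := (h3 x y hxy).trans (k3 x y hxy).symm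
      tauto
    · constructor
      · intro h
        exact (hxy (h2 ▸ h1 x y h)).elim
      · intro h
        exact (hxy (k2 ▸ k1 x y h)).elim

theorem cnt_sparse_blowup_le (n M D g : ℕ) :
    cnt (fun G : SimpleGraph (Fin n) => ∃ (f : Fin n → Fin M) (T R : Fin M → Fin M → Bool)
      (Γ : SimpleGraph (Fin n)), (∀ x y, Γ.Adj x y ↔ R (f x) (f y) = true) ∧
        Γ.edgeFinset.card ≤ g ∧
        cnt (fun p : Fin n × Fin n => ¬Γ.Adj p.1 p.2 ∧
          ¬(G.Adj p.1 p.2 ↔ T (f p.1) (f p.2) = true)) ≤ D) ≤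
      M ^ n * (2 ^ (M * M) * (2 ^ (M * M) * vol (n ^ 2) D)) * 2 ^ g := by
  let Q : (Fin n → Fin M) × (Fin M → Fin M → Bool) × (Fin M → Fin M → Bool) ×
    Finset (Fin n × Fin n) → Prop := fun c => True ∧ True ∧ True ∧ c.2.2.2.card ≤ D
  have hQ : cnt Q = M ^ n * (2 ^ (M * M) * (2 ^ (M * M) * vol (n ^ 2) D)) := by
    have hv := cnt_card_le (X := Fin n × Fin n) D
    rw [Fintype.card_prod, Fintype.card_fin, ← sq] at hv
    rw [← hv]
    change cnt (fun c : (Fin n → Fin M) × (Fin M → Fin M → Bool) × (Fin M → Fin M → Bool) ×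
      Finset (Fin n × Fin n) => True ∧ True ∧ True ∧ c.2.2.2.card ≤ D) = _
    rw [cnt_prod (fun _ => True) (fun c : (Fin M → Fin M → Bool) × (Fin M → Fin M → Bool) ×
        Finset (Fin n × Fin n) => True ∧ True ∧ c.2.2.card ≤ D),
      cnt_prod (fun _ => True) (fun c : (Fin M → Fin M → Bool) ×
        Finset (Fin n × Fin n) => True ∧ c.2.card ≤ D),
      cnt_prod (fun _ => True) (fun c : Finset (Fin n × Fin n) => c.card ≤ D),
      cnt_true, cnt_true]
    simp [pow_mul]
  rw [← hQ]
  refine cnt_le_mul_of_exists (R := fun c G => ∃ Γ : SimpleGraph (Fin n),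
    (∀ x y, Γ.Adj x y ↔ c.2.2.1 (c.1 x) (c.1 y) = true) ∧ Γ.edgeFinset.card ≤ g ∧
    ∀ x y, ¬Γ.Adj x y →
      (¬(G.Adj x y ↔ c.2.1 (c.1 x) (c.1 y) = true) ↔ (x, y) ∈ c.2.2.2)) (2 ^ g) ?_ ?_
  · rintro G ⟨f, T, R, Γ, hR, hg, hD⟩
    rw [cnt_eq_card_filter] at hD
    refine ⟨⟨f, T, R, Finset.univ.filter _⟩, ⟨trivial, trivial, trivial, hD⟩, Γ, hR, hg,
      fun x y hxy => ?_⟩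
    simp only [Finset.mem_filter, Finset.mem_univ, true_and]
    tauto
  · rintro c -
    by_cases hc : ∃ Γ : SimpleGraph (Fin n),
      (∀ x y, Γ.Adj x y ↔ c.2.2.1 (c.1 x) (c.1 y) = true) ∧ Γ.edgeFinset.card ≤ g
    · obtain ⟨Γ, hR, hg⟩ := hc
      refine le_trans (cnt_mono ?_) ((cnt_prescribed_off_le Γ fun x y =>
        ¬(c.2.1 (c.1 x) (c.1 y) = true ↔ (x, y) ∈ c.2.2.2)).trans
          (Nat.pow_le_pow_right two_pos hg))
      rintro G ⟨Γ', hR', -, h⟩ x y hxy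
      have := h x y (fun h' => hxy ((hR x y).2 ((hR' x y).1 h')))
      tauto
    · refine le_trans (cnt_le_one fun G G' h h' => ?_) Nat.one_le_two_pow
      obtain ⟨Γ, h1, h2, -⟩ := h
      exact (hc ⟨Γ, h1, h2⟩).elim

/-- All but few tame graphs agree, off a bipartite graph, with one of few graphs. -/
theorem exists_approx_family {η : ℝ} (hη : 0 < η) :
    ∃ η' : ℝ, 0 < η' ∧ ∃ n₀ : ℕ, ∀ n ≥ n₀,
      ∃ Q : Finset (Fin n) × SimpleGraph (Fin n) → Prop,
        (cnt Q : ℝ) ≤ 2 ^ (η * n ^ 2) ∧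
        (cnt (fun G : SimpleGraph (Fin n) => Tame G ∧ ¬∃ p, Q p ∧ AgreeOff G p.2 p.1) : ℝ) ≤
          2 ^ ((n : ℝ) ^ 2 / 4 - η' * n ^ 2) := by
  obtain ⟨μ, hμ, hμ1, hvμ⟩ : ∃ μ : ℝ, 0 < μ ∧ μ ≤ 1 ∧ ∀ N k : ℕ, (k : ℝ) ≤ μ * N →
      (vol N k : ℝ) ≤ 2 ^ (η / 4 * N) := by
    obtain ⟨μ, hμ, hvμ⟩ := exists_vol_le (show 0 < η / 4 by positivity)
    exact ⟨min μ 1, lt_min hμ one_pos, min_le_right _ _, fun N k h =>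
      hvμ N k (h.trans (mul_le_mul_of_nonneg_right (min_le_left _ _) (Nat.cast_nonneg _)))⟩
  obtain ⟨ν, hν, hvν⟩ := exists_vol_le (show 0 < μ / 8 by positivity)
  set ζ : ℝ := min 1 (min (μ / 2) ν) with hζ
  have hζ0 : 0 < ζ := lt_min one_pos (lt_min (by positivity) hν)
  have hζμ : ζ ≤ μ / 2 := (min_le_right _ _).trans (min_le_left _ _)
  have hζν : ζ ≤ ν := (min_le_right _ _).trans (min_le_right _ _)
  obtain ⟨M, n₁, hM, hblow⟩ := Tame.exists_blowup hζ0 (min_le_left _ _)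
  obtain ⟨n₂, hn₂⟩ := exists_nat_ge ((1 + M + 2 * M * M) / (η / 4))
  obtain ⟨n₃, hn₃⟩ := exists_nat_ge ((1 + M + 2 * M * M) / (μ / 16))
  refine ⟨μ / 16, by positivity, n₁ + n₂ + n₃ + 1, fun n hn => ?_⟩
  have hn1 : (1 : ℝ) ≤ n := by exact_mod_cast (by omega : 1 ≤ n)
  have hM2 : (M : ℝ) ≤ 2 ^ (M : ℝ) := by
    rw [Real.rpow_natCast]
    exact_mod_cast M.lt_two_pow_self.le
  have hMn : (M : ℝ) ^ n ≤ 2 ^ ((M : ℝ) * n) := by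
    rw [Real.rpow_mul two_pos.le, Real.rpow_natCast]
    exact pow_le_pow_left₀ (Nat.cast_nonneg _) hM2 _
  have hsmall : ∀ c : ℝ, 0 < c → (1 + M + 2 * M * M) / c ≤ n →
      (n : ℝ) + M * n + 2 * (M * M) ≤ c * n ^ 2 := fun c hc h => by
    rw [div_le_iff₀ hc] at h
    have hM0 : (0 : ℝ) ≤ M := Nat.cast_nonneg _
    nlinarith [mul_le_mul_of_nonneg_right h (by linarith : (0 : ℝ) ≤ n),
      mul_nonneg (mul_nonneg hM0 hM0) (by linarith : (0 : ℝ) ≤ n - 1)]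
  have hb1 := hsmall _ (by positivity) (hn₂.trans (by exact_mod_cast (by omega : n₂ ≤ n)))
  have hb2 := hsmall _ (by positivity) (hn₃.trans (by exact_mod_cast (by omega : n₃ ≤ n)))
  have hn20 : (0 : ℝ) ≤ (n : ℝ) ^ 2 := by positivity
  refine ⟨BlowupCode n M ⌊μ * n ^ 2⌋₊, ?_, ?_⟩
  · have h1 : (cnt (BlowupCode n M ⌊μ * n ^ 2⌋₊) : ℝ) ≤
        2 ^ n * (M ^ n * (2 ^ (M * M) * vol (n ^ 2) ⌊μ * n ^ 2⌋₊)) := by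
      exact_mod_cast cnt_blowupCode_le n M _
    have h2 := hvμ (n ^ 2) ⌊μ * n ^ 2⌋₊ (by
      push_cast
      exact Nat.floor_le (by positivity))
    calc _ ≤ (2 : ℝ) ^ n * (M ^ n * (2 ^ (M * M) * vol (n ^ 2) ⌊μ * n ^ 2⌋₊)) := h1
      _ ≤ (2 : ℝ) ^ (n : ℝ) * (2 ^ ((M : ℝ) * n) * (2 ^ ((M : ℝ) * M) *
          2 ^ (η / 4 * (n ^ 2 : ℕ)))) := by
        rw [← Nat.cast_mul M M, Real.rpow_natCast, Real.rpow_natCast]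
        gcongr
      _ = 2 ^ ((n : ℝ) + (M * n + (M * M + η / 4 * (n ^ 2 : ℕ)))) := by
        rw [Real.rpow_add two_pos, Real.rpow_add two_pos, Real.rpow_add two_pos]
      _ ≤ 2 ^ (η * n ^ 2) := by
        refine Real.rpow_le_rpow_of_exponent_le one_le_two ?_
        push_cast
        nlinarith [mul_self_nonneg (M : ℝ)]
  · set g : ℕ := ⌊(n : ℝ) ^ 2 / 4 - μ / 4 * n ^ 2⌋₊ with hg
    have key : cnt (fun G : SimpleGraph (Fin n) => Tame G ∧
        ¬∃ p, BlowupCode n M ⌊μ * n ^ 2⌋₊ p ∧ AgreeOff G p.2 p.1) ≤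
        M ^ n * (2 ^ (M * M) * (2 ^ (M * M) * vol (n ^ 2) ⌊ζ * n ^ 2⌋₊)) * 2 ^ g := by
      refine le_trans (cnt_mono ?_) (cnt_sparse_blowup_le n M ⌊ζ * n ^ 2⌋₊ g)
      rintro G ⟨hG, hno⟩
      obtain ⟨f, T, R, Γ, hR, htri, hdiff⟩ := hblow n (by omega) G hG
      rw [← cnt_eq_card_filter] at hdiff
      refine ⟨f, T, R, Γ, hR, ?_, Nat.le_floor hdiff⟩
      by_contra hcon
      obtain ⟨U, hU⟩ := exists_bipartition_of_triangleFree Γ htri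
      rw [not_le, hg] at hcon
      have hcon := Nat.lt_of_floor_lt hcon
      rw [Fintype.card_fin] at hU
      have hU : 2 * (2 * (Γ.edgeFinset.card : ℝ) + (cnt (fun p : Fin n × Fin n =>
          Γ.Adj p.1 p.2 ∧ (p.1 ∈ U ↔ p.2 ∈ U)) : ℝ)) ≤ (n : ℝ) ^ 2 := by
        exact_mod_cast hU
      let H : SimpleGraph (Fin n) :=
        { Adj := fun x y => G.Adj x y ∧ (x ∈ U ↔ y ∈ U)
          symm := ⟨fun x y h => ⟨h.1.symm, h.2.symm⟩⟩
          loopless := ⟨fun x h => G.loopless.irrefl x h.1⟩ }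
      refine hno ⟨(U, H), ⟨fun x y h => h.2, f, T, ?_⟩, fun x y hxy => ?_⟩
      · refine Nat.le_floor ?_
        have h5 : cnt (fun q : Fin n × Fin n => (q.1 ∈ U ↔ q.2 ∈ U) ∧
            ¬(H.Adj q.1 q.2 ↔ T (f q.1) (f q.2) = true)) ≤
            cnt (fun p : Fin n × Fin n => Γ.Adj p.1 p.2 ∧ (p.1 ∈ U ↔ p.2 ∈ U)) +
            cnt (fun p : Fin n × Fin n => ¬Γ.Adj p.1 p.2 ∧
              ¬(G.Adj p.1 p.2 ↔ T (f p.1) (f p.2) = true)) := by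
          refine le_trans (cnt_mono ?_) (cnt_or_le _ _)
          intro q hq
          simp only [H] at hq
          tauto
        refine (Nat.cast_le (α := ℝ).2 h5).trans ?_
        push_cast
        nlinarith
      · show G.Adj x y ↔ G.Adj x y ∧ (x ∈ U ↔ y ∈ U)
        tauto
    have h2 := hvν (n ^ 2) ⌊ζ * n ^ 2⌋₊ (by
      push_cast
      exact (Nat.floor_le (by positivity)).trans (mul_le_mul_of_nonneg_right hζν hn20))
    have key' : (cnt (fun G : SimpleGraph (Fin n) => Tame G ∧
        ¬∃ p, BlowupCode n M ⌊μ * n ^ 2⌋₊ p ∧ AgreeOff G p.2 p.1) : ℝ) ≤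
        M ^ n * (2 ^ (M * M) * (2 ^ (M * M) * vol (n ^ 2) ⌊ζ * n ^ 2⌋₊)) * 2 ^ g := by
      exact_mod_cast key
    have hgle : (g : ℝ) ≤ (n : ℝ) ^ 2 / 4 - μ / 4 * n ^ 2 :=
      Nat.floor_le (by nlinarith)
    calc _ ≤ (M : ℝ) ^ n * (2 ^ (M * M) * (2 ^ (M * M) * vol (n ^ 2) ⌊ζ * n ^ 2⌋₊)) * 2 ^ g :=
          key'
      _ ≤ (2 : ℝ) ^ ((M : ℝ) * n) * (2 ^ ((M : ℝ) * M) * (2 ^ ((M : ℝ) * M) *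
          2 ^ (μ / 8 * (n ^ 2 : ℕ)))) * 2 ^ (g : ℝ) := by
        rw [← Nat.cast_mul M M, Real.rpow_natCast, Real.rpow_natCast]
        gcongr
      _ = 2 ^ ((M : ℝ) * n + (M * M + (M * M + μ / 8 * (n ^ 2 : ℕ))) + g) := by
        rw [Real.rpow_add two_pos, Real.rpow_add two_pos, Real.rpow_add two_pos,
          Real.rpow_add two_pos]
      _ ≤ 2 ^ ((n : ℝ) ^ 2 / 4 - μ / 16 * n ^ 2) := by
        refine Real.rpow_le_rpow_of_exponent_le one_le_two ?_
        push_cast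
        nlinarith

end Family

section Cells

variable {V : Type*}

theorem AgreeOff.compl {G H : SimpleGraph V} {U : Finset V} (h : AgreeOff G H U) :
    AgreeOff Gᶜ Hᶜ U := fun x y hxy => by
  rw [SimpleGraph.compl_adj, SimpleGraph.compl_adj, h x y hxy]

theorem agreeOff_compl_iff [Fintype V] {G H : SimpleGraph V} {U : Finset V} :
    AgreeOff G H Uᶜ ↔ AgreeOff G H U := by
  refine forall_congr' fun x => forall_congr' fun y => ?_
  rw [Finset.mem_compl, Finset.mem_compl, not_iff_not]

theorem cast_le_rpow_of_mul_pow_le {N a k b : ℕ} (hb : b < 64)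
    (h : N * (b + 1) ^ k ≤ 2 ^ a * b ^ k) : (N : ℝ) ≤ 2 ^ ((a : ℝ) - k / 64) := by
  have h1 : (N : ℝ) * (b + 1) ^ k ≤ 2 ^ a * b ^ k := by exact_mod_cast h
  have hb' : (b : ℝ) ≤ 63 := by exact_mod_cast Nat.lt_succ_iff.1 hb
  have hb1 : (0 : ℝ) < b + 1 := by positivity
  have h2 : (N : ℝ) ≤ 2 ^ a * ((b : ℝ) / (b + 1)) ^ k := by
    rw [div_pow, ← mul_div_assoc, le_div_iff₀ (by positivity)]
    exact h1
  have h3 : (63 / 64 : ℝ) ≤ 2 ^ (-(1 / 64 : ℝ)) := by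
    have h4 : ((63 / 64 : ℝ) ^ (64 : ℕ)) ^ (1 / 64 : ℝ) ≤ (2⁻¹ : ℝ) ^ (1 / 64 : ℝ) :=
      Real.rpow_le_rpow (by positivity) (by norm_num) (by norm_num)
    rw [← Real.rpow_natCast, ← Real.rpow_mul (by norm_num)] at h4
    rw [Real.rpow_neg two_pos.le, ← Real.inv_rpow two_pos.le]
    refine le_trans (le_of_eq ?_) h4
    norm_num
  have h5 : (b : ℝ) / (b + 1) ≤ 2 ^ (-(1 / 64 : ℝ)) := by
    refine le_trans ?_ h3
    rw [div_le_div_iff₀ hb1 (by norm_num)]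
    linarith
  calc (N : ℝ) ≤ 2 ^ a * ((b : ℝ) / (b + 1)) ^ k := h2
    _ ≤ 2 ^ a * (2 ^ (-(1 / 64 : ℝ))) ^ k := by gcongr
    _ = 2 ^ ((a : ℝ) - k / 64) := by
      rw [← Real.rpow_natCast, ← Real.rpow_natCast, ← Real.rpow_mul two_pos.le,
        ← Real.rpow_add two_pos]
      congr 1
      ring

theorem cnt_agreeOff_avoid_product [Fintype V] {r₁ r₂ : ℕ} (H : SimpleGraph V) (U : Finset V)
    {P : Finset (Fin r₁ → V)} {M : Finset (Fin r₂ → V)} (hP : DisjFam P) (hM : DisjFam M)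
    (hPU : ∀ e ∈ P, ∀ a, e a ∈ U) (hMU : ∀ e ∈ M, ∀ a, e a ∉ U) (pat : Fin r₁ → Fin r₂ → Bool)
    (hr : 2 ^ (r₁ * r₂) ≤ 64) :
    (cnt (fun G : SimpleGraph V => AgreeOff G H U ∧ ∀ e ∈ P, ∀ f ∈ M,
      ∃ a b, ¬(G.Adj (e a) (f b) ↔ pat a b = true)) : ℝ) ≤
      2 ^ (((U.card * Uᶜ.card : ℕ) : ℝ) - ((P.card * M.card : ℕ) : ℝ) / 64) := by
  have h1 := cnt_agreeOff_avoid H U (P ×ˢ M)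
    (fun i (a : Fin (r₁ * r₂)) => (i.1 (finProdFinEquiv.symm a).1, i.2 (finProdFinEquiv.symm a).2))
    (fun _ a => pat (finProdFinEquiv.symm a).1 (finProdFinEquiv.symm a).2) ?_ ?_ ?_
  · have h2 : 2 ^ (r₁ * r₂) - 1 + 1 = 2 ^ (r₁ * r₂) := Nat.sub_add_cancel Nat.one_le_two_pow
    rw [Finset.card_product] at h1
    refine cast_le_rpow_of_mul_pow_le (b := 2 ^ (r₁ * r₂) - 1) (by omega) ?_
    rw [h2]
    refine le_trans (Nat.mul_le_mul_right _ (cnt_mono ?_)) h1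
    rintro G ⟨hG, h⟩
    refine ⟨hG, fun i hi => ?_⟩
    obtain ⟨a, b, hab⟩ := h i.1 (Finset.mem_product.1 hi).1 i.2 (Finset.mem_product.1 hi).2
    exact ⟨finProdFinEquiv (a, b), by simpa using hab⟩
  · intro i hi a
    exact ⟨hPU _ (Finset.mem_product.1 hi).1 _, hMU _ (Finset.mem_product.1 hi).2 _⟩
  · intro i hi a b hab
    have h3 := Prod.ext_iff.1 hab
    refine finProdFinEquiv.symm.injective (Prod.ext ?_ ?_)
    · exact hP.inj _ (Finset.mem_product.1 hi).1 h3.1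
    · exact hM.inj _ (Finset.mem_product.1 hi).2 h3.2
  · intro i hi j hj hij a b hab
    have h3 := Prod.ext_iff.1 hab
    by_cases h : i.1 = j.1
    · refine hM.disj _ (Finset.mem_product.1 hi).2 _ (Finset.mem_product.1 hj).2
        (fun h' => hij (Prod.ext h h')) _ _ h3.2
    · exact hP.disj _ (Finset.mem_product.1 hi).1 _ (Finset.mem_product.1 hj).1 h _ _ h3.1

end Cells

section Obstructions

variable {V : Type*}

/-- An induced path on three vertices. -/
def IsPath3 (G : SimpleGraph V) (e : Fin 3 → V) : Prop :=
  e 0 ≠ e 2 ∧ G.Adj (e 0) (e 1) ∧ G.Adj (e 1) (e 2) ∧ ¬G.Adj (e 0) (e 2)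

theorem IsPath3.injective {G : SimpleGraph V} {e : Fin 3 → V} (h : IsPath3 G e) :
    Function.Injective e := by
  have h1 := h.2.1.ne
  have h2 := h.2.2.1.ne
  have h3 := h.1
  intro a b hab
  fin_cases a <;> fin_cases b <;> simp_all

theorem injective_pair {e : Fin 2 → V} (h : e 0 ≠ e 1) : Function.Injective e := by
  intro a b hab
  fin_cases a <;> fin_cases b <;> simp_all

/-- Many disjoint induced paths in `U` together with a large matching in `W`. -/
def PathMatching (G : SimpleGraph V) (U W : Finset V) (q : ℕ) : Prop :=
  ∃ (P : Finset (Fin 3 → V)) (M : Finset (Fin 2 → V)), DisjFam P ∧ DisjFam M ∧ P.card = q ∧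
    M.card = q ∧ (∀ e ∈ P, IsPath3 G e ∧ ∀ a, e a ∈ U) ∧
    ∀ f ∈ M, G.Adj (f 0) (f 1) ∧ ∀ a, f a ∈ W

theorem AgreeOff.pathMatching [Fintype V] {G H : SimpleGraph V} {U : Finset V}
    (h : AgreeOff G H U) {q : ℕ} (hG : PathMatching G U Uᶜ q) : PathMatching H U Uᶜ q := by
  obtain ⟨P, M, hP, hM, hPc, hMc, hPG, hMG⟩ := hG
  refine ⟨P, M, hP, hM, hPc, hMc, fun e he => ⟨?_, (hPG e he).2⟩, fun f hf => ⟨?_, (hMG f hf).2⟩⟩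
  · have hU := (hPG e he).2
    have hab : ∀ a b, G.Adj (e a) (e b) ↔ H.Adj (e a) (e b) := fun a b =>
      h _ _ (iff_of_true (hU a) (hU b))
    have := (hPG e he).1
    rwa [IsPath3, hab, hab, hab] at this
  · have hU := (hMG f hf).2
    rw [← h _ _ (iff_of_false (Finset.mem_compl.1 (hU 0)) (Finset.mem_compl.1 (hU 1)))]
    exact (hMG f hf).1

theorem cnt_pathMatching_le [Fintype V] (H : SimpleGraph V) (U : Finset V) (q : ℕ) :
    (cnt (fun G : SimpleGraph V => Tame G ∧ AgreeOff G H U ∧ PathMatching G U Uᶜ q) : ℝ) ≤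
      2 ^ (((U.card * Uᶜ.card : ℕ) : ℝ) - ((q * q : ℕ) : ℝ) / 64) := by
  by_cases hH : PathMatching H U Uᶜ q
  · obtain ⟨P, M, hP, hM, hPc, hMc, hPH, hMH⟩ := hH
    have h1 := cnt_agreeOff_avoid_product H U hP hM (fun e he => (hPH e he).2)
      (fun e he a => Finset.mem_compl.1 ((hMH e he).2 a))
      (fun a b => decide (a = 2 ∧ b = 0 ∨ a = 0 ∧ b = 1)) (by norm_num)
    rw [hPc, hMc] at h1
    refine (Nat.cast_le.2 (cnt_mono ?_)).trans h1
    rintro G ⟨hG, hGH, -⟩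
    refine ⟨hGH, fun e he f hf => ?_⟩
    by_contra! hcon
    have hU := (hPH e he).2
    have hW := (hMH f hf).2
    have hab : ∀ a b, G.Adj (e a) (e b) ↔ H.Adj (e a) (e b) := fun a b =>
      hGH _ _ (iff_of_true (hU a) (hU b))
    obtain ⟨-, p1, p2, p3⟩ := (hPH e he).1
    rw [← hab] at p1 p2 p3
    have p4 := (hMH f hf).1
    rw [← hGH _ _ (iff_of_false (Finset.mem_compl.1 (hW 0)) (Finset.mem_compl.1 (hW 1)))] at p4
    have c20 : G.Adj (e 2) (f 0) := (hcon 2 0).2 (by decide)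
    have c01 : G.Adj (e 0) (f 1) := (hcon 0 1).2 (by decide)
    have c00 : ¬G.Adj (e 0) (f 0) := fun h => absurd ((hcon 0 0).1 h) (by decide)
    have c10 : ¬G.Adj (e 1) (f 0) := fun h => absurd ((hcon 1 0).1 h) (by decide)
    have c11 : ¬G.Adj (e 1) (f 1) := fun h => absurd ((hcon 1 1).1 h) (by decide)
    have c21 : ¬G.Adj (e 2) (f 1) := fun h => absurd ((hcon 2 1).1 h) (by decide)
    exact hG.c5 _ _ _ _ _ p1 p2 c20 p4 c01.symm p3 c10 c21 (fun h => c00 h.symm)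
      (fun h => c11 h.symm)
  · have : cnt (fun G : SimpleGraph V => Tame G ∧ AgreeOff G H U ∧ PathMatching G U Uᶜ q) = 0 := by
      refine Nat.card_eq_zero.2 (Or.inl ⟨fun G => hH (G.2.2.1.pathMatching G.2.2.2)⟩)
    rw [this, Nat.cast_zero]
    positivity

/-- All adjacency patterns to disjoint pairs in `B` occur from large subsets of `A`. -/
def Rich (G : SimpleGraph V) (A B : Finset V) (m : ℕ) : Prop :=
  ∀ X ⊆ A, m ≤ X.card → ∀ M : Finset (Fin 2 → V), DisjFam M → (∀ e ∈ M, ∀ a, e a ∈ B) →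
    m ≤ M.card → ∀ pat : Fin 2 → Bool, ∃ x ∈ X, ∃ e ∈ M, ∀ b, G.Adj x (e b) ↔ pat b = true

theorem Rich.mono {G : SimpleGraph V} {A B A' B' : Finset V} {m m' : ℕ} (h : Rich G A B m)
    (hA : A' ⊆ A) (hB : B' ⊆ B) (hm : m ≤ m') : Rich G A' B' m' :=
  fun X hX hXm M hM hMB hMm => h X (hX.trans hA) (hm.trans hXm) M hM
    (fun e he a => hB (hMB e he a)) (hm.trans hMm)

theorem Rich.compl {G : SimpleGraph V} {A B : Finset V} {m : ℕ} (h : Rich G A B m)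
    (hAB : Disjoint A B) : Rich Gᶜ A B m := fun X hX hXm M hM hMB hMm pat => by
  obtain ⟨x, hx, e, he, hxe⟩ := h X hX hXm M hM hMB hMm (fun b => !pat b)
  refine ⟨x, hx, e, he, fun b => ?_⟩
  have hne : x ≠ e b := fun h => Finset.disjoint_left.1 hAB (hX hx) (h ▸ hMB e he b)
  rw [SimpleGraph.compl_adj, hxe b]
  simp [hne]

theorem cnt_not_rich_le [Fintype V] (H : SimpleGraph V) (U : Finset V) {m : ℕ} :
    (cnt (fun G : SimpleGraph V => AgreeOff G H U ∧ ¬Rich G U Uᶜ m) : ℝ) ≤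
      4 * 2 ^ Fintype.card V * (Fintype.card V ^ 2) ^ m *
        2 ^ (((U.card * Uᶜ.card : ℕ) : ℝ) - ((m * m : ℕ) : ℝ) / 64) := by
  set t : ℝ := 2 ^ (((U.card * Uᶜ.card : ℕ) : ℝ) - ((m * m : ℕ) : ℝ) / 64) with ht
  have ht0 : 0 ≤ t := by positivity
  let Q : (Fin 2 → Bool) × Finset V × (Fin m → Fin 2 → V) → Prop := fun c =>
    c.2.1 ⊆ U ∧ m ≤ c.2.1.card ∧ DisjFam (Finset.univ.image c.2.2) ∧
      (Finset.univ.image c.2.2).card = m ∧ ∀ i a, c.2.2 i a ∉ U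
  have h1 : cnt (fun G : SimpleGraph V => AgreeOff G H U ∧ ¬Rich G U Uᶜ m) ≤ cnt Q * ⌊t⌋₊ := by
    refine cnt_le_mul_of_exists (R := fun c G => AgreeOff G H U ∧
      ∀ e ∈ c.2.1.image (fun x (_ : Fin 1) => x), ∀ f ∈ Finset.univ.image c.2.2,
        ∃ a b, ¬(G.Adj (e a) (f b) ↔ c.1 b = true)) _ ?_ ?_
    · rintro G ⟨hG, hr⟩
      simp only [Rich, not_forall] at hr
      obtain ⟨X, hXU, hXm, M, hM, hMU, hMm, pat, hcon⟩ := hr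
      obtain ⟨N, hNM, hNm⟩ := Finset.exists_subset_card_eq hMm
      let g : Fin m → Fin 2 → V := fun i => (N.equivFinOfCardEq hNm).symm i
      have hg : Finset.univ.image g = N := by
        ext e
        simp only [Finset.mem_image, Finset.mem_univ, true_and, g]
        exact ⟨fun ⟨i, hi⟩ => hi ▸ Subtype.prop _, fun he =>
          ⟨N.equivFinOfCardEq hNm ⟨e, he⟩, by simp⟩⟩
      refine ⟨(pat, X, g), ⟨hXU, hXm, ?_, ?_, fun i a => ?_⟩, hG, ?_⟩
      · exact hg.symm ▸ hM.subset hNM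
      · exact hg.symm ▸ hNm
      · exact Finset.mem_compl.1 (hMU _ (hNM (Subtype.prop _)) a)
      · intro e he f hf
        obtain ⟨x, hx, rfl⟩ := Finset.mem_image.1 he
        have hf : f ∈ M := hNM (hg ▸ hf)
        by_contra! hno
        exact hcon ⟨x, hx, f, hf, fun b => hno 0 b⟩
    · rintro ⟨pat, X, g⟩ ⟨hXU, hXm, hd, hc, hgU⟩
      refine Nat.le_floor ((cnt_agreeOff_avoid_product H U (r₁ := 1) (r₂ := 2)
        (P := X.image (fun x (_ : Fin 1) => x)) (M := Finset.univ.image g) ⟨?_, ?_⟩ hd ?_ ?_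
        (fun _ b => pat b) (by norm_num)).trans ?_)
      · rintro e - a b -
        exact Subsingleton.elim _ _
      · intro e he e' he' hne a b hab
        obtain ⟨x, hx, rfl⟩ := Finset.mem_image.1 he
        obtain ⟨y, hy, rfl⟩ := Finset.mem_image.1 he'
        exact hne (funext fun _ => hab)
      · intro e he a
        obtain ⟨x, hx, rfl⟩ := Finset.mem_image.1 he
        exact hXU hx
      · intro e he a
        obtain ⟨i, -, rfl⟩ := Finset.mem_image.1 he
        exact hgU i a
      · refine Real.rpow_le_rpow_of_exponent_le one_le_two ?_
        rw [hc, Finset.card_image_of_injective _ fun x y hxy => congrFun hxy 0]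
        have : ((m * m : ℕ) : ℝ) ≤ ((X.card * m : ℕ) : ℝ) := by
          exact_mod_cast Nat.mul_le_mul_right m hXm
        linarith
  have h2 : cnt Q ≤ 4 * 2 ^ Fintype.card V * (Fintype.card V ^ 2) ^ m := by
    refine (cnt_le_card Q).trans (le_of_eq ?_)
    simp only [Nat.card_eq_fintype_card, Fintype.card_prod, Fintype.card_fun, Fintype.card_bool,
      Fintype.card_fin, Fintype.card_finset]
    ring
  calc (cnt (fun G : SimpleGraph V => AgreeOff G H U ∧ ¬Rich G U Uᶜ m) : ℝ)
      ≤ cnt Q * (⌊t⌋₊ : ℝ) := by exact_mod_cast h1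
    _ ≤ cnt Q * t := by gcongr; exact Nat.floor_le ht0
    _ ≤ _ := by gcongr; exact_mod_cast h2

end Obstructions

section Structured

variable {V : Type*}

/-- Up to few vertices `G` is a unipolar arrangement `(A, B)` with random-like cross edges. -/
structure Str [Fintype V] (G : SimpleGraph V) (A B : Finset V) (m : ℕ) : Prop where
  clique : G.IsClique (A : Set V)
  cluster : ClusterOn G (B : Set V)
  disjoint : Disjoint A B
  lower : Fintype.card V ≤ 2 * A.card + 2 * m
  upper : 2 * A.card ≤ Fintype.card V + 2 * m
  cover : Fintype.card V ≤ A.card + B.card + m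
  rich : Rich G A B m

/-- Few vertices meet all induced paths in `W`. -/
theorem exists_clusterOn_or_paths (G : SimpleGraph V) (W : Finset V) (q : ℕ) :
    (∃ P : Finset (Fin 3 → V), DisjFam P ∧ P.card = q ∧ ∀ e ∈ P, IsPath3 G e ∧ ∀ a, e a ∈ W) ∨
      ∃ E : Finset V, E.card ≤ 3 * q ∧ ClusterOn G ((W \ E : Finset V) : Set V) := by
  rcases exists_disjFam_or_hitting (fun e : Fin 3 → V => IsPath3 G e ∧ ∀ a, e a ∈ W)
    (fun e he => he.1.injective) q with h | ⟨E, hE, h⟩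
  · exact Or.inl h
  · refine Or.inr ⟨E, hE, fun x hx y hy z hz hxy hyz hxz => ?_⟩
    by_contra hcon
    simp only [Finset.coe_sdiff, Set.mem_sdiff, Finset.mem_coe] at hx hy hz
    obtain ⟨a, ha⟩ := h ![x, y, z] ⟨⟨hxz, hxy, hyz, hcon⟩, fun a => by
      fin_cases a <;> simp [hx.1, hy.1, hz.1]⟩
    fin_cases a <;> simp_all

theorem exists_independent_or_matching (G : SimpleGraph V) (W : Finset V) (q : ℕ) :
    (∃ M : Finset (Fin 2 → V), DisjFam M ∧ M.card = q ∧
      ∀ f ∈ M, G.Adj (f 0) (f 1) ∧ ∀ a, f a ∈ W) ∨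
      ∃ E : Finset V, E.card ≤ 2 * q ∧ ∀ x ∈ W \ E, ∀ y ∈ W \ E, ¬G.Adj x y := by
  rcases exists_disjFam_or_hitting (fun f : Fin 2 → V => G.Adj (f 0) (f 1) ∧ ∀ a, f a ∈ W)
    (fun f hf => injective_pair hf.1.ne) q with h | ⟨E, hE, h⟩
  · exact Or.inl h
  · refine Or.inr ⟨E, hE, fun x hx y hy hxy => ?_⟩
    rw [Finset.mem_sdiff] at hx hy
    obtain ⟨a, ha⟩ := h ![x, y] ⟨hxy, fun a => by fin_cases a <;> simp [hx.1, hy.1]⟩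
    fin_cases a <;> simp_all

/-- A set inducing a cluster graph and a co-cluster graph is a clique or independent. -/
theorem ClusterOn.isClique_or_isIndep {G : SimpleGraph V} {W : Set V} (h : ClusterOn G W)
    (h' : ClusterOn Gᶜ W) : G.IsClique W ∨ Gᶜ.IsClique W := by
  by_contra! hcon
  obtain ⟨h1, h2⟩ := hcon
  simp only [SimpleGraph.IsClique, Set.Pairwise, not_forall] at h1 h2
  obtain ⟨x, hx, y, hy, hxy, hn⟩ := h1
  obtain ⟨u, hu, v, hv, huv, hadj⟩ := h2
  have hadj : G.Adj u v := by
    rw [SimpleGraph.compl_adj] at hadj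
    tauto
  have hco : ∀ w ∈ W, w = u ∨ w = v ∨ G.Adj w u := fun w hw => by
    by_contra! hc
    obtain ⟨c1, c2, c3⟩ := hc
    have hwv : ¬G.Adj w v := fun h3 => c3 (h w hw v hv u hu h3 hadj.symm c1)
    have := h' u hu w hw v hv ⟨c1.symm, fun h => c3 h.symm⟩ ⟨c2, hwv⟩ huv
    exact this.2 hadj
  have hco' : ∀ w ∈ W, w ≠ u → G.Adj w u := fun w hw hne => by
    rcases hco w hw with h3 | h3 | h3
    · exact (hne h3).elim
    · exact h3 ▸ hadj.symm
    · exact h3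
  by_cases hxu : x = u
  · exact hn (hxu ▸ (hco' y hy (fun h3 => hxy (hxu.trans h3.symm))).symm)
  by_cases hyu : y = u
  · exact hn (hyu ▸ hco' x hx hxu)
  exact hn (h x hx u hu y hy (hco' x hx hxu) (hco' y hy hyu).symm hxy)

theorem exists_str_of_nearClique [Fintype V] {G : SimpleGraph V} {U W E : Finset V} {m q : ℕ}
    (hUW : Disjoint U W) (hcov : Fintype.card V = U.card + W.card)
    (hlo : Fintype.card V ≤ 2 * U.card + m) (hhi : 2 * U.card ≤ Fintype.card V + m)
    (hqm : 12 * q ≤ m) (hn : 3 * m + 4 ≤ Fintype.card V)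
    (hE : E.card ≤ 6 * q) (hcl : G.IsClique ((U \ E : Finset V) : Set V))
    (hP : ¬PathMatching G W U q) (hr : Rich G U W m) :
    ∃ A B, Str G A B m := by
  rcases exists_clusterOn_or_paths G W q with ⟨P, hP1, hP2, hP3⟩ | ⟨F, hF, hFc⟩
  · rcases exists_independent_or_matching G U q with ⟨M, hM1, hM2, hM3⟩ | ⟨F, hF, hFi⟩
    · exact (hP ⟨P, M, hP1, hM1, hP2, hM2, hP3, hM3⟩).elim
    · exfalso
      have h1 : U.card - E.card - F.card ≤ ((U \ E) \ F).card :=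
        (Nat.sub_le_sub_right (Finset.le_card_sdiff E U) _).trans (Finset.le_card_sdiff F (U \ E))
      obtain ⟨x, hx, y, hy, hxy⟩ := Finset.one_lt_card.1 (show 1 < ((U \ E) \ F).card by omega)
      have hx := Finset.mem_sdiff.1 hx
      have hy := Finset.mem_sdiff.1 hy
      exact hFi x (Finset.mem_sdiff.2 ⟨(Finset.mem_sdiff.1 hx.1).1, hx.2⟩) y
        (Finset.mem_sdiff.2 ⟨(Finset.mem_sdiff.1 hy.1).1, hy.2⟩)
        (hcl (Finset.mem_coe.2 hx.1) (Finset.mem_coe.2 hy.1) hxy)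
  · have h1 := Finset.le_card_sdiff E U
    have h2 := Finset.le_card_sdiff F W
    have h3 := Finset.card_le_card (Finset.sdiff_subset (s := U) (t := E))
    exact ⟨U \ E, W \ F, hcl, hFc, hUW.mono Finset.sdiff_subset Finset.sdiff_subset,
      by omega, by omega, by omega, hr.mono Finset.sdiff_subset Finset.sdiff_subset le_rfl⟩

theorem exists_str [Fintype V] {G : SimpleGraph V} {U : Finset V} {m q : ℕ}
    (hlo : Fintype.card V ≤ 2 * U.card + m) (hhi : 2 * U.card ≤ Fintype.card V + m)
    (hqm : 12 * q ≤ m) (hn : 3 * m + 4 ≤ Fintype.card V)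
    (h1 : ¬PathMatching G U Uᶜ q) (h2 : ¬PathMatching Gᶜ U Uᶜ q)
    (h3 : ¬PathMatching G Uᶜ U q) (h4 : ¬PathMatching Gᶜ Uᶜ U q)
    (hr : Rich G U Uᶜ m) (hr' : Rich G Uᶜ U m) :
    ∃ A B, Str G A B m ∨ Str Gᶜ A B m := by
  have hcov : Fintype.card V = U.card + Uᶜ.card := U.card_add_card_compl.symm
  have hdis : Disjoint U Uᶜ := disjoint_compl_right
  have hclq : ∀ {G' : SimpleGraph V} {W : Finset V}, (∀ x ∈ W, ∀ y ∈ W, ¬G'ᶜ.Adj x y) →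
      G'.IsClique (W : Set V) := fun {G' W} h x hx y hy hxy => by
    have := h x hx y hy
    rw [SimpleGraph.compl_adj] at this
    tauto
  rcases exists_independent_or_matching Gᶜ U q with ⟨M, hM1, hM2, hM3⟩ | ⟨E, hE, hEi⟩
  swap
  · obtain ⟨A, B, hAB⟩ := exists_str_of_nearClique hdis hcov hlo hhi hqm hn (by omega)
      (hclq hEi) h3 hr
    exact ⟨A, B, Or.inl hAB⟩
  rcases exists_independent_or_matching G U q with ⟨N, hN1, hN2, hN3⟩ | ⟨E, hE, hEi⟩
  swap
  · obtain ⟨A, B, hAB⟩ := exists_str_of_nearClique (G := Gᶜ) hdis hcov hlo hhi hqm hn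
      (show E.card ≤ 6 * q by omega) (hclq (by rw [compl_compl]; exact hEi)) h4 (hr.compl hdis)
    exact ⟨A, B, Or.inr hAB⟩
  rcases exists_clusterOn_or_paths G Uᶜ q with ⟨P, hP1, hP2, hP3⟩ | ⟨E, hE, hEc⟩
  · exact (h3 ⟨P, N, hP1, hN1, hP2, hN2, hP3, hN3⟩).elim
  rcases exists_clusterOn_or_paths Gᶜ Uᶜ q with ⟨P, hP1, hP2, hP3⟩ | ⟨F, hF, hFc⟩
  · exact (h4 ⟨P, M, hP1, hM1, hP2, hM2, hP3, hM3⟩).elim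
  have hsub1 : ((Uᶜ \ (E ∪ F) : Finset V) : Set V) ⊆ ((Uᶜ \ E : Finset V) : Set V) :=
    Finset.coe_subset.2 (Finset.sdiff_subset_sdiff subset_rfl Finset.subset_union_left)
  have hsub2 : ((Uᶜ \ (E ∪ F) : Finset V) : Set V) ⊆ ((Uᶜ \ F : Finset V) : Set V) :=
    Finset.coe_subset.2 (Finset.sdiff_subset_sdiff subset_rfl Finset.subset_union_right)
  have hEF : (E ∪ F).card ≤ 6 * q := (Finset.card_union_le _ _).trans (by omega)
  rcases (hEc.mono hsub1).isClique_or_isIndep (hFc.mono hsub2) with h | h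
  · obtain ⟨A, B, hAB⟩ := exists_str_of_nearClique hdis.symm (by omega) (by omega) (by omega)
      hqm hn hEF h h1 hr'
    exact ⟨A, B, Or.inl hAB⟩
  · obtain ⟨A, B, hAB⟩ := exists_str_of_nearClique hdis.symm (by omega) (by omega) (by omega)
      hqm hn hEF h h2 (hr'.compl hdis.symm)
    exact ⟨A, B, Or.inr hAB⟩

/-- The number of tame graphs without approximate structure, for given graphs inside `U` and its
complement. -/
theorem cnt_not_str_agreeOff_le [Fintype V] (H : SimpleGraph V) (U : Finset V) {m q : ℕ}
    (hqm : 12 * q ≤ m) (hn : 3 * m + 4 ≤ Fintype.card V) :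
    (cnt (fun G : SimpleGraph V => (Tame G ∧ ¬∃ A B, Str G A B m ∨ Str Gᶜ A B m) ∧
      AgreeOff G H U) : ℝ) ≤
      (4 + 8 * 2 ^ Fintype.card V * (Fintype.card V ^ 2) ^ m) *
        2 ^ ((Fintype.card V : ℝ) ^ 2 / 4 - (q * q) / 64) := by
  set n := Fintype.card V with hnV
  have hn1 : 1 ≤ n := by omega
  have hK : (1 : ℝ) ≤ 2 ^ n * (n ^ 2) ^ m := by
    have h1 : (1 : ℝ) ≤ n := by exact_mod_cast hn1
    exact one_le_mul_of_one_le_of_one_le (one_le_pow₀ one_le_two)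
      (one_le_pow₀ (one_le_pow₀ h1))
  have hqm2 : ((q : ℝ) * q) ≤ m * m := by
    exact_mod_cast Nat.mul_self_le_mul_self (by omega : q ≤ m)
  have hUU : (((U.card * Uᶜ.card : ℕ) : ℝ)) ≤ n ^ 2 / 4 := by
    have := four_mul_card_mul_card_compl_le U
    have : (4 : ℝ) * ((U.card * Uᶜ.card : ℕ) : ℝ) ≤ n ^ 2 := by exact_mod_cast this
    linarith
  by_cases hbal : n ≤ 2 * U.card + m ∧ 2 * U.card ≤ n + m
  · have hUc : Uᶜᶜ = U := compl_compl U
    have hb1 : ∀ (H' : SimpleGraph V) (U' : Finset V), U' = U ∨ U' = Uᶜ →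
        (cnt (fun G : SimpleGraph V => Tame G ∧ AgreeOff G H' U' ∧ PathMatching G U' U'ᶜ q) : ℝ) ≤
        2 ^ ((n : ℝ) ^ 2 / 4 - (q * q) / 64) := fun H' U' hU' => by
      refine (cnt_pathMatching_le H' U' q).trans (Real.rpow_le_rpow_of_exponent_le one_le_two ?_)
      have : (((U'.card * U'ᶜ.card : ℕ) : ℝ)) ≤ n ^ 2 / 4 := by
        rcases hU' with h | h
        · rw [h]; exact hUU
        · rw [h, hUc, mul_comm]; exact hUU
      push_cast at this ⊢
      linarith
    have hb2 : ∀ (U' : Finset V), U' = U ∨ U' = Uᶜ →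
        (cnt (fun G : SimpleGraph V => AgreeOff G H U' ∧ ¬Rich G U' U'ᶜ m) : ℝ) ≤
        4 * 2 ^ n * (n ^ 2) ^ m * 2 ^ ((n : ℝ) ^ 2 / 4 - (q * q) / 64) := fun U' hU' => by
      refine (cnt_not_rich_le H U').trans ?_
      gcongr 4 * 2 ^ n * (n ^ 2) ^ m * ?_
      refine Real.rpow_le_rpow_of_exponent_le one_le_two ?_
      have : (((U'.card * U'ᶜ.card : ℕ) : ℝ)) ≤ n ^ 2 / 4 := by
        rcases hU' with h | h
        · rw [h]; exact hUU
        · rw [h, hUc, mul_comm]; exact hUU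
      push_cast at this ⊢
      linarith
    have hcomp : ∀ U' : Finset V, cnt (fun G : SimpleGraph V => Tame Gᶜ ∧ AgreeOff Gᶜ Hᶜ U' ∧
        PathMatching Gᶜ U' U'ᶜ q) = cnt (fun G : SimpleGraph V => Tame G ∧ AgreeOff G Hᶜ U' ∧
        PathMatching G U' U'ᶜ q) := fun U' =>
      cnt_equiv (Equiv.mk compl compl (fun _ => compl_compl _) (fun _ => compl_compl _))
        (fun G : SimpleGraph V => Tame G ∧ AgreeOff G Hᶜ U' ∧ PathMatching G U' U'ᶜ q)
    have hsum : cnt (fun G : SimpleGraph V => (Tame G ∧ ¬∃ A B, Str G A B m ∨ Str Gᶜ A B m) ∧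
        AgreeOff G H U) ≤
        cnt (fun G : SimpleGraph V => Tame G ∧ AgreeOff G H U ∧ PathMatching G U Uᶜ q) +
        (cnt (fun G : SimpleGraph V => Tame Gᶜ ∧ AgreeOff Gᶜ Hᶜ U ∧ PathMatching Gᶜ U Uᶜ q) +
        (cnt (fun G : SimpleGraph V => Tame G ∧ AgreeOff G H Uᶜ ∧ PathMatching G Uᶜ Uᶜᶜ q) +
        (cnt (fun G : SimpleGraph V => Tame Gᶜ ∧ AgreeOff Gᶜ Hᶜ Uᶜ ∧ PathMatching Gᶜ Uᶜ Uᶜᶜ q) +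
        (cnt (fun G : SimpleGraph V => AgreeOff G H U ∧ ¬Rich G U Uᶜ m) +
        cnt (fun G : SimpleGraph V => AgreeOff G H Uᶜ ∧ ¬Rich G Uᶜ Uᶜᶜ m))))) := by
      refine le_trans (cnt_mono ?_) ((cnt_or_le _ _).trans (Nat.add_le_add_left
        ((cnt_or_le _ _).trans (Nat.add_le_add_left ((cnt_or_le _ _).trans (Nat.add_le_add_left
        ((cnt_or_le _ _).trans (Nat.add_le_add_left (cnt_or_le _ _) _)) _)) _)) _))
      rintro G ⟨⟨hG, hno⟩, hGH⟩
      have hGH' := agreeOff_compl_iff.2 hGH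
      by_contra! hcon
      obtain ⟨c1, c2, c3, c4, c5, c6⟩ := hcon
      rw [hUc] at c3 c4 c6
      exact hno (exists_str hbal.1 hbal.2 hqm hn (c1 hG hGH) (c2 hG.compl hGH.compl)
        (c3 hG hGH') (c4 hG.compl hGH'.compl) (c5 hGH) (c6 hGH'))
    rw [hcomp, hcomp] at hsum
    have hsum' := Nat.cast_le (α := ℝ) |>.2 hsum
    push_cast at hsum'
    refine hsum'.trans ?_
    have e1 := hb1 H U (Or.inl rfl)
    have e2 := hb1 Hᶜ U (Or.inl rfl)
    have e3 := hb1 H Uᶜ (Or.inr rfl)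
    have e4 := hb1 Hᶜ Uᶜ (Or.inr rfl)
    have e5 := hb2 U (Or.inl rfl)
    have e6 := hb2 Uᶜ (Or.inr rfl)
    linarith
  · have h1 : cnt (fun G : SimpleGraph V => (Tame G ∧ ¬∃ A B, Str G A B m ∨ Str Gᶜ A B m) ∧
        AgreeOff G H U) ≤ 2 ^ (U.card * Uᶜ.card) := by
      have := cnt_agreeOff_avoid H U (∅ : Finset ℕ) (r := 0) (fun _ => Fin.elim0)
        (fun _ => Fin.elim0) (by simp) (by simp) (by simp)
      simp only [Finset.card_empty, pow_zero, mul_one] at this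
      refine le_trans (cnt_mono ?_) this
      rintro G ⟨-, h⟩
      exact ⟨h, by simp⟩
    have h2 : ((cnt (fun G : SimpleGraph V => (Tame G ∧ ¬∃ A B, Str G A B m ∨ Str Gᶜ A B m) ∧
        AgreeOff G H U) : ℕ) : ℝ) ≤ 2 ^ (((U.card * Uᶜ.card : ℕ)) : ℝ) := by
      rw [Real.rpow_natCast]
      exact_mod_cast h1
    refine h2.trans ?_
    have h3 : (((U.card * Uᶜ.card : ℕ)) : ℝ) ≤ (n : ℝ) ^ 2 / 4 - (q * q) / 64 := by
      have hc : (n : ℝ) = U.card + Uᶜ.card := by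
        exact_mod_cast U.card_add_card_compl.symm
      have hd : (m : ℝ) * m ≤ ((n : ℝ) - 2 * U.card) ^ 2 := by
        rw [← abs_mul_abs_self (m : ℝ), ← sq, sq_le_sq, abs_abs]
        rw [not_and_or, not_le, not_le] at hbal
        rw [abs_of_nonneg (Nat.cast_nonneg (α := ℝ) m)]
        rcases hbal with h | h
        · have : 2 * (U.card : ℝ) + m < n := by exact_mod_cast h
          exact le_trans (by linarith) (le_abs_self _)
        · have : (n : ℝ) + m < 2 * U.card := by exact_mod_cast h
          exact le_trans (by linarith) (neg_le_abs _)
      push_cast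
      nlinarith
    refine (Real.rpow_le_rpow_of_exponent_le one_le_two h3).trans ?_
    refine le_mul_of_one_le_left (by positivity) ?_
    nlinarith

end Structured

section StageD

theorem exists_forall_le_two_rpow {ε : ℝ} (hε : 0 < ε) :
    ∃ n₀ : ℕ, ∀ n : ℕ, n₀ ≤ n → (n : ℝ) ≤ 2 ^ (ε * n) := by
  have h1 := (Real.isLittleO_log_id_atTop.bound
    (show 0 < ε * Real.log 2 by have := Real.log_pos one_lt_two; positivity)).natCast_atTop
  obtain ⟨n₀, hn₀⟩ := eventually_atTop.1 h1
  refine ⟨n₀ + 1, fun n hn => ?_⟩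
  have h2 := hn₀ n (by omega)
  have hpos : (0 : ℝ) < n := by exact_mod_cast (by omega : 0 < n)
  rw [Real.norm_eq_abs, Real.norm_eq_abs, id, abs_of_pos hpos] at h2
  have h3 := (le_abs_self _).trans h2
  rw [← Real.log_le_log_iff hpos (by positivity), Real.log_rpow two_pos]
  linarith

theorem cnt_tame_not_str_le {δ : ℝ} (hδ : 0 < δ) (hδ1 : δ ≤ 1 / 4) :
    ∃ c : ℝ, 0 < c ∧ ∃ n₀ : ℕ, ∀ n ≥ n₀,
      (cnt (fun G : SimpleGraph (Fin n) => Tame G ∧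
        ¬∃ A B, Str G A B ⌊δ * n⌋₊ ∨ Str Gᶜ A B ⌊δ * n⌋₊) : ℝ) ≤
        2 ^ ((n : ℝ) ^ 2 / 4 - c * n ^ 2) := by
  set κ := (δ / 24) ^ 2 / 64 with hκ
  have hκ0 : 0 < κ := by positivity
  obtain ⟨η, hη, n₁, hfam⟩ := exists_approx_family (show 0 < κ / 4 by positivity)
  obtain ⟨n₂, hn₂⟩ := exists_forall_le_two_rpow (show 0 < κ / 16 by positivity)
  obtain ⟨n₃, hn₃⟩ := exists_nat_ge (26 / δ)
  set c : ℝ := min η (κ / 4) with hc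
  have hc0 : 0 < c := lt_min hη (by positivity)
  obtain ⟨n₄, hn₄⟩ := exists_nat_ge (2 / c)
  obtain ⟨n₅, hn₅⟩ := exists_nat_ge (40 / κ)
  refine ⟨c / 2, by positivity, n₁ + n₂ + n₃ + n₄ + n₅ + 16, fun n hn => ?_⟩
  have hn16 : (16 : ℝ) ≤ n := by exact_mod_cast (by omega : 16 ≤ n)
  have hδn : 26 ≤ δ * n := by
    have := hn₃.trans (show (n₃ : ℝ) ≤ n by exact_mod_cast (by omega : n₃ ≤ n))
    rw [div_le_iff₀ hδ] at this
    linarith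
  have hcn : 2 ≤ c * n := by
    have := hn₄.trans (show (n₄ : ℝ) ≤ n by exact_mod_cast (by omega : n₄ ≤ n))
    rw [div_le_iff₀ hc0] at this
    linarith
  have hκn : 40 ≤ κ * n := by
    have := hn₅.trans (show (n₅ : ℝ) ≤ n by exact_mod_cast (by omega : n₅ ≤ n))
    rw [div_le_iff₀ hκ0] at this
    linarith
  set m := ⌊δ * n⌋₊ with hm
  set q := m / 12 with hq
  have hmle : (m : ℝ) ≤ δ * n := Nat.floor_le (by positivity)
  have hmlt : δ * n < m + 1 := Nat.lt_floor_add_one _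
  have hqge : δ / 24 * n ≤ q := by
    have h1 : m < 12 * (q + 1) := by omega
    have h2 : (m : ℝ) + 1 ≤ 12 * (q + 1) := by exact_mod_cast h1
    linarith
  have hmn : 3 * m + 4 ≤ n := by
    have : 3 * (m : ℝ) + 4 ≤ n := by nlinarith
    exact_mod_cast this
  obtain ⟨Q, hQ, hQc⟩ := hfam n (by omega)
  have hn2 := hn₂ n (by omega)
  set t : ℝ := (4 + 8 * 2 ^ n * ((n : ℝ) ^ 2) ^ m) * 2 ^ ((n : ℝ) ^ 2 / 4 - (q * q) / 64) with ht
  have ht0 : 0 ≤ t := by positivity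
  have hsum : cnt (fun G : SimpleGraph (Fin n) => Tame G ∧ ¬∃ A B, Str G A B m ∨ Str Gᶜ A B m) ≤
      cnt (fun G : SimpleGraph (Fin n) => Tame G ∧ ¬∃ p, Q p ∧ AgreeOff G p.2 p.1) +
        cnt Q * ⌊t⌋₊ := by
    refine le_trans (cnt_mono (Q := fun G : SimpleGraph (Fin n) =>
      (Tame G ∧ ¬∃ p, Q p ∧ AgreeOff G p.2 p.1) ∨ ((Tame G ∧ ¬∃ A B, Str G A B m ∨ Str Gᶜ A B m) ∧
        ∃ p, Q p ∧ AgreeOff G p.2 p.1)) ?_) ((cnt_or_le _ _).trans (Nat.add_le_add_left ?_ _))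
    · intro G hG
      tauto
    · refine cnt_le_mul_of_exists (R := fun p G => (Tame G ∧
        ¬∃ A B, Str G A B m ∨ Str Gᶜ A B m) ∧ AgreeOff G p.2 p.1) _ ?_ ?_
      · rintro G ⟨hG, p, hp, h⟩
        exact ⟨p, hp, hG, h⟩
      · intro p _
        have h1 := cnt_not_str_agreeOff_le p.2 p.1 (m := m) (q := q) (by omega)
          (by rw [Fintype.card_fin]; exact hmn)
        rw [Fintype.card_fin] at h1
        exact Nat.le_floor h1
  have hsum' := Nat.cast_le (α := ℝ) |>.2 hsum
  push_cast at hsum'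
  have htle : t ≤ 2 ^ (κ / 4 * n ^ 2) * 2 ^ ((n : ℝ) ^ 2 / 4 - κ * n ^ 2) := by
    rw [ht]
    gcongr
    · have h1 : (1 : ℝ) ≤ 2 ^ n * ((n : ℝ) ^ 2) ^ m :=
        one_le_mul_of_one_le_of_one_le (one_le_pow₀ one_le_two)
          (one_le_pow₀ (one_le_pow₀ (by linarith)))
      have h2 : ((n : ℝ) ^ 2) ^ m ≤ 2 ^ (κ / 8 * n ^ 2) := by
        calc ((n : ℝ) ^ 2) ^ m = (n : ℝ) ^ (2 * m) := (pow_mul _ _ _).symm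
          _ ≤ (n : ℝ) ^ (2 * n) := pow_le_pow_right₀ (by linarith) (by omega)
          _ ≤ (2 ^ (κ / 16 * n)) ^ (2 * n) := pow_le_pow_left₀ (by positivity) hn2 _
          _ = 2 ^ (κ / 8 * n ^ 2) := by
            rw [← Real.rpow_natCast, ← Real.rpow_mul two_pos.le]
            push_cast
            congr 1
            ring
      calc (4 : ℝ) + 8 * 2 ^ n * ((n : ℝ) ^ 2) ^ m ≤ 16 * (2 ^ n * ((n : ℝ) ^ 2) ^ m) := by
            linarith
        _ ≤ 2 ^ (4 : ℝ) * (2 ^ (n : ℝ) * 2 ^ (κ / 8 * n ^ 2)) := by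
          rw [Real.rpow_natCast]
          gcongr
          norm_num
        _ = 2 ^ (4 + ((n : ℝ) + κ / 8 * n ^ 2)) := by
          rw [Real.rpow_add two_pos, Real.rpow_add two_pos]
        _ ≤ 2 ^ (κ / 4 * n ^ 2) := by
          refine Real.rpow_le_rpow_of_exponent_le one_le_two ?_
          nlinarith
    · exact one_le_two
    · have h1 := mul_self_le_mul_self (by positivity) hqge
      have h2 : κ * n ^ 2 = (δ / 24 * n) * (δ / 24 * n) / 64 := by
        rw [hκ]
        ring
      linarith
  have hfin : (cnt Q : ℝ) * ⌊t⌋₊ ≤ 2 ^ ((n : ℝ) ^ 2 / 4 - κ / 2 * n ^ 2) := by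
    calc (cnt Q : ℝ) * ⌊t⌋₊ ≤ 2 ^ (κ / 4 * n ^ 2) *
          (2 ^ (κ / 4 * n ^ 2) * 2 ^ ((n : ℝ) ^ 2 / 4 - κ * n ^ 2)) :=
          mul_le_mul hQ ((Nat.floor_le ht0).trans htle) (Nat.cast_nonneg _) (by positivity)
      _ = 2 ^ ((n : ℝ) ^ 2 / 4 - κ / 2 * n ^ 2) := by
        rw [← Real.rpow_add two_pos, ← Real.rpow_add two_pos]
        congr 1
        ring
  have hn20 : (0 : ℝ) ≤ (n : ℝ) ^ 2 := by positivity
  have hcη : c * n ^ 2 ≤ η * n ^ 2 := mul_le_mul_of_nonneg_right (min_le_left _ _) hn20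
  have hcκ : c * n ^ 2 ≤ κ / 4 * n ^ 2 := mul_le_mul_of_nonneg_right (min_le_right _ _) hn20
  have hκn : 0 ≤ κ * (n : ℝ) ^ 2 := by positivity
  calc _ ≤ _ := hsum'
    _ ≤ 2 ^ ((n : ℝ) ^ 2 / 4 - c * n ^ 2) + 2 ^ ((n : ℝ) ^ 2 / 4 - c * n ^ 2) := by
      refine add_le_add (hQc.trans ?_) (hfin.trans ?_)
      · exact Real.rpow_le_rpow_of_exponent_le one_le_two (by linarith)
      · exact Real.rpow_le_rpow_of_exponent_le one_le_two (by linarith)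
    _ = 2 ^ (1 + ((n : ℝ) ^ 2 / 4 - c * n ^ 2)) := by
      rw [Real.rpow_add two_pos, Real.rpow_one]
      ring
    _ ≤ 2 ^ ((n : ℝ) ^ 2 / 4 - c / 2 * n ^ 2) := by
      refine Real.rpow_le_rpow_of_exponent_le one_le_two ?_
      nlinarith

end StageD

section Extension

variable {V : Type*} {s : ℕ}

/-- Make the vertices in the range of `x` isolated. -/
def isolate (G : SimpleGraph V) (x : Fin s → V) : SimpleGraph V where
  Adj u v := G.Adj u v ∧ (∀ i, u ≠ x i) ∧ ∀ i, v ≠ x i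
  symm := ⟨fun _ _ h => ⟨h.1.symm, h.2.2, h.2.1⟩⟩
  loopless := ⟨fun _ h => G.loopless.irrefl _ h.1⟩

/-- The adjacencies between each vertex and the vertices `x i`. -/
def nbrPattern (G : SimpleGraph V) (x : Fin s → V) : V → Fin s → Bool :=
  fun v i => decide (G.Adj (x i) v)

theorem eq_of_isolate_eq {G H : SimpleGraph V} {x : Fin s → V} (h : isolate G x = isolate H x)
    (h' : nbrPattern G x = nbrPattern H x) : G = H := by
  have h1 : ∀ i v, G.Adj (x i) v ↔ H.Adj (x i) v := fun i v => by
    simpa [nbrPattern] using congrFun (congrFun h' v) i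
  ext u v
  by_cases hu : ∃ i, u = x i
  · obtain ⟨i, rfl⟩ := hu
    exact h1 i v
  by_cases hv : ∃ i, v = x i
  · obtain ⟨i, rfl⟩ := hv
    rw [G.adj_comm, H.adj_comm]
    exact h1 i u
  push Not at hu hv
  have h2 : (isolate G x).Adj u v ↔ (isolate H x).Adj u v := by rw [h]
  simpa [isolate, hu, hv] using h2

/-- The number of tame graphs on `n` vertices. -/
def tameCount (n : ℕ) : ℕ := cnt (fun G : SimpleGraph (Fin n) => Tame G)

theorem cnt_isolate_le [Fintype V] {x : Fin s → V} (hx : Function.Injective x) :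
    cnt (fun H : SimpleGraph V => ∃ G, Tame G ∧ H = isolate G x) ≤
      tameCount (Fintype.card V - s) := by
  have hcard : (Finset.univ.image x)ᶜ.card = Fintype.card V - s := by
    rw [Finset.card_compl, Finset.card_image_of_injective _ hx, Finset.card_univ,
      Fintype.card_fin]
  let e : Fin (Fintype.card V - s) ↪ V :=
    ((Finset.equivFinOfCardEq hcard).symm.toEmbedding).trans (Function.Embedding.subtype _)
  have he : ∀ v, (∀ i, v ≠ x i) → ∃ j, e j = v := fun v hv => by
    have hmem : v ∈ (Finset.univ.image x)ᶜ := by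
      simp only [Finset.mem_compl, Finset.mem_image, Finset.mem_univ, true_and, not_exists]
      exact fun i h => hv i h.symm
    exact ⟨Finset.equivFinOfCardEq hcard ⟨v, hmem⟩, by simp [e]⟩
  have he' : ∀ j i, e j ≠ x i := fun j i h => by
    have := ((Finset.equivFinOfCardEq hcard).symm j).2
    simp only [Finset.mem_compl, Finset.mem_image, Finset.mem_univ, true_and, not_exists] at this
    exact this i h.symm
  refine cnt_le_of_injOn (fun H => H.comap e) ?_ ?_
  · rintro H ⟨G, hG, rfl⟩
    have : (isolate G x).comap e = G.comap e := by
      ext u v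
      simp [isolate, he']
    rw [this]
    exact hG.comap e
  · rintro H₁ H₂ ⟨G₁, -, h₁⟩ ⟨G₂, -, h₂⟩ h
    have h0 : ∀ H G : SimpleGraph V, H = isolate G x → ∀ u v, H.Adj u v →
        (∃ j, e j = u) ∧ ∃ j, e j = v := by
      rintro H G rfl u v huv
      exact ⟨he u huv.2.1, he v huv.2.2⟩
    have h3 : ∀ i j, H₁.Adj (e i) (e j) ↔ H₂.Adj (e i) (e j) := fun i j => by
      have : (H₁.comap e).Adj i j ↔ (H₂.comap e).Adj i j := by rw [h]
      simpa using this
    ext u v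
    constructor
    · intro huv
      obtain ⟨⟨i, rfl⟩, ⟨j, rfl⟩⟩ := h0 _ _ h₁ u v huv
      exact (h3 i j).1 huv
    · intro huv
      obtain ⟨⟨i, rfl⟩, ⟨j, rfl⟩⟩ := h0 _ _ h₂ u v huv
      exact (h3 i j).2 huv

theorem cnt_extension_le [Fintype V] {R : SimpleGraph V → (V → Fin s → Bool) → Prop} {K : ℕ}
    (hR : ∀ H, cnt (R H) ≤ K) :
    cnt (fun G : SimpleGraph V => Tame G ∧ ∃ x : Fin s → V, Function.Injective x ∧
      R (isolate G x) (nbrPattern G x)) ≤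
      Fintype.card V ^ s * (tameCount (Fintype.card V - s) * K) := by
  have h1 : cnt (fun x : Fin s → V => Function.Injective x) ≤ Fintype.card V ^ s := by
    refine (cnt_le_card _).trans ?_
    simp [Nat.card_eq_fintype_card]
  refine (cnt_le_mul_of_exists (Q := fun x : Fin s → V => Function.Injective x)
    (R := fun x G => Tame G ∧ R (isolate G x) (nbrPattern G x))
    (tameCount (Fintype.card V - s) * K) ?_ ?_).trans (Nat.mul_le_mul_right _ h1)
  · rintro G ⟨hG, x, hx, h⟩
    exact ⟨x, hx, hG, h⟩
  · intro x hx
    refine (cnt_le_mul (Q := fun H : SimpleGraph V => ∃ G, Tame G ∧ H = isolate G x)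
      (fun G => isolate G x) K (fun G hG => ⟨G, hG.1, rfl⟩) fun H _ => ?_).trans
      (Nat.mul_le_mul_right _ (cnt_isolate_le hx))
    refine (cnt_le_of_injOn (fun G => nbrPattern G x) (Q := R H) ?_ ?_).trans (hR H)
    · rintro G ⟨⟨-, h⟩, rfl⟩
      exact h
    · rintro G G' ⟨-, h⟩ ⟨-, h'⟩ hp
      exact eq_of_isolate_eq (h.trans h'.symm) hp

theorem cnt_approx_le {σ : Type*} [Fintype V] [Fintype σ] [Nonempty σ] (Al : V → σ → Prop)
    {U₁ U₂ : Finset V} (hd : Disjoint U₁ U₂) {a b : ℕ} (k : ℕ) (ha : 1 ≤ a) (hb : 1 ≤ b)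
    (h₁ : ∀ v ∈ U₁, cnt (Al v) ≤ a) (h₂ : ∀ v ∈ U₂, cnt (Al v) ≤ b) :
    cnt (fun p : V → σ => cnt (fun v => ¬Al v (p v)) ≤ k) ≤
      vol (Fintype.card V) k * (Fintype.card σ ^ k * (a ^ U₁.card * b ^ U₂.card *
        Fintype.card σ ^ (Fintype.card V - U₁.card - U₂.card))) := by
  have hc : 1 ≤ Fintype.card σ := Fintype.card_pos
  rw [← cnt_card_le]
  refine cnt_le_mul_of_exists (R := fun E p => ∀ v ∉ E, Al v (p v)) _
    (fun p hp => ⟨Finset.univ.filter fun v => ¬Al v (p v), ?_, ?_⟩) fun E hE => ?_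
  · rwa [← cnt_eq_card_filter]
  · intro v hv
    simpa using hv
  · have h1 : cnt (fun p : V → σ => ∀ v ∉ E, Al v (p v)) =
        ∏ v, (if v ∈ E then Finset.univ else Finset.univ.filter (Al v)).card := by
      rw [← Fintype.card_piFinset, cnt_eq_card_filter]
      congr 1
      ext p
      simp only [Finset.mem_filter, Finset.mem_univ, true_and, Fintype.mem_piFinset]
      refine forall_congr' fun v => ?_
      by_cases hv : v ∈ E <;> simp [hv]
    have h3 : ∀ (U : Finset V) (c : ℕ), (∏ v, if v ∈ U then c else 1) = c ^ U.card := by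
      intro U c
      rw [Finset.prod_ite_mem, Finset.univ_inter, Finset.prod_const]
    calc _ = _ := h1
      _ ≤ ∏ v, (if v ∈ E then Fintype.card σ else 1) * ((if v ∈ U₁ then a else 1) *
          (if v ∈ U₂ then b else 1) * if v ∈ (U₁ ∪ U₂)ᶜ then Fintype.card σ else 1) := by
        refine Finset.prod_le_prod' fun v _ => ?_
        by_cases hv : v ∈ E
        · rw [if_pos hv, if_pos hv, Finset.card_univ]
          refine Nat.le_mul_of_pos_right _ ?_
          refine Nat.mul_pos (Nat.mul_pos ?_ ?_) ?_ <;> split_ifs <;> omega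
        · rw [if_neg hv, if_neg hv, one_mul, ← cnt_eq_card_filter]
          by_cases hv1 : v ∈ U₁
          · have hv2 : v ∉ U₂ := Finset.disjoint_left.1 hd hv1
            simpa [hv1, hv2] using h₁ v hv1
          by_cases hv2 : v ∈ U₂
          · simpa [hv1, hv2] using h₂ v hv2
          · refine (cnt_le_card _).trans ?_
            simp [hv1, hv2, Nat.card_eq_fintype_card]
      _ = Fintype.card σ ^ E.card * (a ^ U₁.card * b ^ U₂.card *
          Fintype.card σ ^ (Fintype.card V - U₁.card - U₂.card)) := by
        rw [Finset.prod_mul_distrib, Finset.prod_mul_distrib, Finset.prod_mul_distrib, h3, h3, h3,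
          h3, Finset.card_compl, Finset.card_union_of_disjoint hd, Nat.sub_sub]
      _ ≤ _ := Nat.mul_le_mul_right _ (Nat.pow_le_pow_right hc hE)

end Extension

section Blocks

variable {V : Type*}

theorem exists_pairs_of_isClique {G : SimpleGraph V} {Y : Finset V} {q : ℕ}
    (hY : G.IsClique (Y : Set V)) (hq : 2 * q + 2 ≤ Y.card) :
    ∃ M : Finset (Fin 2 → V), DisjFam M ∧ M.card = q ∧ ∀ f ∈ M, ∀ a, f a ∈ Y := by
  rcases exists_independent_or_matching G Y q with ⟨M, hM, hc, h⟩ | ⟨E, hE, h⟩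
  · exact ⟨M, hM, hc, fun f hf => (h f hf).2⟩
  · have h2 : 1 < (Y \ E).card := by
      have := Finset.le_card_sdiff E Y
      omega
    obtain ⟨x, hx, y, hy, hxy⟩ := Finset.one_lt_card.1 h2
    exact absurd (hY (Finset.mem_sdiff.1 hx).1 (Finset.mem_sdiff.1 hy).1 hxy) (h x hx y hy)

theorem Str.card_sdiff_le_or [Fintype V] {G : SimpleGraph V} {A₁ B₁ A₂ B₂ : Finset V} {m : ℕ}
    (h₁ : Str G A₁ B₁ m) (h₂ : Str G A₂ B₂ m) :
    (A₁ \ A₂).card ≤ 3 * m + 1 ∨ (A₁ ∩ A₂).card < m := by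
  by_contra! hcon
  obtain ⟨c1, c2⟩ := hcon
  have h3 : (A₁ \ A₂).card ≤ (A₁ ∩ B₂).card + m := by
    have h4 : (A₂ ∪ B₂)ᶜ.card ≤ m := by
      rw [Finset.card_compl, Finset.card_union_of_disjoint h₂.disjoint]
      have := h₂.cover
      omega
    refine (Finset.card_le_card (t := (A₁ ∩ B₂) ∪ (A₂ ∪ B₂)ᶜ) fun x hx => ?_).trans
      ((Finset.card_union_le _ _).trans (by omega))
    simp only [Finset.mem_sdiff, Finset.mem_union, Finset.mem_inter, Finset.mem_compl] at hx ⊢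
    tauto
  obtain ⟨M, hM, hMc, hMB⟩ := exists_pairs_of_isClique (Y := A₁ ∩ B₂) (q := m)
    (h₁.clique.subset (by simp)) (by omega)
  obtain ⟨x, hx, e, he, hxe⟩ := h₂.rich (A₁ ∩ A₂) Finset.inter_subset_right c2 M hM
    (fun e he a => (Finset.mem_inter.1 (hMB e he a)).2) hMc.ge (fun _ => false)
  have h5 := Finset.mem_inter.1 (hMB e he 0)
  have h6 := Finset.mem_inter.1 hx
  have h7 : x ≠ e 0 := fun h => Finset.disjoint_left.1 h₂.disjoint h6.2 (h ▸ h5.2)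
  simpa using (hxe 0).1 (h₁.clique h6.1 h5.1 h7)

theorem cnt_str_le [Fintype V] (G : SimpleGraph V) {m : ℕ} (hm : 12 * m + 3 < Fintype.card V) :
    cnt (fun p : Finset V × Finset V => Str G p.1 p.2 m) ≤
      2 * vol (Fintype.card V) (5 * m + 1) ^ 3 := by
  by_cases h0 : ∃ p : Finset V × Finset V, Str G p.1 p.2 m
  swap
  · refine le_trans (cnt_mono (Q := fun _ => False) fun p hp => h0 ⟨p, hp⟩) ?_
    simp [cnt]
  obtain ⟨⟨A₀, B₀⟩, h0⟩ := h0
  change Str G A₀ B₀ m at h0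
  have h1 : ∃ A₁ B₁, Str G A₁ B₁ m ∧ ∀ A B, Str G A B m → (A \ A₀).card ≤ 3 * m + 1 ∨
      (A \ A₁).card ≤ 3 * m + 1 := by
    by_cases h1 : ∃ A₁ B₁, Str G A₁ B₁ m ∧ 3 * m + 1 < (A₁ \ A₀).card
    · obtain ⟨A₁, B₁, h1, h2⟩ := h1
      refine ⟨A₁, B₁, h1, fun A B h => ?_⟩
      by_contra! hcon
      have a1 := (h.card_sdiff_le_or h0).resolve_left hcon.1.not_ge
      have a2 := (h.card_sdiff_le_or h1).resolve_left hcon.2.not_ge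
      have a3 := (h1.card_sdiff_le_or h0).resolve_left h2.not_ge
      have b1 := Finset.card_union_add_card_inter A A₀
      have b2 := Finset.card_union_add_card_inter (A ∪ A₀) A₁
      have b3 : ((A ∪ A₀) ∩ A₁).card ≤ (A ∩ A₁).card + (A₁ ∩ A₀).card := by
        refine (Finset.card_le_card fun x hx => ?_).trans (Finset.card_union_le _ _)
        simp only [Finset.mem_union, Finset.mem_inter] at hx ⊢
        tauto
      have b4 := Finset.card_le_univ (A ∪ A₀ ∪ A₁)
      have b5 := h.lower
      have b6 := h0.lower
      have b7 := h1.lower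
      omega
    · push Not at h1
      exact ⟨A₀, B₀, h0, fun A B h => Or.inl (h1 A B h)⟩
  obtain ⟨A₁, B₁, h1, h2⟩ := h1
  let R : Bool → Finset V := fun b => if b then A₀ else A₁
  have hR : ∀ b, 2 * (R b).card ≤ Fintype.card V + 2 * m := by
    intro b
    cases b
    · simpa [R] using h1.upper
    · simpa [R] using h0.upper
  have hsmall : ∀ b A B, Str G A B m → (A \ R b).card ≤ 3 * m + 1 →
      (R b \ A).card ≤ 5 * m + 1 := by
    intro b A B h hA
    have e1 := Finset.card_sdiff_add_card_inter (R b) A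
    have e2 := Finset.card_sdiff_add_card_inter A (R b)
    rw [Finset.inter_comm] at e2
    have e3 := hR b
    have e4 := h.lower
    omega
  refine (cnt_le_mul_of_exists
    (Q := fun y : Bool × Finset V × Finset V × Finset V => True ∧ (y.2.1.card ≤ 5 * m + 1 ∧
      (y.2.2.1.card ≤ 5 * m + 1 ∧ y.2.2.2.card ≤ 5 * m + 1)))
    (R := fun y p => p = ((R y.1 \ y.2.2.1) ∪ y.2.1,
      (y.2.2.2 ∪ ((R y.1 \ y.2.2.1) ∪ y.2.1))ᶜ)) 1 ?_ ?_).trans ?_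
  · rintro ⟨A, B⟩ h
    have key : ∃ b, (A \ R b).card ≤ 3 * m + 1 := by
      rcases h2 A B h with h | h
      · exact ⟨true, h⟩
      · exact ⟨false, h⟩
    obtain ⟨b, hb⟩ := key
    refine ⟨⟨b, A \ R b, R b \ A, (A ∪ B)ᶜ⟩, ⟨trivial, by simpa using hb.trans (by omega),
      hsmall b A B h hb, ?_⟩, ?_⟩
    · simp only
      rw [Finset.card_compl, Finset.card_union_of_disjoint h.disjoint]
      have := h.cover
      omega
    · have hA : A = R b \ (R b \ A) ∪ A \ R b := by
        ext x
        simp only [Finset.mem_union, Finset.mem_sdiff]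
        tauto
      rw [← hA, Prod.mk.injEq]
      refine ⟨rfl, ?_⟩
      ext x
      have hd : x ∈ A → x ∉ B := fun hx => Finset.disjoint_left.1 h.disjoint hx
      simp only [Finset.mem_union, Finset.mem_compl]
      tauto
  · intro y _
    exact cnt_le_one fun p q hp hq => hp.trans hq.symm
  · rw [cnt_prod (fun _ : Bool => True) (fun y : Finset V × Finset V × Finset V =>
      y.1.card ≤ 5 * m + 1 ∧ (y.2.1.card ≤ 5 * m + 1 ∧ y.2.2.card ≤ 5 * m + 1)),
      cnt_prod (fun y : Finset V => y.card ≤ 5 * m + 1) (fun y : Finset V × Finset V =>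
      y.1.card ≤ 5 * m + 1 ∧ y.2.card ≤ 5 * m + 1),
      cnt_prod (fun y : Finset V => y.card ≤ 5 * m + 1) (fun y : Finset V =>
      y.card ≤ 5 * m + 1), cnt_card_le, cnt_true, Nat.card_eq_fintype_card, Fintype.card_bool]
    exact le_of_eq (by ring)

/-- `Q` is empty or a component of the cluster graph on `B`. -/
structure IsBlock (G : SimpleGraph V) (B Q : Finset V) : Prop where
  subset : Q ⊆ B
  clique : G.IsClique (Q : Set V)
  isolated : ∀ u ∈ Q, ∀ v ∈ B, v ∉ Q → ¬G.Adj u v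

theorem IsBlock.eq_of_mem {G : SimpleGraph V} {B Q Q' : Finset V} (h : IsBlock G B Q)
    (h' : IsBlock G B Q') {x : V} (hx : x ∈ Q) (hx' : x ∈ Q') : Q = Q' := by
  have key : ∀ {Q Q' : Finset V}, IsBlock G B Q → IsBlock G B Q' → x ∈ Q → x ∈ Q' → Q ⊆ Q' := by
    intro Q Q' h h' hx hx' y hy
    by_contra hy'
    have hne : x ≠ y := fun e => hy' (e ▸ hx')
    exact h'.isolated x hx' y (h.subset hy) hy' (h.clique hx hy hne)
  exact (key h h' hx hx').antisymm (key h' h hx' hx)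

theorem cnt_isBlock_le [Fintype V] (G : SimpleGraph V) (B : Finset V) :
    cnt (IsBlock G B) ≤ Fintype.card V + 1 := by
  refine (cnt_le_of_injOn (β := Option V)
    (fun Q => if h : Q.Nonempty then some h.choose else none) (Q := fun _ => True)
    (fun _ _ => trivial) ?_).trans ?_
  · intro Q Q' h h' he
    by_cases hQ : Q.Nonempty
    · by_cases hQ' : Q'.Nonempty
      · rw [dif_pos hQ, dif_pos hQ', Option.some_inj] at he
        exact h.eq_of_mem h' hQ.choose_spec (he ▸ hQ'.choose_spec)
      · simp [hQ, hQ'] at he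
    · by_cases hQ' : Q'.Nonempty
      · simp [hQ, hQ'] at he
      · rw [Finset.not_nonempty_iff_eq_empty] at hQ hQ'
        rw [hQ, hQ']
  · rw [cnt_true, Nat.card_eq_fintype_card, Fintype.card_option]

theorem IsBlock.isolate {G : SimpleGraph V} {B Q : Finset V} (h : IsBlock G B Q) {s : ℕ}
    (x : Fin s → V) : IsBlock (isolate G x) (B.filter fun v => ∀ i, v ≠ x i)
      (Q.filter fun v => ∀ i, v ≠ x i) where
  subset := Finset.filter_subset_filter _ h.subset
  clique := fun u hu v hv huv => by
    simp only [Finset.coe_filter, Set.mem_ofPred_eq] at hu hv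
    exact ⟨h.clique hu.1 hv.1 huv, hu.2, hv.2⟩
  isolated := fun u hu v hv hvQ huv => by
    simp only [Finset.mem_filter, not_and] at hu hv hvQ
    exact h.isolated u hu.1 v hv.1 (fun hQ => hvQ hQ hv.2) huv.1

/-- A clique in the cluster graph on `B` is contained in a block. -/
theorem exists_isBlock {G : SimpleGraph V} {B Q : Finset V} (hB : ClusterOn G (B : Set V))
    (hQB : Q ⊆ B) (hQ : G.IsClique (Q : Set V)) : ∃ Q', IsBlock G B Q' ∧ Q ⊆ Q' := by
  rcases Q.eq_empty_or_nonempty with rfl | ⟨x, hx⟩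
  · exact ⟨∅, ⟨by simp, by simp, by simp⟩, subset_rfl⟩
  · have hx' := hQB hx
    refine ⟨B.filter fun v => v = x ∨ G.Adj x v, ⟨Finset.filter_subset _ _, ?_, ?_⟩, ?_⟩
    · intro u hu v hv huv
      simp only [Finset.coe_filter, Set.mem_ofPred_eq] at hu hv
      obtain ⟨hu, hu'⟩ := hu
      obtain ⟨hv, hv'⟩ := hv
      rcases hu' with hu' | hu' <;> rcases hv' with hv' | hv'
      · exact absurd (hu'.trans hv'.symm) huv
      · exact hu' ▸ hv'
      · exact hv' ▸ hu'.symm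
      · exact hB u hu x hx' v hv hu'.symm hv' huv
    · intro u hu v hv hvQ huv
      simp only [Finset.mem_filter, not_and, not_or] at hu hvQ
      obtain ⟨hu, hu'⟩ := hu
      obtain ⟨h1, h2⟩ := hvQ hv
      rcases hu' with hu' | hu'
      · exact h2 (hu' ▸ huv)
      · exact h2 (hB x hx' u hu v hv hu' huv (Ne.symm h1))
    · intro y hy
      rw [Finset.mem_filter]
      refine ⟨hQB hy, ?_⟩
      by_cases h : y = x
      · exact Or.inl h
      · exact Or.inr (hQ hx hy (Ne.symm h))

theorem Str.isolate [Fintype V] {G : SimpleGraph V} {A B : Finset V} {m s : ℕ} (h : Str G A B m)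
    (x : Fin s → V) : Str (isolate G x) (A.filter fun v => ∀ i, v ≠ x i)
      (B.filter fun v => ∀ i, v ≠ x i) (m + 2 * s) := by
  have hc : ∀ U : Finset V, U.card ≤ (U.filter fun v => ∀ i, v ≠ x i).card + s := by
    intro U
    have h1 : (Finset.univ.image x).card ≤ s := by
      simpa using Finset.card_image_le (s := (Finset.univ : Finset (Fin s))) (f := x)
    refine (Finset.card_le_card (t := (U.filter fun v => ∀ i, v ≠ x i) ∪ Finset.univ.image x)
      fun v hv => ?_).trans ((Finset.card_union_le _ _).trans (by omega))
    by_cases hv' : ∀ i, v ≠ x i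
    · exact Finset.mem_union_left _ (Finset.mem_filter.2 ⟨hv, hv'⟩)
    · push Not at hv'
      obtain ⟨i, hi⟩ := hv'
      exact Finset.mem_union_right _ (Finset.mem_image.2 ⟨i, Finset.mem_univ _, hi.symm⟩)
  have hA := hc A
  have hB := hc B
  refine ⟨?_, ?_, ?_, ?_, ?_, ?_, ?_⟩
  · intro u hu v hv huv
    simp only [Finset.coe_filter, Set.mem_ofPred_eq] at hu hv
    exact ⟨h.clique hu.1 hv.1 huv, hu.2, hv.2⟩
  · intro u hu v hv w hw huv hvw huw
    simp only [Finset.coe_filter, Set.mem_ofPred_eq] at hu hv hw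
    exact ⟨h.cluster u hu.1 v hv.1 w hw.1 huv.1 hvw.1 huw, hu.2, hw.2⟩
  · exact Finset.disjoint_filter_filter h.disjoint
  · have := h.lower
    omega
  · have := h.upper
    have := Finset.card_filter_le A fun v => ∀ i, v ≠ x i
    omega
  · have := h.cover
    omega
  · intro X hX hXm M hM hMB hMm pat
    obtain ⟨a, ha, e, he, hae⟩ := h.rich X (hX.trans (Finset.filter_subset _ _)) (by omega) M hM
      (fun e he a => Finset.filter_subset _ _ (hMB e he a)) (by omega) pat
    refine ⟨a, ha, e, he, fun b => ?_⟩
    rw [← hae b]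
    have h1 := (Finset.mem_filter.1 (hX ha)).2
    have h2 := (Finset.mem_filter.1 (hMB e he b)).2
    exact ⟨fun h => h.1, fun h => ⟨h, h1, h2⟩⟩

end Blocks

section Neighbourhoods

variable {V : Type*}

theorem Rich.exists_common {G : SimpleGraph V} {A B X₁ X₂ : Finset V} {m : ℕ}
    (h : Rich G A B m) (h₁ : X₁ ⊆ A) (h₂ : X₂ ⊆ A) (hc₁ : m ≤ X₁.card) (hc₂ : m ≤ X₂.card)
    {M : Finset (Fin 2 → V)} (hM : DisjFam M) (hMB : ∀ e ∈ M, ∀ a, e a ∈ B)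
    (hMc : 2 * m ≤ M.card) (p₁ p₂ : Fin 2 → Bool) :
    ∃ e ∈ M, (∃ x ∈ X₁, ∀ b, G.Adj x (e b) ↔ p₁ b = true) ∧
      ∃ x ∈ X₂, ∀ b, G.Adj x (e b) ↔ p₂ b = true := by
  have key : ∀ X ⊆ A, m ≤ X.card → ∀ p : Fin 2 → Bool,
      (M.filter fun e => ¬∃ x ∈ X, ∀ b, G.Adj x (e b) ↔ p b = true).card < m := by
    intro X hX hXm p
    by_contra hcon
    rw [not_lt] at hcon
    obtain ⟨x, hx, e, he, hxe⟩ := h X hX hXm _ (hM.subset (Finset.filter_subset _ _))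
      (fun e he => hMB e (Finset.filter_subset _ _ he)) hcon p
    exact (Finset.mem_filter.1 he).2 ⟨x, hx, hxe⟩
  have k₁ := key X₁ h₁ hc₁ p₁
  have k₂ := key X₂ h₂ hc₂ p₂
  by_contra! hcon
  have : M.card ≤ _ := (Finset.card_le_card (t :=
    (M.filter fun e => ¬∃ x ∈ X₁, ∀ b, G.Adj x (e b) ↔ p₁ b = true) ∪
    (M.filter fun e => ¬∃ x ∈ X₂, ∀ b, G.Adj x (e b) ↔ p₂ b = true)) fun e he => by
      simp only [Finset.mem_union, Finset.mem_filter, he, true_and]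
      by_cases hx : ∃ x ∈ X₁, ∀ b, G.Adj x (e b) ↔ p₁ b = true
      · refine Or.inr fun ⟨y, hy, hye⟩ => ?_
        obtain ⟨b, hb⟩ := hcon e he hx y hy
        have := hye b
        tauto
      · exact Or.inl hx).trans (Finset.card_union_le _ _)
  omega

variable [Fintype V]

theorem Str.exists_block {G : SimpleGraph V} (hG : Tame G) {A B : Finset V} {m : ℕ}
    (h : Str G A B m) {x : V} (hx : m + 1 ≤ (A.filter fun a => ¬G.Adj x a).card) :
    ∃ Q, IsBlock G B Q ∧ ((B.filter (G.Adj x)) \ Q).card ≤ 4 * m := by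
  have hX : m ≤ ((A.filter fun a => ¬G.Adj x a).erase x).card := by
    have := Finset.pred_card_le_card_erase (s := A.filter fun a => ¬G.Adj x a) (a := x)
    omega
  have hXA : (A.filter fun a => ¬G.Adj x a).erase x ⊆ A :=
    (Finset.erase_subset _ _).trans (Finset.filter_subset _ _)
  rcases exists_independent_or_matching Gᶜ (B.filter (G.Adj x)) (2 * m) with
    ⟨M, hM, hMc, hMP⟩ | ⟨E, hE, hEQ⟩
  · exfalso
    obtain ⟨e, he, ⟨a, ha, hae⟩, ⟨a', ha', hae'⟩⟩ := h.rich.exists_common hXA hXA hX hX hM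
      (fun e he a => (Finset.mem_filter.1 ((hMP e he).2 a)).1) hMc.ge
      (fun b => decide (b = 0)) (fun b => decide (b = 1))
    have e0 := (Finset.mem_filter.1 ((hMP e he).2 0)).2
    have e1 := (Finset.mem_filter.1 ((hMP e he).2 1)).2
    have e01 := (SimpleGraph.compl_adj _ _ _).1 (hMP e he).1
    have a0 := hae 0
    have a1 := hae 1
    have b0 := hae' 0
    have b1 := hae' 1
    simp only [Finset.mem_erase, Finset.mem_filter] at ha ha'
    have hne : a ≠ a' := fun hc => by
      subst hc
      simp at a0 b0
      exact b0 a0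
    have haa := h.clique ha.2.1 ha'.2.1 hne
    simp at a0 a1 b0 b1
    exact hG.c5 x (e 0) a a' (e 1) e0 a0.symm haa b1 e1.symm ha.2.2 (fun hc => b0 hc.symm) a1
      (fun hc => ha'.2.2 hc.symm) (fun hc => e01.2 hc.symm)
  · obtain ⟨Q, hQ, hEQ'⟩ := exists_isBlock (Q := B.filter (G.Adj x) \ E) h.cluster
      (Finset.sdiff_subset.trans (Finset.filter_subset _ _)) (fun u hu v hv huv => by
        by_contra hc
        exact hEQ u (by simpa using hu) v (by simpa using hv)
          ((SimpleGraph.compl_adj _ _ _).2 ⟨huv, hc⟩))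
    refine ⟨Q, hQ, (Finset.card_le_card fun v hv => ?_).trans (hE.trans (by omega))⟩
    rw [Finset.mem_sdiff] at hv
    by_contra hc
    exact hv.2 (hEQ' (Finset.mem_sdiff.2 ⟨hv.1, hc⟩))

theorem Str.exists_block_near {G : SimpleGraph V} (hG : Tame G) {A B : Finset V} {m : ℕ}
    (h : Str G A B m) {x : V} (hx : m + 1 ≤ (A.filter fun a => ¬G.Adj x a).card)
    (hx' : m + 1 ≤ (A.filter (G.Adj x)).card) :
    ∃ Q, IsBlock G B Q ∧ (B.filter fun v => ¬(G.Adj x v ↔ v ∈ Q)).card ≤ 8 * m + 1 := by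
  obtain ⟨Q, hQ, hQ4⟩ := h.exists_block hG hx
  have hX : m ≤ ((A.filter fun a => ¬G.Adj x a).erase x).card := by
    have := Finset.pred_card_le_card_erase (s := A.filter fun a => ¬G.Adj x a) (a := x)
    omega
  have hXA : (A.filter fun a => ¬G.Adj x a).erase x ⊆ A :=
    (Finset.erase_subset _ _).trans (Finset.filter_subset _ _)
  rcases exists_disjFam_or_hitting (fun e : Fin 2 → V => (G.Adj x (e 0) ∧ ¬G.Adj x (e 1) ∧
      e 1 ≠ x ∧ G.Adj (e 0) (e 1)) ∧ ∀ a, e a ∈ B)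
      (fun e he => injective_pair he.1.2.2.2.ne) (2 * m) with ⟨M, hM, hMc, hMP⟩ | ⟨E, hE, hEQ⟩
  · exfalso
    obtain ⟨e, he, ⟨a, ha, hae⟩, ⟨a', ha', hae'⟩⟩ := h.rich.exists_common hXA
      (Finset.filter_subset _ _) hX (m.le_succ.trans hx') hM (fun e he a => (hMP e he).2 a)
      hMc.ge (fun b => decide (b = 1)) (fun b => false)
    obtain ⟨⟨e0, e1, ex, e01⟩, -⟩ := hMP e he
    have a0 := hae 0
    have a1 := hae 1
    have b0 := hae' 0
    have b1 := hae' 1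
    simp only [Finset.mem_erase, Finset.mem_filter] at ha ha'
    simp at a0 a1 b0 b1
    have hne : a ≠ a' := fun hc => b1 (hc ▸ a1)
    have haa := h.clique ha.2.1 ha'.1 hne
    exact hG.c5 x (e 0) (e 1) a a' e0 e01 a1.symm haa ha'.2.symm e1 (fun hc => a0 hc.symm)
      (fun hc => b1 hc.symm) (fun hc => ha.2.2 hc.symm) b0
  · by_cases hc : ∀ v ∈ Q, G.Adj x v → v ∈ E
    · refine ⟨∅, ⟨by simp, by simp, by simp⟩, (Finset.card_le_card
        (t := ((B.filter (G.Adj x)) \ Q) ∪ E) fun v hv => ?_).trans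
        ((Finset.card_union_le _ _).trans (by omega))⟩
      simp only [Finset.mem_filter, Finset.notMem_empty, iff_false, not_not] at hv
      by_cases hvQ : v ∈ Q
      · exact Finset.mem_union_right _ (hc v hvQ hv.2)
      · exact Finset.mem_union_left _ (Finset.mem_sdiff.2 ⟨Finset.mem_filter.2 hv, hvQ⟩)
    · push Not at hc
      obtain ⟨u, huQ, hxu, huE⟩ := hc
      refine ⟨Q, hQ, (Finset.card_le_card
        (t := ((B.filter (G.Adj x)) \ Q) ∪ (E ∪ {x})) fun v hv => ?_).trans
        ((Finset.card_union_le _ _).trans ((Nat.add_le_add_left (Finset.card_union_le _ _)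
          _).trans (by rw [Finset.card_singleton]; omega)))⟩
      rw [Finset.mem_filter] at hv
      obtain ⟨hvB, hv⟩ := hv
      by_cases hvQ : v ∈ Q
      · refine Finset.mem_union_right _ ?_
        have hxv : ¬G.Adj x v := fun hc => hv (iff_of_true hc hvQ)
        by_cases hvx : v = x
        · simp [hvx]
        · have huv : u ≠ v := fun h => hxv (h ▸ hxu)
          obtain ⟨a, ha⟩ := hEQ ![u, v] ⟨⟨hxu, hxv, hvx, hQ.clique huQ hvQ huv⟩, fun a => by
            fin_cases a
            · exact hQ.subset huQ
            · exact hvB⟩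
          fin_cases a
          · exact absurd ha huE
          · exact Finset.mem_union_left _ ha
      · have hxv : G.Adj x v := by tauto
        exact Finset.mem_union_left _
          (Finset.mem_sdiff.2 ⟨Finset.mem_filter.2 ⟨hvB, hxv⟩, hvQ⟩)

end Neighbourhoods

section EventCounts

theorem IsBlock.card_cast_sdiff {V : Type*} {G : SimpleGraph V} {B Q : Finset V}
    (h : IsBlock G B Q) : ((B \ Q).card : ℝ) = B.card - Q.card := by
  rw [Finset.card_sdiff_of_subset h.subset, Nat.cast_sub (Finset.card_le_card h.subset)]

variable {V : Type*} [Fintype V]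

theorem cnt_forall_le {α ι : Type*} [Finite α] [Fintype ι] (P : α → Prop) :
    cnt (fun f : ι → α => ∀ i, P (f i)) = cnt P ^ Fintype.card ι := by
  rw [cnt, cnt, Nat.card_congr (Equiv.subtypePiEquivPi (β := fun _ : ι => α) (p := fun _ => P)),
    Nat.card_fun, Nat.card_eq_fintype_card (α := ι)]

theorem cnt_ne_le {σ : Type*} [Fintype σ] (r : σ) :
    cnt (fun c : σ => c ≠ r) ≤ Fintype.card σ - 1 := by
  rw [cnt_eq_card_filter, Finset.filter_ne' Finset.univ r,
    Finset.card_erase_of_mem (Finset.mem_univ _), Finset.card_univ]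

theorem cnt_ne_ne_le {σ : Type*} [Fintype σ] {r r' : σ} (h : r ≠ r') :
    cnt (fun c : σ => c ≠ r ∧ c ≠ r') ≤ Fintype.card σ - 2 := by
  have h1 : (Finset.univ.filter fun c : σ => c ≠ r ∧ c ≠ r') = ({r, r'} : Finset σ)ᶜ := by
    ext c
    simp
  rw [cnt_eq_card_filter, h1, Finset.card_compl, Finset.card_pair h]

/-- The vertex is almost nonadjacent to `A ∪ B`, except for a smaller block. -/
def LowEvent (G : SimpleGraph V) (A B : Finset V) (k : ℕ) (p : V → Fin 1 → Bool) : Prop :=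
  ∃ Q, (IsBlock G B Q ∧ 200 * Q.card ≤ 99 * Fintype.card V) ∧
    cnt (fun v => ¬((v ∈ A → p v 0 = false) ∧ (v ∈ B \ Q → p v 0 = false))) ≤ k

/-- The vertex is almost homogeneous to `A` and to a large block. -/
def FlatEvent (G : SimpleGraph V) (A B : Finset V) (k t : ℕ) (p : V → Fin 1 → Bool) : Prop :=
  ∃ q : Finset V × Bool × Bool,
    ((IsBlock G B q.1 ∧ 99 * Fintype.card V ≤ 200 * q.1.card + t) ∧ True) ∧
    cnt (fun v => ¬((v ∈ A → p v 0 = q.2.1) ∧ (v ∈ q.1 → p v 0 = q.2.2))) ≤ k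

/-- Two vertices have almost no common non-neighbours in `A`. -/
def PairEvent (G : SimpleGraph V) (A B : Finset V) (k : ℕ) (p : V → Fin 2 → Bool) : Prop :=
  ∃ Q : Fin 2 → Finset V, (∀ i, IsBlock G B (Q i)) ∧
    cnt (fun v => ¬((v ∈ A → p v ≠ fun _ => false) ∧
      (v ∈ B → p v = fun i => decide (v ∈ Q i)))) ≤ k

/-- Three vertices, each attached to a block, miss a pattern in `A`. -/
def TripleEventA (G : SimpleGraph V) (A B : Finset V) (k : ℕ) (p : V → Fin 3 → Bool) : Prop :=
  ∃ q : (Fin 3 → Finset V) × (Fin 3 → Bool), ((∀ i, IsBlock G B (q.1 i)) ∧ True) ∧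
    cnt (fun v => ¬((v ∈ A → p v ≠ q.2) ∧ (v ∈ B → p v = fun i => decide (v ∈ q.1 i)))) ≤ k

/-- Three vertices, almost complete to `A`, miss a pattern in `B`. -/
def TripleEventB (A B : Finset V) (k : ℕ) (p : V → Fin 3 → Bool) : Prop :=
  ∃ r : Fin 3 → Bool, True ∧
    cnt (fun v => ¬((v ∈ A → p v = fun _ => true) ∧ (v ∈ B → p v ≠ r))) ≤ k

/-- Three vertices, almost complete to `A`, miss two patterns in `B` outside a smaller block. -/
def TripleEventC (G : SimpleGraph V) (A B : Finset V) (k : ℕ) (p : V → Fin 3 → Bool) : Prop :=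
  ∃ q : Finset V × (Fin 3 → Bool) × (Fin 3 → Bool),
    ((IsBlock G B q.1 ∧ 200 * q.1.card ≤ 99 * Fintype.card V) ∧ q.2.1 ≠ q.2.2) ∧
    cnt (fun v => ¬((v ∈ A → p v = fun _ => true) ∧
      (v ∈ B \ q.1 → p v ≠ q.2.1 ∧ p v ≠ q.2.2))) ≤ k

/-- Three vertices, each almost homogeneous to `A`, miss a pattern in a large block. -/
def TripleEventD (G : SimpleGraph V) (A B : Finset V) (k t : ℕ) (p : V → Fin 3 → Bool) : Prop :=
  ∃ q : Finset V × (Fin 3 → Bool) × (Fin 3 → Bool),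
    ((IsBlock G B q.1 ∧ 99 * Fintype.card V ≤ 200 * q.1.card + t) ∧ True) ∧
    cnt (fun v => ¬((v ∈ A → p v = q.2.1) ∧ (v ∈ q.1 → p v ≠ q.2.2))) ≤ k

/-- The parameters `m`, `k`, `t` are negligible compared to `n`. -/
structure SmallParams (n m k t : ℕ) : Prop where
  vol_le : (vol n k : ℝ) ≤ 2 ^ ((1 / 100000 : ℝ) * n)
  k_le : (3 * k : ℝ) ≤ (1 / 100000 : ℝ) * n
  m_le : (m : ℝ) ≤ (1 / 100000 : ℝ) * n
  t_le : (t : ℝ) ≤ (1 / 100000 : ℝ) * n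
  poly_le : (64 * (n + 1) ^ 3 : ℝ) ≤ 2 ^ ((1 / 100000 : ℝ) * n)

theorem cnt_le_mul_of_exists_real {α β : Type*} [Finite α] [Finite β] {P : α → Prop}
    {Q : β → Prop} {R : β → α → Prop} {K : ℝ} (hK : 0 ≤ K) (hf : ∀ x, P x → ∃ y, Q y ∧ R y x)
    (hk : ∀ y, Q y → (cnt (R y) : ℝ) ≤ K) : (cnt P : ℝ) ≤ cnt Q * K := by
  have h := cnt_le_mul_of_exists ⌊K⌋₊ hf fun y hy => Nat.le_floor (hk y hy)
  calc (cnt P : ℝ) ≤ cnt Q * ⌊K⌋₊ := by exact_mod_cast h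
    _ ≤ cnt Q * K := mul_le_mul_of_nonneg_left (Nat.floor_le hK) (Nat.cast_nonneg _)

theorem natCast_le_two_rpow_div {a p q : ℕ} (hq : q ≠ 0) (h : a ^ q ≤ 2 ^ p) :
    (a : ℝ) ≤ 2 ^ ((p : ℝ) / q) := by
  have h1 : ((a : ℝ)) ^ q ≤ (2 ^ ((p : ℝ) / q)) ^ q := by
    rw [← Real.rpow_natCast (2 ^ ((p : ℝ) / q)), ← Real.rpow_mul zero_le_two,
      div_mul_cancel₀ _ (by exact_mod_cast hq), Real.rpow_natCast]
    exact_mod_cast h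
  exact le_of_pow_le_pow_left₀ hq (by positivity) h1

theorem SmallParams.cnt_le {m k t s a b : ℕ} (h : SmallParams (Fintype.card V) m k t)
    {ι : Type*} [Finite ι] {I : ι → Prop} {Al : ι → V → (Fin s → Bool) → Prop} (hs : s ≤ 3)
    (hI : cnt I ≤ 64 * (Fintype.card V + 1) ^ 3) {α β γ : ℝ} (ha0 : 1 ≤ a) (hb0 : 1 ≤ b)
    (ha : (a : ℝ) ≤ 2 ^ α) (hb : (b : ℝ) ≤ 2 ^ β)
    (hU : ∀ q, I q → ∃ U₁ U₂ : Finset V, Disjoint U₁ U₂ ∧ (∀ v ∈ U₁, cnt (Al q v) ≤ a) ∧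
      (∀ v ∈ U₂, cnt (Al q v) ≤ b) ∧ 3 / 100000 * Fintype.card V + α * U₁.card + β * U₂.card +
        s * ((Fintype.card V : ℝ) - U₁.card - U₂.card) ≤ γ) :
    (cnt (fun p : V → Fin s → Bool => ∃ q, I q ∧ cnt (fun v => ¬Al q v (p v)) ≤ k) : ℝ) ≤
      2 ^ γ := by
  set n := Fintype.card V with hn
  have e0 : (cnt I : ℝ) ≤ 2 ^ ((1 / 100000 : ℝ) * n) :=
    le_trans (by exact_mod_cast hI) h.poly_le
  have e1 : ((2 : ℝ) ^ s) ^ k ≤ 2 ^ ((1 / 100000 : ℝ) * n) := by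
    rw [← pow_mul, ← Real.rpow_natCast]
    refine Real.rpow_le_rpow_of_exponent_le one_le_two (le_trans ?_ h.k_le)
    have : s * k ≤ 3 * k := Nat.mul_le_mul_right _ hs
    exact_mod_cast this
  have key : ∀ q, I q → (cnt (fun p : V → Fin s → Bool => cnt (fun v => ¬Al q v (p v)) ≤ k) : ℝ) ≤
      2 ^ (γ - (1 / 100000 : ℝ) * n) := by
    intro q hq
    obtain ⟨U₁, U₂, hd, h1, h2, hγ⟩ := hU q hq
    have hN := cnt_approx_le (Al q) hd k ha0 hb0 h1 h2
    rw [Fintype.card_fun, Fintype.card_bool, Fintype.card_fin, ← hn] at hN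
    have hu : U₁.card + U₂.card ≤ n := by
      rw [← Finset.card_union_of_disjoint hd]
      exact Finset.card_le_univ _
    have e2 : (a : ℝ) ^ U₁.card ≤ 2 ^ (α * U₁.card) := by
      rw [Real.rpow_mul zero_le_two, Real.rpow_natCast]
      gcongr
    have e3 : (b : ℝ) ^ U₂.card ≤ 2 ^ (β * U₂.card) := by
      rw [Real.rpow_mul zero_le_two, Real.rpow_natCast]
      gcongr
    have e4 : ((2 : ℝ) ^ s) ^ (n - U₁.card - U₂.card) =
        2 ^ (s * ((n : ℝ) - U₁.card - U₂.card)) := by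
      rw [← pow_mul, ← Real.rpow_natCast]
      congr 1
      rw [Nat.cast_mul, Nat.sub_sub, Nat.cast_sub hu]
      push_cast
      ring
    calc _ ≤ ((vol n k * ((2 ^ s) ^ k * (a ^ U₁.card * b ^ U₂.card *
          (2 ^ s) ^ (n - U₁.card - U₂.card))) : ℕ) : ℝ) := by exact_mod_cast hN
      _ = (vol n k : ℝ) * ((2 ^ s) ^ k * ((a : ℝ) ^ U₁.card * (b : ℝ) ^ U₂.card *
          (2 ^ s) ^ (n - U₁.card - U₂.card))) := by push_cast; rfl
      _ ≤ 2 ^ ((1 / 100000 : ℝ) * n) * (2 ^ ((1 / 100000 : ℝ) * n) *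
          (2 ^ (α * U₁.card) * 2 ^ (β * U₂.card) *
            2 ^ (s * ((n : ℝ) - U₁.card - U₂.card)))) := by
        rw [e4]
        have := h.vol_le
        gcongr
      _ = 2 ^ (2 / 100000 * n + α * U₁.card + β * U₂.card +
          s * ((n : ℝ) - U₁.card - U₂.card)) := by
        simp only [← Real.rpow_add two_pos]
        congr 1
        ring
      _ ≤ _ := Real.rpow_le_rpow_of_exponent_le one_le_two (by linarith)
  calc _ ≤ (cnt I : ℝ) * 2 ^ (γ - (1 / 100000 : ℝ) * n) :=
        cnt_le_mul_of_exists_real (R := fun q (p : V → Fin s → Bool) =>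
          cnt (fun v => ¬Al q v (p v)) ≤ k) (by positivity) (fun p hp => hp) key
    _ ≤ 2 ^ ((1 / 100000 : ℝ) * n) * 2 ^ (γ - (1 / 100000 : ℝ) * n) := by gcongr
    _ = 2 ^ γ := by
      rw [← Real.rpow_add two_pos]
      congr 1
      ring

section Bounds

variable {G : SimpleGraph V} {A B : Finset V} {m k t : ℕ}

theorem Str.real_bounds (h : Str G A B m) :
    (Fintype.card V : ℝ) ≤ 2 * A.card + 2 * m ∧ 2 * (A.card : ℝ) ≤ Fintype.card V + 2 * m ∧
      (Fintype.card V : ℝ) ≤ A.card + B.card + m ∧ (A.card : ℝ) + B.card ≤ Fintype.card V := by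
  have h1 : A.card + B.card ≤ Fintype.card V := by
    rw [← Finset.card_union_of_disjoint h.disjoint]
    exact Finset.card_le_univ _
  exact ⟨by exact_mod_cast h.lower, by exact_mod_cast h.upper, by exact_mod_cast h.cover,
    by exact_mod_cast h1⟩

theorem cnt_isBlock_and_le (P : Finset V → Prop) :
    cnt (fun Q => IsBlock G B Q ∧ P Q) ≤ Fintype.card V + 1 :=
  (cnt_mono fun _ h => h.1).trans (cnt_isBlock_le G B)

theorem fin_one_ext {c d : Fin 1 → Bool} (h : c 0 = d 0) : c = d :=
  funext fun i => by rw [Subsingleton.elim i 0, h]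

theorem cnt_lowEvent_le (h : Str G A B m) (hs : SmallParams (Fintype.card V) m k t) :
    (cnt (LowEvent G A B k) : ℝ) ≤ 2 ^ ((1 / 2 - 1 / 2000 : ℝ) * Fintype.card V) := by
  obtain ⟨h1, h2, h3, h4⟩ := h.real_bounds
  have hm := hs.m_le
  refine hs.cnt_le (s := 1) (Al := fun Q v c => (v ∈ A → c 0 = false) ∧ (v ∈ B \ Q → c 0 = false))
    (a := 1) (b := 1) (α := 0) (β := 0) (by norm_num) ?_ le_rfl le_rfl (by simp) (by simp) ?_
  · exact (cnt_isBlock_and_le _).trans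
      ((Nat.le_self_pow (by norm_num) _).trans (Nat.le_mul_of_pos_left _ (by norm_num)))
  · rintro Q ⟨hQ, hQc⟩
    refine ⟨A, B \ Q, h.disjoint.mono_right Finset.sdiff_subset, fun v hv => ?_, fun v hv => ?_, ?_⟩
    · exact cnt_le_one fun c d hc hd => fin_one_ext ((hc.1 hv).trans (hd.1 hv).symm)
    · exact cnt_le_one fun c d hc hd => fin_one_ext ((hc.2 hv).trans (hd.2 hv).symm)
    · rw [hQ.card_cast_sdiff]
      have hQc' : 200 * (Q.card : ℝ) ≤ 99 * Fintype.card V := by exact_mod_cast hQc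
      push_cast
      linarith

theorem cnt_flatEvent_le (h : Str G A B m) (hs : SmallParams (Fintype.card V) m k t) :
    (cnt (FlatEvent G A B k t) : ℝ) ≤ 2 ^ ((1 / 2 - 1 / 2000 : ℝ) * Fintype.card V) := by
  obtain ⟨h1, h2, h3, h4⟩ := h.real_bounds
  have hm := hs.m_le
  have ht := hs.t_le
  refine hs.cnt_le (s := 1) (Al := fun q : Finset V × Bool × Bool => fun v c =>
      (v ∈ A → c 0 = q.2.1) ∧ (v ∈ q.1 → c 0 = q.2.2))
    (a := 1) (b := 1) (α := 0) (β := 0) (by norm_num) ?_ le_rfl le_rfl (by simp) (by simp) ?_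
  · rw [cnt_prod (fun Q => IsBlock G B Q ∧ 99 * Fintype.card V ≤ 200 * Q.card + t) (fun _ => True),
      cnt_true, Nat.card_eq_fintype_card]
    refine (Nat.mul_le_mul_right _ (cnt_isBlock_and_le _)).trans ?_
    simp only [Fintype.card_prod, Fintype.card_bool]
    rw [mul_comm]
    exact Nat.mul_le_mul (by norm_num) (Nat.le_self_pow (by norm_num) _)
  · rintro q ⟨⟨hQ, hQc⟩, -⟩
    refine ⟨A, q.1, h.disjoint.mono_right hQ.subset, fun v hv => ?_, fun v hv => ?_, ?_⟩
    · exact cnt_le_one fun c d hc hd => fin_one_ext ((hc.1 hv).trans (hd.1 hv).symm)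
    · exact cnt_le_one fun c d hc hd => fin_one_ext ((hc.2 hv).trans (hd.2 hv).symm)
    · have hQc' : 99 * (Fintype.card V : ℝ) ≤ 200 * q.1.card + t := by exact_mod_cast hQc
      push_cast
      linarith

theorem cnt_pairEvent_le (h : Str G A B m) (hs : SmallParams (Fintype.card V) m k t) :
    (cnt (PairEvent G A B k) : ℝ) ≤ 2 ^ ((1 - 1 / 2000 : ℝ) * Fintype.card V) := by
  obtain ⟨h1, h2, h3, h4⟩ := h.real_bounds
  have hm := hs.m_le
  refine hs.cnt_le (s := 2) (Al := fun Q : Fin 2 → Finset V => fun v c =>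
      (v ∈ A → c ≠ fun _ => false) ∧ (v ∈ B → c = fun i => decide (v ∈ Q i)))
    (a := 3) (b := 1) (α := (8 : ℕ) / (5 : ℕ)) (β := 0) (by norm_num) ?_ (by norm_num) le_rfl
    (natCast_le_two_rpow_div (by norm_num) (by norm_num)) (by simp) ?_
  · rw [cnt_forall_le, Fintype.card_fin]
    refine (Nat.pow_le_pow_left (cnt_isBlock_le G B) 2).trans ?_
    nlinarith [Nat.zero_le (Fintype.card V)]
  · rintro Q hQ
    refine ⟨A, B, h.disjoint, fun v hv => ?_, fun v hv => ?_, ?_⟩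
    · refine (cnt_mono fun c hc => hc.1 hv).trans ((cnt_ne_le _).trans ?_)
      simp
    · exact cnt_le_one fun c d hc hd => (hc.2 hv).trans (hd.2 hv).symm
    · push_cast
      linarith

theorem cnt_tripleEventA_le (h : Str G A B m) (hs : SmallParams (Fintype.card V) m k t) :
    (cnt (TripleEventA G A B k) : ℝ) ≤ 2 ^ ((3 / 2 - 1 / 2000 : ℝ) * Fintype.card V) := by
  obtain ⟨h1, h2, h3, h4⟩ := h.real_bounds
  have hm := hs.m_le
  refine hs.cnt_le (s := 3) (Al := fun q : (Fin 3 → Finset V) × (Fin 3 → Bool) => fun v c =>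
      (v ∈ A → c ≠ q.2) ∧ (v ∈ B → c = fun i => decide (v ∈ q.1 i)))
    (a := 7) (b := 1) (α := (17 : ℕ) / (6 : ℕ)) (β := 0) (by norm_num) ?_ (by norm_num) le_rfl
    (natCast_le_two_rpow_div (by norm_num) (by norm_num)) (by simp) ?_
  · rw [cnt_prod (fun Q : Fin 3 → Finset V => ∀ i, IsBlock G B (Q i)) (fun _ => True),
      cnt_forall_le, cnt_true, Nat.card_eq_fintype_card, Fintype.card_fin]
    refine (Nat.mul_le_mul_right _ (Nat.pow_le_pow_left (cnt_isBlock_le G B) 3)).trans ?_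
    simp only [Fintype.card_fun, Fintype.card_bool, Fintype.card_fin]
    nlinarith [Nat.zero_le ((Fintype.card V + 1) ^ 3)]
  · rintro q -
    refine ⟨A, B, h.disjoint, fun v hv => ?_, fun v hv => ?_, ?_⟩
    · refine (cnt_mono fun c hc => hc.1 hv).trans ((cnt_ne_le _).trans ?_)
      simp
    · exact cnt_le_one fun c d hc hd => (hc.2 hv).trans (hd.2 hv).symm
    · push_cast
      linarith

theorem cnt_tripleEventB_le (h : Str G A B m) (hs : SmallParams (Fintype.card V) m k t) :
    (cnt (TripleEventB A B k) : ℝ) ≤ 2 ^ ((3 / 2 - 1 / 2000 : ℝ) * Fintype.card V) := by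
  obtain ⟨h1, h2, h3, h4⟩ := h.real_bounds
  have hm := hs.m_le
  refine hs.cnt_le (s := 3) (Al := fun q : Fin 3 → Bool => fun v c =>
      (v ∈ A → c = fun _ => true) ∧ (v ∈ B → c ≠ q))
    (a := 1) (b := 7) (α := 0) (β := (17 : ℕ) / (6 : ℕ)) (by norm_num) ?_ le_rfl (by norm_num)
    (by simp) (natCast_le_two_rpow_div (by norm_num) (by norm_num)) ?_
  · rw [cnt_true, Nat.card_eq_fintype_card]
    simp only [Fintype.card_fun, Fintype.card_bool, Fintype.card_fin]
    nlinarith [Nat.one_le_pow 3 _ (Nat.succ_pos (Fintype.card V))]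
  · rintro q -
    refine ⟨A, B, h.disjoint, fun v hv => ?_, fun v hv => ?_, ?_⟩
    · exact cnt_le_one fun c d hc hd => (hc.1 hv).trans (hd.1 hv).symm
    · refine (cnt_mono fun c hc => hc.2 hv).trans ((cnt_ne_le _).trans ?_)
      simp
    · push_cast
      linarith

theorem cnt_pattern_pair_le (P : Finset V → Prop) (P' : (Fin 3 → Bool) × (Fin 3 → Bool) → Prop) :
    cnt (fun q : Finset V × (Fin 3 → Bool) × (Fin 3 → Bool) => (IsBlock G B q.1 ∧ P q.1) ∧
      P' q.2) ≤ 64 * (Fintype.card V + 1) ^ 3 := by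
  rw [cnt_prod (fun Q => IsBlock G B Q ∧ P Q) P']
  refine (Nat.mul_le_mul (cnt_isBlock_and_le _) (cnt_le_card _)).trans ?_
  simp only [Nat.card_eq_fintype_card, Fintype.card_prod, Fintype.card_fun, Fintype.card_bool,
    Fintype.card_fin]
  rw [mul_comm]
  exact Nat.mul_le_mul (by norm_num) (Nat.le_self_pow (by norm_num) _)

theorem cnt_tripleEventC_le (h : Str G A B m) (hs : SmallParams (Fintype.card V) m k t) :
    (cnt (TripleEventC G A B k) : ℝ) ≤ 2 ^ ((3 / 2 - 1 / 2000 : ℝ) * Fintype.card V) := by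
  obtain ⟨h1, h2, h3, h4⟩ := h.real_bounds
  have hm := hs.m_le
  refine hs.cnt_le (s := 3) (Al := fun q : Finset V × (Fin 3 → Bool) × (Fin 3 → Bool) => fun v c =>
      (v ∈ A → c = fun _ => true) ∧ (v ∈ B \ q.1 → c ≠ q.2.1 ∧ c ≠ q.2.2))
    (a := 1) (b := 6) (α := 0) (β := (13 : ℕ) / (5 : ℕ)) (by norm_num) ?_ le_rfl (by norm_num)
    (by simp) (natCast_le_two_rpow_div (by norm_num) (by norm_num)) ?_
  · exact cnt_pattern_pair_le (fun Q => 200 * Q.card ≤ 99 * Fintype.card V) (fun r => r.1 ≠ r.2)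
  rintro q ⟨⟨hQ, hQc⟩, hne⟩
  refine ⟨A, B \ q.1, h.disjoint.mono_right Finset.sdiff_subset, fun v hv => ?_, fun v hv => ?_, ?_⟩
  · exact cnt_le_one fun c d hc hd => (hc.1 hv).trans (hd.1 hv).symm
  · refine (cnt_mono fun c hc => hc.2 hv).trans ((cnt_ne_ne_le hne).trans ?_)
    simp
  · rw [hQ.card_cast_sdiff]
    have hQc' : 200 * (q.1.card : ℝ) ≤ 99 * Fintype.card V := by exact_mod_cast hQc
    push_cast
    linarith

theorem cnt_tripleEventD_le (h : Str G A B m) (hs : SmallParams (Fintype.card V) m k t) :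
    (cnt (TripleEventD G A B k t) : ℝ) ≤ 2 ^ ((3 / 2 - 1 / 2000 : ℝ) * Fintype.card V) := by
  obtain ⟨h1, h2, h3, h4⟩ := h.real_bounds
  have hm := hs.m_le
  have ht := hs.t_le
  refine hs.cnt_le (s := 3) (Al := fun q : Finset V × (Fin 3 → Bool) × (Fin 3 → Bool) => fun v c =>
      (v ∈ A → c = q.2.1) ∧ (v ∈ q.1 → c ≠ q.2.2))
    (a := 1) (b := 7) (α := 0) (β := (17 : ℕ) / (6 : ℕ)) (by norm_num) ?_ le_rfl (by norm_num)
    (by simp) (natCast_le_two_rpow_div (by norm_num) (by norm_num)) ?_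
  · exact cnt_pattern_pair_le (fun Q => 99 * Fintype.card V ≤ 200 * Q.card + t) (fun _ => True)
  rintro q ⟨⟨hQ, hQc⟩, -⟩
  refine ⟨A, q.1, h.disjoint.mono_right hQ.subset, fun v hv => ?_, fun v hv => ?_, ?_⟩
  · exact cnt_le_one fun c d hc hd => (hc.1 hv).trans (hd.1 hv).symm
  · refine (cnt_mono fun c hc => hc.2 hv).trans ((cnt_ne_le _).trans ?_)
    simp
  · have hQc' : 99 * (Fintype.card V : ℝ) ≤ 200 * q.1.card + t := by exact_mod_cast hQc
    have h5 : (q.1.card : ℝ) ≤ B.card := by exact_mod_cast Finset.card_le_card hQ.subset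
    push_cast
    linarith

end Bounds

end EventCounts

section Heredity

variable {V : Type*} {s : ℕ}

/-- The members of `U` different from all `x i`. -/
def avoiding (U : Finset V) (x : Fin s → V) : Finset V := U.filter fun v => ∀ i, v ≠ x i

theorem mem_avoiding {U : Finset V} {x : Fin s → V} {v : V} :
    v ∈ avoiding U x ↔ v ∈ U ∧ ∀ i, v ≠ x i := Finset.mem_filter

theorem card_avoiding_le (U : Finset V) (x : Fin s → V) : (avoiding U x).card ≤ U.card :=
  Finset.card_filter_le _ _

theorem card_le_card_avoiding_add (U : Finset V) (x : Fin s → V) :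
    U.card ≤ (avoiding U x).card + s := by
  have h : U ⊆ avoiding U x ∪ Finset.univ.image x := fun v hv => by
    rw [Finset.mem_union, mem_avoiding]
    by_cases h : ∃ i, v = x i
    · obtain ⟨i, rfl⟩ := h
      exact Or.inr (Finset.mem_image_of_mem _ (Finset.mem_univ i))
    · push Not at h
      exact Or.inl ⟨hv, h⟩
  refine (Finset.card_le_card h).trans ((Finset.card_union_le _ _).trans ?_)
  have h1 : (Finset.univ.image x).card ≤ s :=
    Finset.card_image_le.trans (by rw [Finset.card_univ, Fintype.card_fin])
  lia

variable [Fintype V] {G : SimpleGraph V} {A B : Finset V} {m k t : ℕ}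

theorem cnt_le_card_of_mem {P : V → Prop} (S : Finset V) (h : ∀ v, P v → v ∈ S) :
    cnt P ≤ S.card := by
  rw [cnt_eq_card_filter]
  exact Finset.card_le_card fun v hv => h v (Finset.mem_filter.1 hv).2

theorem LowEvent.isolate {p : V → Fin 1 → Bool} (h : LowEvent G A B k p) (x : Fin s → V) :
    LowEvent (isolate G x) (avoiding A x) (avoiding B x) k p := by
  obtain ⟨Q, ⟨hQ, hc⟩, hk⟩ := h
  refine ⟨avoiding Q x, ⟨hQ.isolate x, ?_⟩, (cnt_mono fun v hv => mt (fun h => ?_) hv).trans hk⟩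
  · have := card_avoiding_le Q x
    lia
  · simp only [Finset.mem_sdiff, mem_avoiding] at h ⊢
    tauto

theorem FlatEvent.isolate {p : V → Fin 1 → Bool} (h : FlatEvent G A B k t p) (x : Fin s → V) :
    FlatEvent (isolate G x) (avoiding A x) (avoiding B x) k (t + 200 * s) p := by
  obtain ⟨q, ⟨⟨hQ, hc⟩, -⟩, hk⟩ := h
  refine ⟨(avoiding q.1 x, q.2), ⟨⟨hQ.isolate x, ?_⟩, trivial⟩,
    (cnt_mono fun v hv => mt (fun h => ?_) hv).trans hk⟩
  · have := card_le_card_avoiding_add q.1 x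
    lia
  · simp only [mem_avoiding] at h ⊢
    tauto

theorem PairEvent.isolate {p : V → Fin 2 → Bool} (h : PairEvent G A B k p) (x : Fin s → V) :
    PairEvent (isolate G x) (avoiding A x) (avoiding B x) k p := by
  obtain ⟨Q, hQ, hk⟩ := h
  refine ⟨fun i => avoiding (Q i) x, fun i => (hQ i).isolate x,
    (cnt_mono fun v hv => mt (fun h => ?_) hv).trans hk⟩
  refine ⟨fun hv => h.1 (mem_avoiding.1 hv).1, fun hv => ?_⟩
  rw [mem_avoiding] at hv
  rw [h.2 hv.1]
  funext i
  simp only [mem_avoiding, and_iff_left hv.2]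

theorem TripleEventA.isolate {p : V → Fin 3 → Bool} (h : TripleEventA G A B k p)
    (x : Fin s → V) : TripleEventA (isolate G x) (avoiding A x) (avoiding B x) k p := by
  obtain ⟨q, ⟨hQ, -⟩, hk⟩ := h
  refine ⟨(fun i => avoiding (q.1 i) x, q.2), ⟨fun i => (hQ i).isolate x, trivial⟩,
    (cnt_mono fun v hv => mt (fun h => ?_) hv).trans hk⟩
  refine ⟨fun hv => h.1 (mem_avoiding.1 hv).1, fun hv => ?_⟩
  rw [mem_avoiding] at hv
  rw [h.2 hv.1]
  funext i
  simp only [mem_avoiding, and_iff_left hv.2]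

theorem TripleEventB.avoiding {p : V → Fin 3 → Bool} (h : TripleEventB A B k p)
    (x : Fin s → V) : TripleEventB (avoiding A x) (avoiding B x) k p := by
  obtain ⟨q, -, hk⟩ := h
  exact ⟨q, trivial, (cnt_mono fun v hv => mt (fun h => ⟨fun hv => h.1 (mem_avoiding.1 hv).1,
    fun hv => h.2 (mem_avoiding.1 hv).1⟩) hv).trans hk⟩

theorem TripleEventC.isolate {p : V → Fin 3 → Bool} (h : TripleEventC G A B k p)
    (x : Fin s → V) : TripleEventC (isolate G x) (_root_.avoiding A x) (_root_.avoiding B x) k p := by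
  obtain ⟨q, ⟨⟨hQ, hc⟩, hne⟩, hk⟩ := h
  refine ⟨(_root_.avoiding q.1 x, q.2), ⟨⟨hQ.isolate x, ?_⟩, hne⟩,
    (cnt_mono fun v hv => mt (fun h => ?_) hv).trans hk⟩
  · have := card_avoiding_le q.1 x
    lia
  · simp only [Finset.mem_sdiff, mem_avoiding] at h ⊢
    tauto

theorem TripleEventD.isolate {p : V → Fin 3 → Bool} (h : TripleEventD G A B k t p)
    (x : Fin s → V) :
    TripleEventD (isolate G x) (_root_.avoiding A x) (_root_.avoiding B x) k (t + 200 * s) p := by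
  obtain ⟨q, ⟨⟨hQ, hc⟩, -⟩, hk⟩ := h
  refine ⟨(_root_.avoiding q.1 x, q.2), ⟨⟨hQ.isolate x, ?_⟩, trivial⟩,
    (cnt_mono fun v hv => mt (fun h => ?_) hv).trans hk⟩
  · have := card_le_card_avoiding_add q.1 x
    lia
  · simp only [mem_avoiding] at h ⊢
    tauto

end Heredity

section Exceptional

variable {V : Type*} [Fintype V]

theorem Str.mono {G : SimpleGraph V} {A B : Finset V} {m m' : ℕ} (h : Str G A B m)
    (hm : m ≤ m') : Str G A B m' where
  clique := h.clique
  cluster := h.cluster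
  disjoint := h.disjoint
  lower := h.lower.trans (by lia)
  upper := h.upper.trans (by lia)
  cover := h.cover.trans (by lia)
  rich := h.rich.mono subset_rfl subset_rfl hm

/-- Some tuple of vertices realizes the event `Ev` over the rest of the graph. -/
def Realizes (G : SimpleGraph V) (m s : ℕ)
    (Ev : SimpleGraph V → Finset V → Finset V → (V → Fin s → Bool) → Prop) : Prop :=
  ∃ x : Fin s → V, Function.Injective x ∧
    ∃ A B, Str (isolate G x) A B m ∧ Ev (isolate G x) A B (nbrPattern G x)

/-- An atypical attachment of at most three vertices. -/
def Exceptional (G : SimpleGraph V) (m k t : ℕ) : Prop :=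
  Realizes G m 1 (fun H A B p => LowEvent H A B k p ∨ FlatEvent H A B k t p) ∨
  Realizes G m 2 (fun H A B p => PairEvent H A B k p) ∨
  Realizes G m 3 (fun H A B p => (TripleEventA H A B k p ∨ TripleEventB A B k p) ∨
    TripleEventC H A B k p ∨ TripleEventD H A B k t p)

theorem cnt_realizes_le {m k t s : ℕ} (hs : SmallParams (Fintype.card V) m k t)
    (hk : 5 * m + 1 ≤ k) {Ev : SimpleGraph V → Finset V → Finset V → (V → Fin s → Bool) → Prop}
    (hEv : ∀ H A B, Str H A B m →
      (cnt (Ev H A B) : ℝ) ≤ 4 * 2 ^ ((s / 2 - 1 / 2000 : ℝ) * Fintype.card V)) :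
    (cnt (fun G : SimpleGraph V => Tame G ∧ Realizes G m s Ev) : ℝ) ≤
      (Fintype.card V : ℝ) ^ s * (tameCount (Fintype.card V - s) *
        2 ^ ((s / 2 - 1 / 2500 : ℝ) * Fintype.card V)) := by
  set n := Fintype.card V with hn
  have hm1 : (5 * m + 1 : ℝ) ≤ k := by exact_mod_cast hk
  have hkn := hs.k_le
  have hmn : 12 * m + 3 < n := by
    have : (12 * m + 3 : ℝ) < n := by
      have : (0 : ℝ) ≤ m := Nat.cast_nonneg m
      linarith
    exact_mod_cast this
  have hpoly : (64 : ℝ) ≤ 2 ^ ((1 / 100000 : ℝ) * n) := by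
    refine le_trans ?_ hs.poly_le
    have : (1 : ℝ) ≤ ((n : ℝ) + 1) ^ 3 := one_le_pow₀ (by linarith [Nat.cast_nonneg (α := ℝ) n])
    linarith
  have hvol : (vol n (5 * m + 1) : ℝ) ≤ 2 ^ ((1 / 100000 : ℝ) * n) :=
    le_trans (by exact_mod_cast vol_mono le_rfl hk) hs.vol_le
  set y : ℝ := 2 ^ ((1 / 100000 : ℝ) * n) with hy
  have hy0 : 0 < y := by positivity
  have hy4 : (2 : ℝ) ^ ((4 : ℕ) * ((1 / 100000 : ℝ) * n)) = y ^ 4 := by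
    rw [mul_comm, Real.rpow_mul zero_le_two, Real.rpow_natCast]
  have hR : ∀ H : SimpleGraph V, cnt (fun p : V → Fin s → Bool => ∃ A B, Str H A B m ∧ Ev H A B p) ≤
      ⌊(2 : ℝ) ^ ((s / 2 - 1 / 2500 : ℝ) * n)⌋₊ := fun H => by
    refine Nat.le_floor ?_
    have h1 := cnt_le_mul_of_exists_real
      (P := fun p : V → Fin s → Bool => ∃ A B, Str H A B m ∧ Ev H A B p)
      (Q := fun q : Finset V × Finset V => Str H q.1 q.2 m) (R := fun q p => Ev H q.1 q.2 p)
      (K := 4 * 2 ^ ((s / 2 - 1 / 2000 : ℝ) * n)) (by positivity)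
      (fun p ⟨A, B, h⟩ => ⟨(A, B), h⟩) (fun q hq => hEv H q.1 q.2 hq)
    have h2 : (cnt (fun p : Finset V × Finset V => Str H p.1 p.2 m) : ℝ) ≤ 2 * y ^ 3 := by
      refine (Nat.cast_le.2 (cnt_str_le H hmn)).trans ?_
      push_cast
      gcongr
    calc _ ≤ _ := h1
      _ ≤ 2 * y ^ 3 * (4 * 2 ^ ((s / 2 - 1 / 2000 : ℝ) * n)) := by gcongr
      _ = 8 * (y ^ 3 * 2 ^ ((s / 2 - 1 / 2000 : ℝ) * n)) := by ring
      _ ≤ y * (y ^ 3 * 2 ^ ((s / 2 - 1 / 2000 : ℝ) * n)) := by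
        gcongr
        linarith
      _ = 2 ^ ((4 : ℕ) * ((1 / 100000 : ℝ) * n) + (s / 2 - 1 / 2000 : ℝ) * n) := by
        rw [Real.rpow_add two_pos, hy4]
        ring
      _ ≤ _ := by
        refine Real.rpow_le_rpow_of_exponent_le one_le_two ?_
        have : (0 : ℝ) ≤ n := Nat.cast_nonneg n
        push_cast
        linarith
  refine (Nat.cast_le.2 (cnt_extension_le hR)).trans ?_
  push_cast
  rw [← hn]
  gcongr
  exact Nat.floor_le (by positivity)

theorem cast_cnt_or_le {α : Type*} [Finite α] {P Q : α → Prop} {a b : ℝ} (hP : (cnt P : ℝ) ≤ a)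
    (hQ : (cnt Q : ℝ) ≤ b) : (cnt (fun x => P x ∨ Q x) : ℝ) ≤ a + b :=
  (Nat.cast_le.2 (cnt_or_le P Q)).trans (by push_cast; linarith)

theorem cnt_exceptional_le {m k t : ℕ} (hs : SmallParams (Fintype.card V) m k t)
    (hk : 5 * m + 1 ≤ k) :
    (cnt (fun G : SimpleGraph V => Tame G ∧ Exceptional G m k t) : ℝ) ≤
      ∑ s ∈ Finset.Icc 1 3, (Fintype.card V : ℝ) ^ s * (tameCount (Fintype.card V - s) *
        2 ^ ((s / 2 - 1 / 2500 : ℝ) * Fintype.card V)) := by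
  have e1 := cnt_realizes_le hs hk (s := 1)
    (Ev := fun H A B p => LowEvent H A B k p ∨ FlatEvent H A B k t p) (fun H A B h => by
      have := cast_cnt_or_le (cnt_lowEvent_le h hs) (cnt_flatEvent_le h hs)
      have h0 : (0 : ℝ) ≤ 2 ^ ((1 / 2 - 1 / 2000 : ℝ) * Fintype.card V) := by positivity
      rw [Nat.cast_one]
      linarith)
  have e2 := cnt_realizes_le hs hk (s := 2)
    (Ev := fun H A B p => PairEvent H A B k p) (fun H A B h => by
      have := cnt_pairEvent_le h hs
      have h0 : (0 : ℝ) ≤ 2 ^ ((1 - 1 / 2000 : ℝ) * Fintype.card V) := by positivity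
      rw [Nat.cast_ofNat, div_self two_ne_zero]
      linarith)
  have e3 := cnt_realizes_le hs hk (s := 3)
    (Ev := fun H A B p => (TripleEventA H A B k p ∨ TripleEventB A B k p) ∨
      TripleEventC H A B k p ∨ TripleEventD H A B k t p) (fun H A B h => by
      have := cast_cnt_or_le (cast_cnt_or_le (cnt_tripleEventA_le h hs) (cnt_tripleEventB_le h hs))
        (cast_cnt_or_le (cnt_tripleEventC_le h hs) (cnt_tripleEventD_le h hs))
      rw [Nat.cast_ofNat]
      linarith)
  have e := cast_cnt_or_le e1 (cast_cnt_or_le e2 e3)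
  rw [show Finset.Icc 1 3 = {1, 2, 3} from rfl, Finset.sum_insert (by decide),
    Finset.sum_insert (by decide), Finset.sum_singleton]
  refine le_trans (Nat.cast_le.2 (cnt_mono fun G hG => ?_)) e
  rcases hG with ⟨h, h1 | h1 | h1⟩
  · exact Or.inl ⟨h, h1⟩
  · exact Or.inr (Or.inl ⟨h, h1⟩)
  · exact Or.inr (Or.inr ⟨h, h1⟩)

end Exceptional

section Attachment

theorem nbrPattern_apply {V : Type*} {G : SimpleGraph V} {s : ℕ} (x : Fin s → V) (v : V)
    (i : Fin s) : nbrPattern G x v i = decide (G.Adj (x i) v) := rfl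

variable {V : Type*} [Fintype V] {G : SimpleGraph V} {A B : Finset V} {m k t : ℕ}

theorem Str.realizes {s : ℕ} {Ev : SimpleGraph V → Finset V → Finset V → (V → Fin s → Bool) → Prop}
    (h : Str G A B m) (hs : s ≤ 3) {x : Fin s → V} (hx : Function.Injective x)
    (hE : Ev (_root_.isolate G x) (avoiding A x) (avoiding B x) (nbrPattern G x)) :
    Realizes G (m + 6) s Ev :=
  ⟨x, hx, _, _, (h.isolate x).mono (by lia), hE⟩

/-- The number of neighbours in `A`. -/
def nbrIn (G : SimpleGraph V) (A : Finset V) (x : V) : ℕ := cnt fun a => a ∈ A ∧ G.Adj x a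

/-- The number of non-neighbours in `A`. -/
def nonNbrIn (G : SimpleGraph V) (A : Finset V) (x : V) : ℕ := cnt fun a => a ∈ A ∧ ¬G.Adj x a

theorem card_filter_adj_eq (x : V) : (A.filter (G.Adj x)).card = nbrIn G A x := by
  rw [nbrIn, cnt_eq_card_filter]
  congr 1
  ext v
  simp only [Finset.mem_filter, Finset.mem_univ, true_and]

theorem card_filter_not_adj_eq (x : V) : (A.filter fun a => ¬G.Adj x a).card = nonNbrIn G A x := by
  rw [nonNbrIn, cnt_eq_card_filter]
  congr 1
  ext v
  simp only [Finset.mem_filter, Finset.mem_univ, true_and]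

theorem nbrIn_add_nonNbrIn (x : V) : nbrIn G A x + nonNbrIn G A x = A.card := by
  rw [← card_filter_adj_eq, ← card_filter_not_adj_eq]
  exact Finset.card_filter_add_card_filter_not _

theorem cnt_exists_le {ι : Type*} [Fintype ι] {α : Type*} [Finite α] (P : ι → α → Prop) {b : ℕ}
    (h : ∀ i, cnt (P i) ≤ b) : cnt (fun v => ∃ i, P i v) ≤ Fintype.card ι * b := by
  refine (cnt_le_sum Finset.univ P fun v ⟨i, hi⟩ => ⟨i, Finset.mem_univ i, hi⟩).trans ?_
  rw [← Finset.card_univ, ← smul_eq_mul]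
  exact Finset.sum_le_card_nsmul _ _ _ fun i _ => h i

theorem cnt_or_le_of_le {α : Type*} [Finite α] {P Q : α → Prop} {a b c : ℕ} (hP : cnt P ≤ a)
    (hQ : cnt Q ≤ b) (h : a + b ≤ c) : cnt (fun x => P x ∨ Q x) ≤ c :=
  (cnt_or_le P Q).trans (by lia)

theorem Str.nearBlock (hG : Tame G) (h : Str G A B m) {x : V} (h₁ : m < nbrIn G A x)
    (h₂ : m < nonNbrIn G A x) :
    ∃ Q, IsBlock G B Q ∧ cnt (fun v => v ∈ B ∧ ¬(G.Adj x v ↔ v ∈ Q)) ≤ 8 * m + 1 := by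
  rw [← card_filter_adj_eq] at h₁
  rw [← card_filter_not_adj_eq] at h₂
  obtain ⟨Q, hQ, hc⟩ := h.exists_block_near hG h₂ h₁
  exact ⟨Q, hQ, (cnt_le_card_of_mem _ fun v hv => Finset.mem_filter.2 hv).trans hc⟩

theorem Str.exceptional_of_low (hG : Tame G) (h : Str G A B m) (hk : 30 * m + 40 ≤ k)
    (hQ : ∀ Q, IsBlock G B Q → 200 * Q.card ≤ 99 * Fintype.card V) (hA : 2 * m + 1 ≤ A.card)
    {x : V} (hx : nbrIn G A x ≤ m) : Exceptional G (m + 6) k t := by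
  have h1 := nbrIn_add_nonNbrIn (G := G) (A := A) x
  obtain ⟨Q, hQB, hc⟩ := h.exists_block hG (x := x) (by rw [card_filter_not_adj_eq]; lia)
  refine Or.inl (h.realizes (by norm_num) (x := fun _ => x)
    (Function.injective_of_subsingleton _) (Or.inl (LowEvent.isolate ⟨Q, ⟨hQB, hQ Q hQB⟩, ?_⟩ _)))
  have h2 : cnt (fun v => v ∈ B ∧ G.Adj x v ∧ v ∉ Q) ≤ 4 * m :=
    (cnt_le_card_of_mem _ fun v hv => by
      rw [Finset.mem_sdiff, Finset.mem_filter]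
      tauto).trans hc
  refine (cnt_mono fun v hv => ?_).trans (cnt_or_le_of_le hx h2 (by lia))
  simp only [nbrPattern_apply, decide_eq_false_iff_not, Finset.mem_sdiff] at hv
  tauto

theorem Tame.absent_pattern_of_isClique (hG : Tame G) {C : Finset V} (hC : G.IsClique (C : Set V))
    {e : Fin 3 → V} (he : IsPath3 G e) :
    ∃ r : Fin 3 → Bool, ∀ v ∈ C, nbrPattern G e v ≠ r := by
  by_contra hcon
  push Not at hcon
  obtain ⟨a, ha, har⟩ := hcon ![true, false, false]
  obtain ⟨b, hb, hbr⟩ := hcon ![false, false, true]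
  have h1 : ∀ i, G.Adj (e i) a ↔ i = 0 := fun i => by
    have := congrFun har i
    rw [nbrPattern_apply] at this
    fin_cases i <;> simpa using this
  have h2 : ∀ i, G.Adj (e i) b ↔ i = 2 := fun i => by
    have := congrFun hbr i
    rw [nbrPattern_apply] at this
    fin_cases i <;> simpa using this
  obtain ⟨h02, h01, h12, hn⟩ := he
  have hab : a ≠ b := fun hab => by
    have := (h1 0).2 rfl
    rw [hab, h2] at this
    exact absurd this (by decide)
  have n1 : ¬G.Adj (e 1) b := by rw [h2]; decide
  have n2 : ¬G.Adj (e 2) a := by rw [h1]; decide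
  have n3 : ¬G.Adj (e 0) b := by rw [h2]; decide
  have n4 : ¬G.Adj (e 1) a := by rw [h1]; decide
  exact hG.c5 (e 0) (e 1) (e 2) b a h01 h12 ((h2 2).2 rfl) (hC hb ha hab.symm) ((h1 0).2 rfl).symm
    hn n1 n2 (fun h => n3 h.symm) (fun h => n4 h.symm)

theorem Str.exceptional_of_typical_path (hG : Tame G) (h : Str G A B m) (hk : 30 * m + 40 ≤ k)
    {e : Fin 3 → V} (he : IsPath3 G e) (h₁ : ∀ i, m < nbrIn G A (e i))
    (h₂ : ∀ i, m < nonNbrIn G A (e i)) : Exceptional G (m + 6) k t := by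
  choose Q hQ hc using fun i => h.nearBlock hG (h₁ i) (h₂ i)
  obtain ⟨r, hr⟩ := hG.absent_pattern_of_isClique h.clique he
  refine Or.inr (Or.inr (h.realizes le_rfl he.injective
    (Or.inl (Or.inl (TripleEventA.isolate ⟨(Q, r), ⟨hQ, trivial⟩, ?_⟩ _)))))
  refine (cnt_mono fun v hv => ?_).trans
    ((cnt_exists_le (fun i v => v ∈ B ∧ ¬(G.Adj (e i) v ↔ v ∈ Q i)) hc).trans ?_)
  · by_contra hcon
    push Not at hcon
    refine hv ⟨hr v, fun hvB => funext fun i => ?_⟩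
    rw [nbrPattern_apply, decide_eq_decide]
    have := hcon i hvB
    tauto
  · rw [Fintype.card_fin]
    lia

theorem Str.exceptional_of_pair (hG : Tame G) (h : Str G A B m) (hk : 30 * m + 40 ≤ k)
    {e : Fin 2 → V} (he : e 0 ≠ e 1) (h₁ : ∀ i, m < nbrIn G A (e i))
    (h₂ : ∀ i, m < nonNbrIn G A (e i))
    (h₃ : cnt (fun a => a ∈ A ∧ ∀ i, ¬G.Adj (e i) a) ≤ 2 * m) : Exceptional G (m + 6) k t := by
  choose Q hQ hc using fun i => h.nearBlock hG (h₁ i) (h₂ i)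
  refine Or.inr (Or.inl (h.realizes (by norm_num) (injective_pair he)
    (PairEvent.isolate ⟨Q, hQ, ?_⟩ _)))
  refine (cnt_mono fun v hv => ?_).trans (cnt_or_le_of_le h₃
    (cnt_exists_le (fun i v => v ∈ B ∧ ¬(G.Adj (e i) v ↔ v ∈ Q i)) hc) ?_)
  · by_contra hcon
    push Not at hcon
    refine hv ⟨fun hvA hp => ?_, fun hvB => funext fun i => ?_⟩
    · obtain ⟨i, hi⟩ := hcon.1 hvA
      have := congrFun hp i
      rw [nbrPattern_apply] at this
      simp [hi] at this
    · rw [nbrPattern_apply, decide_eq_decide]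
      have := hcon.2 i hvB
      tauto
  · rw [Fintype.card_fin]
    lia

theorem Str.exceptional_of_dominating_copath (hG : Tame G) (h : Str G A B m)
    (hk : 30 * m + 40 ≤ k) (hQ : ∀ Q, IsBlock G B Q → 200 * Q.card ≤ 99 * Fintype.card V)
    {e : Fin 3 → V} (he : Function.Injective e) (h01 : ¬G.Adj (e 0) (e 1))
    (h02 : ¬G.Adj (e 0) (e 2)) (h12 : G.Adj (e 1) (e 2))
    (h₂ : ∀ i, nonNbrIn G A (e i) ≤ m) : Exceptional G (m + 6) k t := by
  refine Or.inr (Or.inr (h.realizes le_rfl he ?_))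
  have hA : cnt (fun v => ∃ i, v ∈ A ∧ ¬G.Adj (e i) v) ≤ 3 * m :=
    cnt_exists_le (fun i v => v ∈ A ∧ ¬G.Adj (e i) v) h₂
  have hA' : ∀ v, (∀ i, ¬(v ∈ A ∧ ¬G.Adj (e i) v)) → v ∈ A → nbrPattern G e v = fun _ => true :=
    fun v hv hvA => funext fun i => by
      rw [nbrPattern_apply, decide_eq_true_eq]
      have := hv i
      tauto
  by_cases hr : ∃ r, r ∈ [![true, true, false], ![true, false, true]] ∧
      ∀ v ∈ B, nbrPattern G e v ≠ r
  · obtain ⟨r, -, hr⟩ := hr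
    refine Or.inl (Or.inr (TripleEventB.avoiding ⟨r, trivial, ?_⟩ _))
    refine (cnt_mono fun v hv => ?_).trans (hA.trans (by lia))
    by_contra hcon
    push Not at hcon
    exact hv ⟨hA' v fun i h => h.2 (hcon i h.1), hr v⟩
  push Not at hr
  obtain ⟨b₁, hb₁, hp₁⟩ := hr ![true, true, false] (by simp)
  obtain ⟨b₂, hb₂, hp₂⟩ := hr ![true, false, true] (by simp)
  have key : ∀ b b', nbrPattern G e b = ![true, true, false] →
      nbrPattern G e b' = ![true, false, true] → G.Adj b b' := by
    intro b b' hb hb'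
    by_contra hn
    have c0 : G.Adj (e 0) b := by simpa [nbrPattern_apply] using congrFun hb 0
    have c1 : G.Adj (e 1) b := by simpa [nbrPattern_apply] using congrFun hb 1
    have c2 : ¬G.Adj (e 2) b := by simpa [nbrPattern_apply] using congrFun hb 2
    have d0 : G.Adj (e 0) b' := by simpa [nbrPattern_apply] using congrFun hb' 0
    have d1 : ¬G.Adj (e 1) b' := by simpa [nbrPattern_apply] using congrFun hb' 1
    have d2 : G.Adj (e 2) b' := by simpa [nbrPattern_apply] using congrFun hb' 2
    exact hG.c5 (e 1) (e 2) b' (e 0) b h12 d2 d0.symm c0 c1.symm d1 (fun h => h02 h.symm)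
      (fun h => hn h.symm) h01 (fun h => c2 h.symm)
  set S : Finset V := B.filter fun v => nbrPattern G e v = ![true, true, false] ∨
    nbrPattern G e v = ![true, false, true] with hS
  have hne : (![true, true, false] : Fin 3 → Bool) ≠ ![true, false, true] := by decide
  have hScl : G.IsClique (S : Set V) := by
    intro u hu v hv huv
    simp only [hS, Finset.coe_filter, Set.mem_ofPred_eq] at hu hv
    rcases hu with ⟨huB, hu | hu⟩ <;> rcases hv with ⟨hvB, hv | hv⟩
    · exact h.cluster u huB b₂ hb₂ v hvB (key _ _ hu hp₂) (key _ _ hv hp₂).symm huv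
    · exact key _ _ hu hv
    · exact (key _ _ hv hu).symm
    · exact h.cluster u huB b₁ hb₁ v hvB (key _ _ hp₁ hu).symm (key _ _ hp₁ hv) huv
  obtain ⟨Q, hQB, hSQ⟩ := exists_isBlock h.cluster (Finset.filter_subset _ _) hScl
  refine Or.inr (Or.inl (TripleEventC.isolate
    ⟨(Q, ![true, true, false], ![true, false, true]), ⟨⟨hQB, hQ Q hQB⟩, hne⟩, ?_⟩ _))
  refine (cnt_mono fun v hv => ?_).trans (hA.trans (by lia))
  by_contra hcon
  push Not at hcon
  refine hv ⟨hA' v fun i h => h.2 (hcon i h.1), fun hvB => ?_⟩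
  rw [Finset.mem_sdiff] at hvB
  refine ⟨fun h => hvB.2 (hSQ ?_), fun h => hvB.2 (hSQ ?_)⟩
  · exact Finset.mem_filter.2 ⟨hvB.1, Or.inl h⟩
  · exact Finset.mem_filter.2 ⟨hvB.1, Or.inr h⟩

theorem Str.nbrIn_or_nonNbrIn_le (hG : Tame G) (h : Str G A B m) {K : Finset V}
    (hK : IsBlock G B K) {x : V} (h₁ : 8 * m + 1 < nbrIn G K x) (h₂ : 8 * m + 1 < nonNbrIn G K x) :
    nbrIn G A x ≤ m ∨ nonNbrIn G A x ≤ m := by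
  by_contra hcon
  push Not at hcon
  obtain ⟨Q, hQ, hc⟩ := h.nearBlock hG hcon.1 hcon.2
  by_cases hQK : Q = K
  · subst hQK
    refine absurd (hc.trans_lt h₂) (not_lt.2 (cnt_mono fun v hv => ⟨hK.subset hv.1, ?_⟩))
    tauto
  · refine absurd (hc.trans_lt h₁) (not_lt.2 (cnt_mono fun v hv => ⟨hK.subset hv.1, ?_⟩))
    have : v ∉ Q := fun hvQ => hQK (hQ.eq_of_mem hK hvQ hv.1)
    tauto

theorem Str.exceptional_of_flat (h : Str G A B m) (hk : 30 * m + 40 ≤ k) (ht : 200 ≤ t)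
    {K : Finset V} (hK : IsBlock G B K) (hKc : 99 * Fintype.card V ≤ 200 * K.card) {x : V}
    (hA : nbrIn G A x ≤ m ∨ nonNbrIn G A x ≤ m)
    (hK' : nbrIn G K x ≤ 8 * m + 1 ∨ nonNbrIn G K x ≤ 8 * m + 1) : Exceptional G (m + 6) k t := by
  have key : ∀ {U : Finset V} {j : ℕ}, nbrIn G U x ≤ j ∨ nonNbrIn G U x ≤ j → ∃ r : Bool,
      cnt (fun v => v ∈ U ∧ nbrPattern G (fun _ : Fin 1 => x) v 0 ≠ r) ≤ j := by
    rintro U j (hU | hU)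
    · exact ⟨false, (cnt_mono fun v hv => ⟨hv.1, by simpa [nbrPattern_apply] using hv.2⟩).trans hU⟩
    · exact ⟨true, (cnt_mono fun v hv => ⟨hv.1, by simpa [nbrPattern_apply] using hv.2⟩).trans hU⟩
  obtain ⟨r, hr⟩ := key hA
  obtain ⟨r', hr'⟩ := key hK'
  have hE := FlatEvent.isolate (G := G) (A := A) (B := B) (k := k) (t := 0)
    (p := nbrPattern G fun _ : Fin 1 => x) ⟨(K, r, r'), ⟨⟨hK, hKc⟩, trivial⟩,
      (cnt_mono fun v hv => by
        simp only [not_and_or, Classical.not_imp] at hv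
        exact hv).trans (cnt_or_le_of_le hr hr' (by lia))⟩ (fun _ : Fin 1 => x)
  refine Or.inl (h.realizes (by norm_num) (x := fun _ => x)
    (Function.injective_of_subsingleton _) (Or.inr ?_))
  obtain ⟨q, ⟨⟨h1, h2⟩, -⟩, h3⟩ := hE
  exact ⟨q, ⟨⟨h1, by lia⟩, trivial⟩, h3⟩

theorem Str.exceptional_of_block_path (hG : Tame G) (h : Str G A B m) (hk : 30 * m + 40 ≤ k)
    (ht : 600 ≤ t) {K : Finset V} (hK : IsBlock G B K)
    (hKc : 99 * Fintype.card V ≤ 200 * K.card) {e : Fin 3 → V} (he : IsPath3 G e)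
    (h₁ : ∀ i, 8 * m + 1 < nbrIn G K (e i)) (h₂ : ∀ i, 8 * m + 1 < nonNbrIn G K (e i)) :
    Exceptional G (m + 6) k t := by
  have key : ∀ i, ∃ r : Bool, cnt (fun v => v ∈ A ∧ nbrPattern G e v i ≠ r) ≤ m := fun i => by
    rcases h.nbrIn_or_nonNbrIn_le hG hK (h₁ i) (h₂ i) with hU | hU
    · exact ⟨false, (cnt_mono fun v hv => ⟨hv.1, by simpa [nbrPattern_apply] using hv.2⟩).trans hU⟩
    · exact ⟨true, (cnt_mono fun v hv => ⟨hv.1, by simpa [nbrPattern_apply] using hv.2⟩).trans hU⟩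
  choose r hr using key
  obtain ⟨r', hr'⟩ := hG.absent_pattern_of_isClique hK.clique he
  have hE := TripleEventD.isolate (G := G) (A := A) (B := B) (k := k) (t := 0)
    (p := nbrPattern G e) ⟨(K, r, r'), ⟨⟨hK, hKc⟩, trivial⟩, (cnt_mono fun v hv => by
        by_contra hcon
        push Not at hcon
        exact hv ⟨fun hvA => funext fun i => hcon i hvA, hr' v⟩).trans
      ((cnt_exists_le (fun i v => v ∈ A ∧ nbrPattern G e v i ≠ r i) hr).trans
        (by rw [Fintype.card_fin]; lia))⟩ e
  refine Or.inr (Or.inr (h.realizes le_rfl he.injective (Or.inr (Or.inr ?_))))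
  obtain ⟨q, ⟨⟨h1, h2⟩, -⟩, h3⟩ := hE
  exact ⟨q, ⟨⟨h1, by lia⟩, trivial⟩, h3⟩

end Attachment

section Bell

variable {W : Type*}

/-- The graph joining distinct vertices with the same value. -/
def kerGraph {X : Type*} (f : W → X) : SimpleGraph W where
  Adj u v := u ≠ v ∧ f u = f v
  symm := ⟨fun _ _ h => ⟨h.1.symm, h.2.symm⟩⟩
  loopless := ⟨fun _ h => h.1 rfl⟩

theorem kerGraph_clusterOn {X : Type*} (f : W → X) (U : Set W) : ClusterOn (kerGraph f) U :=
  fun _ _ _ _ _ _ h h' hne => ⟨hne, h.2.trans h'.2⟩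

theorem ClusterOn.exists_setoid {H : SimpleGraph W} (h : ClusterOn H Set.univ) :
    ∃ s : Setoid W, ∀ u v, s u v ↔ u = v ∨ H.Adj u v := by
  refine ⟨⟨fun u v => u = v ∨ H.Adj u v, fun _ => Or.inl rfl, fun h => h.imp Eq.symm fun h => h.symm,
    ?_⟩, fun u v => Iff.rfl⟩
  rintro u v w (rfl | huv) (rfl | hvw)
  · exact Or.inl rfl
  · exact Or.inr hvw
  · exact Or.inr huv
  · by_cases huw : u = w
    · exact Or.inl huw
    · exact Or.inr (h u trivial v trivial w trivial huv hvw huw)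

/-- Representatives of the classes of a cluster graph can be taken in a given set. -/
theorem ClusterOn.exists_kerGraph {H : SimpleGraph W} (h : ClusterOn H Set.univ) (Q : Set W) :
    ∃ f : W → W, H = kerGraph f ∧ (∀ u, f u = u ∨ H.Adj (f u) u) ∧
      ∀ u v, v ∈ Q → (u = v ∨ H.Adj u v) → f u ∈ Q := by
  obtain ⟨s, hs⟩ := h.exists_setoid
  have hφ : ∀ c : Quotient s, ∃ v, Quotient.mk s v = c ∧
      ((∃ w ∈ Q, Quotient.mk s w = c) → v ∈ Q) := fun c => by
    by_cases hc : ∃ w ∈ Q, Quotient.mk s w = c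
    · obtain ⟨w, hw, rfl⟩ := hc
      exact ⟨w, rfl, fun _ => hw⟩
    · exact ⟨c.out, Quotient.out_eq c, fun h => absurd h hc⟩
  choose φ hφ1 hφ2 using hφ
  have hrep : ∀ u, φ (Quotient.mk s u) = u ∨ H.Adj (φ (Quotient.mk s u)) u := fun u =>
    (hs _ _).1 (Quotient.exact (hφ1 _))
  refine ⟨fun u => φ (Quotient.mk s u), ?_, hrep, fun u v hv huv => hφ2 _ ⟨v, hv, ?_⟩⟩
  · ext u v
    constructor
    · exact fun huv => ⟨huv.ne, congrArg φ (Quotient.sound ((hs u v).2 (Or.inr huv)))⟩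
    · rintro ⟨hne, huv⟩
      have huv : φ (Quotient.mk s u) = φ (Quotient.mk s v) := huv
      have h1 : Quotient.mk s u = Quotient.mk s v := by rw [← hφ1 (Quotient.mk s u), huv, hφ1]
      exact ((hs u v).1 (Quotient.exact h1)).resolve_left hne
  · exact (Quotient.sound ((hs u v).2 huv)).symm

theorem ClusterOn.map {W' : Type*} {H : SimpleGraph W} (h : ClusterOn H Set.univ) (e : W ↪ W') :
    ClusterOn (H.map e) Set.univ := by
  intro x _ y _ z _ hxy hyz hne
  rw [SimpleGraph.map_adj] at hxy hyz ⊢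
  obtain ⟨a, b, hab, rfl, rfl⟩ := hxy
  obtain ⟨b', c, hbc, hb, rfl⟩ := hyz
  obtain rfl := e.injective hb
  exact ⟨a, c, h a trivial _ trivial c trivial hab hbc fun hac => hne (congrArg e hac), rfl, rfl⟩

theorem cnt_clusterOn_mono {W' : Type*} [Finite W'] (e : W ↪ W') :
    cnt (fun H : SimpleGraph W => ClusterOn H Set.univ) ≤
      cnt (fun H : SimpleGraph W' => ClusterOn H Set.univ) :=
  cnt_le_of_injOn (fun H => H.map e) (fun _ h => h.map e)
    fun _ _ _ _ h => SimpleGraph.map_injective e h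

theorem Finpartition.eq_of_part_eq {m : ℕ} {P P' : Finpartition (Finset.univ : Finset (Fin m))}
    (h : ∀ u, P.part u = P'.part u) : P = P' := by
  have key : ∀ {P P' : Finpartition (Finset.univ : Finset (Fin m))},
      (∀ u, P.part u = P'.part u) → P.parts ⊆ P'.parts := by
    intro P P' h t ht
    obtain ⟨a, ha⟩ := P.nonempty_of_mem_parts ht
    rw [← P.part_eq_of_mem ht ha, h]
    exact P'.part_mem.2 (Finset.mem_univ a)
  exact Finpartition.ext ((key h).antisymm (key fun u => (h u).symm))

theorem cnt_clusterOn_fin (m : ℕ) :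
    cnt (fun H : SimpleGraph (Fin m) => ClusterOn H Set.univ) = bell m := by
  refine (Nat.card_congr (Equiv.ofBijective
    (fun P : Finpartition (Finset.univ : Finset (Fin m)) =>
      (⟨kerGraph P.part, kerGraph_clusterOn _ _⟩ :
        {H : SimpleGraph (Fin m) // ClusterOn H Set.univ})) ⟨fun P P' h => ?_, ?_⟩)).symm
  · have h1 : kerGraph P.part = kerGraph P'.part := congrArg Subtype.val h
    refine Finpartition.eq_of_part_eq fun u => ?_
    ext v
    rw [P.mem_part_iff_part_eq_part (Finset.mem_univ v) (Finset.mem_univ u),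
      P'.mem_part_iff_part_eq_part (Finset.mem_univ v) (Finset.mem_univ u)]
    by_cases huv : v = u
    · rw [huv]
      exact iff_of_true rfl rfl
    · have := congrArg (fun H : SimpleGraph (Fin m) => H.Adj v u) h1
      simpa [kerGraph, huv] using this
  · rintro ⟨H, hH⟩
    obtain ⟨s, hs⟩ := hH.exists_setoid
    refine ⟨Finpartition.ofSetoid s, Subtype.ext ?_⟩
    ext u v
    change u ≠ v ∧ (Finpartition.ofSetoid s).part u = (Finpartition.ofSetoid s).part v ↔ _
    rw [← Finpartition.mem_part_iff_part_eq_part _ (Finset.mem_univ u) (Finset.mem_univ v),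
      Finpartition.mem_part_ofSetoid_iff_rel]
    constructor
    · exact fun h => (((hs v u).1 h.2).resolve_left h.1.symm).symm
    · exact fun h => ⟨h.ne, (hs v u).2 (Or.inr h.symm)⟩

theorem cnt_clusterOn [Fintype W] :
    cnt (fun H : SimpleGraph W => ClusterOn H Set.univ) = bell (Fintype.card W) := by
  rw [← cnt_clusterOn_fin]
  exact le_antisymm (cnt_clusterOn_mono (Fintype.equivFin W).toEmbedding)
    (cnt_clusterOn_mono (Fintype.equivFin W).symm.toEmbedding)

theorem bell_mono {m m' : ℕ} (h : m ≤ m') : bell m ≤ bell m' := by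
  rw [← cnt_clusterOn_fin, ← cnt_clusterOn_fin]
  exact cnt_clusterOn_mono (Fin.castLEEmb h)

theorem pow_le_bell (r j : ℕ) : r ^ j ≤ bell (r + j) := by
  have h1 : cnt (fun _ : Fin j → Fin r => True) = r ^ j := by
    rw [cnt_true, Nat.card_fun, Nat.card_fin, Nat.card_fin]
  have h2 := cnt_clusterOn (W := Fin r ⊕ Fin j)
  rw [Fintype.card_sum, Fintype.card_fin, Fintype.card_fin] at h2
  rw [← h1, ← h2]
  refine cnt_le_of_injOn (fun f => kerGraph (Sum.elim id f)) (fun f _ => kerGraph_clusterOn _ _)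
    fun f g _ _ h => funext fun i => ?_
  have := congrArg (fun H : SimpleGraph (Fin r ⊕ Fin j) => H.Adj (Sum.inl (f i)) (Sum.inr i)) h
  simpa [kerGraph, eq_comm] using this

theorem bell_pos (m : ℕ) : 1 ≤ bell m := by
  simpa using pow_le_bell m 0

/-- A cluster graph with a large homogeneous set is determined by few vertices. -/
theorem cnt_kerGraph_le [Fintype W] (b : W → W) (q : ℕ) :
    cnt (fun H : SimpleGraph W => ∃ f : W → W, H = kerGraph f ∧ cnt (fun x => f x ≠ b x) ≤ q) ≤
      (Fintype.card W + 1) ^ (2 * q) := by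
  have hcard : Nat.card (Fin q → Option W × Option W) = (Fintype.card W + 1) ^ (2 * q) := by
    rw [Nat.card_fun, Nat.card_eq_fintype_card, Nat.card_eq_fintype_card, Fintype.card_fin,
      Fintype.card_prod, Fintype.card_option, pow_mul, sq]
  rw [← hcard, ← cnt_true]
  have key : ∀ H : SimpleGraph W, (∃ f : W → W, H = kerGraph f ∧ cnt (fun x => f x ≠ b x) ≤ q) →
      ∃ g : Fin q → Option W × Option W, ∃ f : W → W, H = kerGraph f ∧
        ∀ x y, (f x = y ∧ y ≠ b x) ↔ ∃ i, g i = (some x, some y) ∧ y ≠ b x := by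
    rintro H ⟨f, hf, hc⟩
    rw [cnt_eq_card_filter] at hc
    obtain ⟨g, hg⟩ : ∃ g : Fin q → Option W, ∀ x, f x ≠ b x → ∃ i, g i = some x := by
      set E := Finset.univ.filter fun x => f x ≠ b x with hE
      refine ⟨fun i => if h : i.1 < E.card then some (E.equivFin.symm ⟨i, h⟩).1 else none,
        fun x hx => ?_⟩
      have hxE : x ∈ E := Finset.mem_filter.2 ⟨Finset.mem_univ x, hx⟩
      refine ⟨⟨E.equivFin ⟨x, hxE⟩, (E.equivFin ⟨x, hxE⟩).2.trans_le hc⟩, ?_⟩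
      simp
    refine ⟨fun i => (g i, (g i).map f), f, hf, fun x y => ⟨?_, ?_⟩⟩
    · rintro ⟨rfl, hy⟩
      obtain ⟨i, hi⟩ := hg x hy
      refine ⟨i, ?_, hy⟩
      show (g i, (g i).map f) = _
      rw [hi]
      rfl
    · rintro ⟨i, hi, hy⟩
      rw [Prod.mk.injEq] at hi
      rw [hi.1] at hi
      exact ⟨Option.some.inj hi.2, hy⟩
  choose! g hg using key
  refine cnt_le_of_injOn g (fun _ _ => trivial) fun H H' hH hH' hgg => ?_
  obtain ⟨f, rfl, hf⟩ := hg H hH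
  obtain ⟨f', rfl, hf'⟩ := hg H' hH'
  have hff : f = f' := funext fun x => by
    by_cases h1 : f x = b x
    · by_cases h2 : f' x = b x
      · rw [h1, h2]
      · obtain ⟨i, hi⟩ := (hf' x (f' x)).1 ⟨rfl, h2⟩
        rw [← hgg] at hi
        exact ((hf x (f' x)).2 ⟨i, hi⟩).1
    · obtain ⟨i, hi⟩ := (hf x (f x)).1 ⟨rfl, h1⟩
      rw [hgg] at hi
      exact ((hf' x (f x)).2 ⟨i, hi⟩).1.symm
  rw [hff]

theorem cnt_clusterOn_independent_le [Fintype W] (q : ℕ) :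
    cnt (fun H : SimpleGraph W => ClusterOn H Set.univ ∧ ∃ Q : Finset W,
      (∀ u ∈ Q, ∀ v ∈ Q, ¬H.Adj u v) ∧ Fintype.card W ≤ Q.card + q) ≤
      (Fintype.card W + 1) ^ (2 * q) := by
  refine (cnt_mono fun H hH => ?_).trans (cnt_kerGraph_le id q)
  obtain ⟨hH, Q, hQ, hc⟩ := hH
  obtain ⟨f, hf, h1, h2⟩ := hH.exists_kerGraph (Q : Set W)
  refine ⟨f, hf, (cnt_le_card_of_mem Qᶜ fun x hx => ?_).trans
    (by rw [Finset.card_compl]; lia)⟩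
  rw [Finset.mem_compl]
  intro hxQ
  exact hQ _ (h2 x x hxQ (Or.inl rfl)) _ hxQ ((h1 x).resolve_left hx)

theorem cnt_clusterOn_clique_le [Fintype W] (q : ℕ) :
    cnt (fun H : SimpleGraph W => ClusterOn H Set.univ ∧ ∃ Q : Finset W,
      H.IsClique (Q : Set W) ∧ Fintype.card W ≤ Q.card + q) ≤
      (Fintype.card W + 1) ^ (2 * q + 1) := by
  have h0 : ∀ H : SimpleGraph W, (ClusterOn H Set.univ ∧ ∃ Q : Finset W,
      H.IsClique (Q : Set W) ∧ Fintype.card W ≤ Q.card + q) → ∃ o : Option W, True ∧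
        ∃ f : W → W, H = kerGraph f ∧ cnt (fun x => f x ≠ o.getD x) ≤ q := by
    rintro H ⟨hH, Q, hQ, hc⟩
    obtain ⟨f, hf, h1, h2⟩ := hH.exists_kerGraph (∅ : Set W)
    have hsub : ∀ o : Option W, (∀ x ∈ Q, f x = o.getD x) → cnt (fun x => f x ≠ o.getD x) ≤ q :=
      fun o ho => (cnt_le_card_of_mem Qᶜ fun x hx => Finset.mem_compl.2 fun hxQ => hx (ho x hxQ)).trans
        (by rw [Finset.card_compl]; lia)
    rcases Q.eq_empty_or_nonempty with rfl | ⟨a, ha⟩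
    · exact ⟨none, trivial, f, hf, hsub none (by simp)⟩
    · refine ⟨some (f a), trivial, f, hf, hsub _ fun x hx => ?_⟩
      by_cases hxa : x = a
      · rw [hxa]
        rfl
      · have := hQ hx ha hxa
        rw [hf] at this
        exact this.2
  refine (cnt_le_mul_of_exists ((Fintype.card W + 1) ^ (2 * q)) h0
    fun o _ => cnt_kerGraph_le (fun x => o.getD x) q).trans ?_
  rw [cnt_true, Nat.card_eq_fintype_card, Fintype.card_option, pow_succ, mul_comm]

end Bell

section Split

variable {V : Type*}

/-- The graph induced on a finite set. -/
def restr (G : SimpleGraph V) (U : Finset V) : SimpleGraph {x // x ∈ U} :=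
  G.comap Subtype.val

theorem restr_adj {G : SimpleGraph V} {U : Finset V} {x y : {x // x ∈ U}} :
    (restr G U).Adj x y ↔ G.Adj x.1 y.1 :=
  Iff.rfl

theorem ClusterOn.restr {G : SimpleGraph V} {U : Finset V} (h : ClusterOn G (U : Set V)) :
    ClusterOn (restr G U) Set.univ :=
  fun x _ y _ z _ hxy hyz hne => h x x.2 y y.2 z z.2 hxy hyz fun he => hne (Subtype.ext he)

theorem clusterOn_restr_iff {G : SimpleGraph V} {U : Finset V} :
    ClusterOn (_root_.restr G U) Set.univ ↔ ClusterOn G (U : Set V) :=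
  ⟨fun h x hx y hy z hz hxy hyz hne => h ⟨x, hx⟩ trivial ⟨y, hy⟩ trivial ⟨z, hz⟩ trivial hxy hyz
    fun he => hne (congrArg Subtype.val he), ClusterOn.restr⟩

theorem restr_compl (G : SimpleGraph V) (U : Finset V) : restr Gᶜ U = (restr G U)ᶜ := by
  ext x y
  rw [restr_adj, SimpleGraph.compl_adj, SimpleGraph.compl_adj, restr_adj, ne_eq, ne_eq,
    Subtype.ext_iff]

theorem isClique_restr_iff {G : SimpleGraph V} {U : Finset V} :
    restr G U = ⊤ ↔ G.IsClique (U : Set V) := by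
  constructor
  · intro h x hx y hy hne
    have : (restr G U).Adj ⟨x, hx⟩ ⟨y, hy⟩ := by
      rw [h, SimpleGraph.top_adj]
      exact fun he => hne (congrArg Subtype.val he)
    exact this
  · intro h
    ext x y
    rw [restr_adj, SimpleGraph.top_adj]
    exact ⟨fun hxy he => hxy.ne (congrArg Subtype.val he),
      fun hne => h x.2 y.2 fun he => hne (Subtype.ext he)⟩

variable [Fintype V]

theorem cnt_split {U : Finset V} (S₁ : SimpleGraph {x // x ∈ U} → Prop)
    (S₂ : SimpleGraph {x // x ∈ Uᶜ} → Prop) (X : SimpleGraph V → Prop) (k : ℕ)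
    (hX : ∀ H, S₁ (restr H U) → S₂ (restr H Uᶜ) → X H →
      cnt (fun G : SimpleGraph V => AgreeOff G H U ∧ X G) ≤ k) :
    cnt (fun G : SimpleGraph V => S₁ (restr G U) ∧ S₂ (restr G Uᶜ) ∧ X G) ≤
      cnt S₁ * cnt S₂ * k := by
  rw [← cnt_prod S₁ S₂]
  refine cnt_le_mul (fun G => (restr G U, restr G Uᶜ)) k (fun G h => ⟨h.1, h.2.1⟩)
    fun y _ => ?_
  by_cases h : ∃ H : SimpleGraph V, (S₁ (restr H U) ∧ S₂ (restr H Uᶜ) ∧ X H) ∧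
      (restr H U, restr H Uᶜ) = y
  · obtain ⟨H, hH, rfl⟩ := h
    refine (cnt_mono ?_).trans (hX H hH.1 hH.2.1 hH.2.2)
    rintro G ⟨hG, hGH⟩
    rw [Prod.mk.injEq] at hGH
    refine ⟨fun x y hxy => ?_, hG.2.2⟩
    by_cases hx : x ∈ U
    · exact iff_of_eq (congrArg (fun K : SimpleGraph {x // x ∈ U} =>
        K.Adj ⟨x, hx⟩ ⟨y, hxy.1 hx⟩) hGH.1)
    · have hy : y ∉ U := fun hy => hx (hxy.2 hy)
      exact iff_of_eq (congrArg (fun K : SimpleGraph {x // x ∈ Uᶜ} =>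
        K.Adj ⟨x, Finset.mem_compl.2 hx⟩ ⟨y, Finset.mem_compl.2 hy⟩) hGH.2)
  · rw [cnt, Nat.card_eq_zero.2 (Or.inl ⟨fun G => h ⟨G.1, G.2⟩⟩)]
    exact Nat.zero_le _

theorem cnt_agreeOff_le (H : SimpleGraph V) (U : Finset V) :
    cnt (fun G : SimpleGraph V => AgreeOff G H U) ≤ 2 ^ (U.card * Uᶜ.card) := by
  have h := cnt_agreeOff_avoid H U (∅ : Finset (Fin 0)) (r := 0) (fun _ a => a.elim0)
    (fun _ a => a.elim0) (by simp) (by simp) (by simp)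
  simpa using h

theorem cnt_split_true {U : Finset V} (S₁ : SimpleGraph {x // x ∈ U} → Prop)
    (S₂ : SimpleGraph {x // x ∈ Uᶜ} → Prop) :
    cnt (fun G : SimpleGraph V => S₁ (restr G U) ∧ S₂ (restr G Uᶜ)) ≤
      cnt S₁ * cnt S₂ * 2 ^ (U.card * Uᶜ.card) := by
  refine (cnt_mono ?_).trans (cnt_split S₁ S₂ (fun _ => True) _ fun H _ _ _ =>
    (cnt_mono ?_).trans (cnt_agreeOff_le H U))
  · exact fun G h => ⟨h.1, h.2, trivial⟩
  · exact fun G h => h.1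

/-- Unipolar arrangements with a given central clique. -/
def UniOn (G : SimpleGraph V) (C : Finset V) : Prop :=
  G.IsClique (C : Set V) ∧ ClusterOn G ((Cᶜ : Finset V) : Set V)

theorem isUnipolar_iff {G : SimpleGraph V} : IsUnipolar G ↔ ∃ C, UniOn G C := by
  constructor
  · rintro ⟨C, hC⟩
    rw [isUnipolarArrangement_iff] at hC
    refine ⟨C.toFinset, ?_⟩
    rw [UniOn, Finset.coe_compl, Set.coe_toFinset]
    exact hC
  · rintro ⟨C, hC⟩
    rw [UniOn, Finset.coe_compl] at hC
    exact ⟨C, isUnipolarArrangement_iff.2 hC⟩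

theorem cnt_uniOn_le (C : Finset V) :
    cnt (fun G : SimpleGraph V => UniOn G C) ≤ 2 ^ (C.card * Cᶜ.card) * bell Cᶜ.card := by
  have h := cnt_split_true (U := C) (fun H => H = ⊤) (fun H => ClusterOn H Set.univ)
  rw [cnt_clusterOn, Fintype.card_coe] at h
  have h1 : cnt (fun H : SimpleGraph {x // x ∈ C} => H = ⊤) ≤ 1 :=
    cnt_le_one fun x y hx hy => hx.trans hy.symm
  calc cnt (fun G : SimpleGraph V => UniOn G C)
      ≤ _ := (cnt_mono fun G hG => ⟨isClique_restr_iff.2 hG.1, hG.2.restr⟩)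
    _ ≤ _ := h
    _ ≤ 1 * bell Cᶜ.card * 2 ^ (C.card * Cᶜ.card) := by gcongr
    _ = _ := by ring

/-- Build a graph from a clique, a graph on the complement, and cross edges. -/
def uniGraph (C : Finset V) (H : SimpleGraph {x // x ∈ Cᶜ})
    (f : {x // x ∈ C} × {x // x ∈ Cᶜ} → Bool) : SimpleGraph V where
  Adj x y := (x ≠ y ∧ x ∈ C ∧ y ∈ C) ∨ (∃ hx hy, H.Adj ⟨x, hx⟩ ⟨y, hy⟩) ∨
    (∃ hx hy, f (⟨x, hx⟩, ⟨y, hy⟩) = true) ∨ ∃ hx hy, f (⟨y, hy⟩, ⟨x, hx⟩) = true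
  symm := ⟨by
    rintro x y (⟨h1, h2, h3⟩ | ⟨hx, hy, h⟩ | ⟨hx, hy, h⟩ | ⟨hx, hy, h⟩)
    · exact Or.inl ⟨h1.symm, h3, h2⟩
    · exact Or.inr (Or.inl ⟨hy, hx, h.symm⟩)
    · exact Or.inr (Or.inr (Or.inr ⟨hy, hx, h⟩))
    · exact Or.inr (Or.inr (Or.inl ⟨hy, hx, h⟩))⟩
  loopless := ⟨by
    rintro x (⟨h1, -, -⟩ | ⟨hx, hy, h⟩ | ⟨hx, hy, h⟩ | ⟨hx, hy, h⟩)
    · exact h1 rfl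
    · exact h.ne rfl
    · exact Finset.mem_compl.1 hy hx
    · exact Finset.mem_compl.1 hx hy⟩

theorem restr_uniGraph (C : Finset V) (H : SimpleGraph {x // x ∈ Cᶜ})
    (f : {x // x ∈ C} × {x // x ∈ Cᶜ} → Bool) : restr (uniGraph C H f) Cᶜ = H := by
  ext x y
  have hx := Finset.mem_compl.1 x.2
  have hy := Finset.mem_compl.1 y.2
  rw [restr_adj, uniGraph]
  simp [hx, hy]

theorem uniGraph_cross (C : Finset V) (H : SimpleGraph {x // x ∈ Cᶜ})
    (f : {x // x ∈ C} × {x // x ∈ Cᶜ} → Bool) (a : {x // x ∈ C}) (b : {x // x ∈ Cᶜ}) :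
    (uniGraph C H f).Adj a b ↔ f (a, b) = true := by
  have ha := a.2
  have hb := Finset.mem_compl.1 b.2
  rw [uniGraph]
  simp [ha, hb]

theorem le_cnt_uniOn (C : Finset V) :
    2 ^ (C.card * Cᶜ.card) * bell Cᶜ.card ≤ cnt (fun G : SimpleGraph V => UniOn G C) := by
  have h1 := cnt_clusterOn (W := {x // x ∈ Cᶜ})
  rw [Fintype.card_coe] at h1
  have h2 : cnt (fun _ : {x // x ∈ C} × {x // x ∈ Cᶜ} → Bool => True) =
      2 ^ (C.card * Cᶜ.card) := by
    rw [cnt_true, Nat.card_fun, Nat.card_prod, Nat.card_eq_fintype_card, Nat.card_eq_fintype_card,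
      Nat.card_eq_fintype_card, Fintype.card_coe, Fintype.card_coe, Fintype.card_bool]
  rw [← h1, ← h2, mul_comm, ← cnt_prod]
  refine cnt_le_of_injOn (fun p => uniGraph C p.1 p.2) ?_ ?_
  · rintro ⟨H, f⟩ ⟨hH, -⟩
    refine ⟨fun x hx y hy hne => Or.inl ⟨hne, hx, hy⟩, ?_⟩
    rw [← clusterOn_restr_iff, restr_uniGraph]
    exact hH
  · rintro ⟨H, f⟩ ⟨H', f'⟩ - - h
    have h : uniGraph C H f = uniGraph C H' f' := h
    have hH : H = H' := by rw [← restr_uniGraph C H f, h, restr_uniGraph]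
    have hf : f = f' := funext fun p => by
      have := uniGraph_cross C H f p.1 p.2
      rw [h, uniGraph_cross] at this
      exact (Bool.eq_iff_iff.2 this).symm
    rw [hH, hf]

theorem cnt_uniOn (C : Finset V) :
    cnt (fun G : SimpleGraph V => UniOn G C) = 2 ^ (C.card * Cᶜ.card) * bell Cᶜ.card :=
  le_antisymm (cnt_uniOn_le C) (le_cnt_uniOn C)

theorem sum_cnt_uniOn (k : ℕ) :
    ∑ C ∈ (Finset.univ : Finset V).powersetCard k, cnt (fun G : SimpleGraph V => UniOn G C) =
      ell (Fintype.card V) k := by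
  rw [Finset.sum_congr rfl (g := fun _ => 2 ^ (k * (Fintype.card V - k)) *
    bell (Fintype.card V - k)) fun C hC => ?_, Finset.sum_const, Finset.card_powersetCard,
    Finset.card_univ, ell, smul_eq_mul, mul_assoc]
  rw [cnt_uniOn, Finset.card_compl, (Finset.mem_powersetCard.1 hC).2]

end Split

section Growth

theorem ell_mul_le_succ (n k : ℕ) (h : k ≤ n) : ell n k * 2 ^ k ≤ ell (n + 1) k := by
  have h1 : n + 1 - k = n - k + 1 := by omega
  rw [ell, ell, h1]
  calc n.choose k * 2 ^ (k * (n - k)) * bell (n - k) * 2 ^ k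
      = n.choose k * 2 ^ (k * (n - k + 1)) * bell (n - k) := by rw [mul_add, pow_add]; ring
    _ ≤ (n + 1).choose k * 2 ^ (k * (n - k + 1)) * bell (n - k + 1) := by
        gcongr
        · exact Nat.le_succ n
        · exact bell_mono (Nat.le_succ _)

theorem ell_mul_le_succ_succ (n k : ℕ) (h : k ≤ n) :
    ell n k * 2 ^ (n - k) ≤ ell (n + 1) (k + 1) := by
  have h1 : n + 1 - (k + 1) = n - k := by omega
  rw [ell, ell, h1]
  calc n.choose k * 2 ^ (k * (n - k)) * bell (n - k) * 2 ^ (n - k)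
      = n.choose k * 2 ^ ((k + 1) * (n - k)) * bell (n - k) := by rw [add_mul, one_mul, pow_add]; ring
    _ ≤ (n + 1).choose (k + 1) * 2 ^ ((k + 1) * (n - k)) * bell (n - k) := by
        gcongr
        rw [Nat.choose_succ_succ]
        exact Nat.le_add_right _ _

theorem scrL_growth (n : ℕ) : scrL n * 2 ^ ((n + 1) / 2) ≤ 2 * scrL (n + 1) := by
  have h : ∀ k ∈ Finset.range (n + 1), ell n k * 2 ^ ((n + 1) / 2) ≤
      ell (n + 1) k + ell (n + 1) (k + 1) := fun k hk => by
    have hk := Nat.lt_succ_iff.1 (Finset.mem_range.1 hk)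
    rcases le_total ((n + 1) / 2) k with h | h
    · calc ell n k * 2 ^ ((n + 1) / 2) ≤ ell n k * 2 ^ k := by gcongr; norm_num
        _ ≤ _ := (ell_mul_le_succ n k hk).trans (Nat.le_add_right _ _)
    · rcases eq_or_lt_of_le h with rfl | h
      · exact (ell_mul_le_succ n _ hk).trans (Nat.le_add_right _ _)
      · calc ell n k * 2 ^ ((n + 1) / 2) ≤ ell n k * 2 ^ (n - k) := by
              gcongr
              · norm_num
              · omega
          _ ≤ _ := (ell_mul_le_succ_succ n k hk).trans (Nat.le_add_left _ _)
  rw [scrL, Finset.sum_mul]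
  refine (Finset.sum_le_sum h).trans ?_
  rw [Finset.sum_add_distrib, two_mul, scrL]
  refine add_le_add ?_ ?_
  · rw [Finset.sum_range_succ _ (n + 1)]
    exact Nat.le_add_right _ _
  · rw [Finset.sum_range_succ' _ (n + 1)]
    exact Nat.le_add_right _ _

theorem scrL_growth_iterate (n s : ℕ) :
    (scrL n : ℝ) * 2 ^ ((s : ℝ) * n / 2) ≤ 2 ^ s * scrL (n + s) := by
  induction s with
  | zero => simp
  | succ s ih =>
    have h1 : (scrL (n + s) : ℝ) * 2 ^ ((n + s + 1) / 2) ≤ 2 * scrL (n + s + 1) := by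
      exact_mod_cast scrL_growth (n + s)
    have h2 : (2 : ℝ) ^ ((n : ℝ) / 2) ≤ 2 ^ ((n + s + 1) / 2) := by
      rw [← Real.rpow_natCast]
      refine Real.rpow_le_rpow_of_exponent_le one_le_two ?_
      rw [div_le_iff₀ two_pos]
      have : n ≤ (n + s + 1) / 2 * 2 := by omega
      exact_mod_cast this
    have h3 : ((s + 1 : ℕ) : ℝ) * n / 2 = (s : ℝ) * n / 2 + n / 2 := by push_cast; ring
    rw [h3, Real.rpow_add two_pos, pow_succ]
    calc (scrL n : ℝ) * (2 ^ ((s : ℝ) * n / 2) * 2 ^ ((n : ℝ) / 2))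
        = (scrL n : ℝ) * 2 ^ ((s : ℝ) * n / 2) * 2 ^ ((n : ℝ) / 2) := by ring
      _ ≤ 2 ^ s * scrL (n + s) * 2 ^ ((n + s + 1) / 2) := by gcongr
      _ = 2 ^ s * (scrL (n + s) * 2 ^ ((n + s + 1) / 2)) := by ring
      _ ≤ 2 ^ s * (2 * scrL (n + s + 1)) := by gcongr
      _ = 2 ^ s * 2 * scrL (n + (s + 1)) := by rw [← add_assoc]; ring

theorem ell_le_scrL {n k : ℕ} (h : k ≤ n) : ell n k ≤ scrL n :=
  Finset.single_le_sum (f := fun k => ell n k) (fun _ _ => Nat.zero_le _)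
    (Finset.mem_range.2 (Nat.lt_succ_of_le h))

theorem le_scrL (n : ℕ) : (2 : ℝ) ^ ((n : ℝ) ^ 2 / 4 - 1 / 4) * (n / 4 : ℕ) ^ (n / 4) ≤ scrL n := by
  have h1 : 2 ^ (n / 2 * (n - n / 2)) * (n / 4) ^ (n / 4) ≤ scrL n := by
    refine le_trans ?_ (ell_le_scrL (Nat.div_le_self n 2))
    rw [ell]
    have h2 : (n / 4) ^ (n / 4) ≤ bell (n - n / 2) :=
      (pow_le_bell _ _).trans (bell_mono (by omega))
    have h3 : 1 ≤ n.choose (n / 2) := Nat.choose_pos (Nat.div_le_self n 2)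
    calc 2 ^ (n / 2 * (n - n / 2)) * (n / 4) ^ (n / 4)
        = 1 * 2 ^ (n / 2 * (n - n / 2)) * (n / 4) ^ (n / 4) := by ring
      _ ≤ _ := by gcongr
  refine le_trans ?_ (Nat.cast_le (α := ℝ).2 h1)
  push_cast
  gcongr
  have h0 : ((2 : ℝ) ^ (n / 2 * (n - n / 2))) = 2 ^ ((n / 2 * (n - n / 2) : ℕ) : ℝ) :=
    (Real.rpow_natCast _ _).symm
  rw [h0]
  refine Real.rpow_le_rpow_of_exponent_le one_le_two ?_
  have h4 : n / 2 ≤ n := Nat.div_le_self n 2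
  rw [Nat.cast_mul, Nat.cast_sub h4]
  have h5 : (2 * (n / 2 : ℕ) : ℝ) ≤ n := by exact_mod_cast Nat.mul_div_le n 2
  have h6 : (n : ℝ) ≤ 2 * (n / 2 : ℕ) + 1 := by
    have : n ≤ 2 * (n / 2) + 1 := by omega
    exact_mod_cast this
  nlinarith

end Growth

section Structure

theorem nonNbrIn_le_one {V : Type*} {G : SimpleGraph V} {A : Finset V}
    (hA : G.IsClique (A : Set V)) {x : V} (hx : x ∈ A) :
    nonNbrIn G A x ≤ 1 :=
  cnt_le_one fun a b ha hb => by
    have key : ∀ a, a ∈ A ∧ ¬G.Adj x a → a = x := fun a ha => by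
      by_contra hne
      exact ha.2 (hA hx ha.1 (Ne.symm hne))
    rw [key a ha, key b hb]

variable {V : Type*} [Fintype V] {G : SimpleGraph V} {A B : Finset V} {m k t : ℕ}

/-- A co-cluster set and a cluster complement such that no two-edge matching crosses
between a non-edge and an edge. -/
structure CrossFree (G : SimpleGraph V) (U : Finset V) : Prop where
  cocluster : ClusterOn Gᶜ (U : Set V)
  cluster : ClusterOn G ((Uᶜ : Finset V) : Set V)
  cross : ∀ u ∈ U, ∀ v ∈ U, ∀ x ∉ U, ∀ y ∉ U, u ≠ v → ¬G.Adj u v → G.Adj x y → G.Adj u x →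
    G.Adj v y → ¬G.Adj u y → ¬G.Adj v x → False

theorem CrossFree.compl (h : CrossFree G A) : CrossFree Gᶜ Aᶜ where
  cocluster := by rw [compl_compl]; exact h.cluster
  cluster := by rw [compl_compl]; exact h.cocluster
  cross := by
    intro u hu v hv x hx y hy huv hnuv hxy hux hvy hnuy hnvx
    rw [Finset.mem_compl] at hu hv
    rw [Finset.mem_compl, not_not] at hx hy
    rw [SimpleGraph.compl_adj, not_and, not_not] at hnuv hnuy hnvx
    rw [SimpleGraph.compl_adj] at hxy hux hvy
    exact h.cross x hx y hy v hv u hu hxy.1 hxy.2 (hnuv huv).symm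
      (hnvx fun he => hv (he ▸ hx)).symm (hnuy fun he => hu (he ▸ hy)).symm
      (fun h => hux.2 h.symm) fun h => hvy.2 h.symm

/-- Two cluster graphs, each with a dominating clique. -/
def BiCluster (G : SimpleGraph V) (q : ℕ) (R : Finset V) : Prop :=
  ∃ A K : Finset V, A ⊆ R ∧ K ⊆ Rᶜ ∧ ClusterOn G (R : Set V) ∧
    ClusterOn G ((Rᶜ : Finset V) : Set V) ∧ G.IsClique (A : Set V) ∧ G.IsClique (K : Set V) ∧
    Fintype.card V ≤ A.card + K.card + q

theorem Str.crossFree_or (hG : Tame G) (h : Str G A B m) (hE : ¬Exceptional G (m + 6) k 600)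
    (hk : 30 * m + 40 ≤ k) (hm : 1 ≤ m) (hn : 200 * m + 200 ≤ Fintype.card V) :
    (∃ U, CrossFree G U) ∨ ∃ R, BiCluster G (Fintype.card V / 100) R := by
  have hlow := h.lower
  by_cases hcob : ∀ Q, IsBlock G B Q → 200 * Q.card ≤ 99 * Fintype.card V
  · left
    have h1 : ∀ x, m < nbrIn G A x := fun x => by
      by_contra hcon
      exact hE (h.exceptional_of_low hG hk hcob (by lia) (not_lt.1 hcon))
    set U := Finset.univ.filter fun x => nonNbrIn G A x ≤ m with hU
    have hmem : ∀ x, x ∈ U ↔ nonNbrIn G A x ≤ m := fun x => by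
      rw [hU, Finset.mem_filter, and_iff_right (Finset.mem_univ x)]
    have hnmem : ∀ x, x ∉ U → m < nonNbrIn G A x := fun x hx => by
      rw [hmem] at hx
      exact not_le.1 hx
    refine ⟨U, ?_, ?_, ?_⟩
    · intro x hx y hy z hz hxy hyz hne
      rw [SimpleGraph.compl_adj] at hxy hyz ⊢
      refine ⟨hne, fun hxz => hE (h.exceptional_of_dominating_copath hG hk hcob (e := ![y, x, z])
        ?_ (fun h => hxy.2 h.symm) hyz.2 hxz ?_)⟩
      · have := hxy.1
        have := hyz.1
        intro a b hab
        fin_cases a <;> fin_cases b <;> simp_all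
      · intro i
        fin_cases i
        · exact (hmem y).1 hy
        · exact (hmem x).1 hx
        · exact (hmem z).1 hz
    · intro x hx y hy z hz hxy hyz hne
      by_contra hxz
      refine hE (h.exceptional_of_typical_path hG hk (e := ![x, y, z]) ⟨hne, hxy, hyz, hxz⟩
        (fun i => h1 _) ?_)
      intro i
      fin_cases i
      · exact hnmem x (Finset.mem_compl.1 hx)
      · exact hnmem y (Finset.mem_compl.1 hy)
      · exact hnmem z (Finset.mem_compl.1 hz)
    · intro u hu v hv x hx y hy _ hnuv hxy hux hvy hnuy hnvx
      have h2 : ¬cnt (fun a => a ∈ A ∧ ∀ i, ¬G.Adj ((![x, y] : Fin 2 → V) i) a) ≤ 2 * m :=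
        fun hc => hE (h.exceptional_of_pair hG hk (e := ![x, y]) hxy.ne (fun i => h1 _)
          (fun i => by fin_cases i; exacts [hnmem x hx, hnmem y hy]) hc)
      have h3 : ∃ a, (a ∈ A ∧ ∀ i, ¬G.Adj ((![x, y] : Fin 2 → V) i) a) ∧ G.Adj u a ∧ G.Adj v a := by
        by_contra hcon
        push Not at hcon
        refine h2 ((cnt_mono fun a ha => ?_).trans
          (cnt_or_le_of_le ((hmem u).1 hu) ((hmem v).1 hv) (two_mul m).ge))
        have := hcon a ha
        tauto
      obtain ⟨a, ⟨-, ha⟩, hua, hva⟩ := h3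
      exact hG.c5 a u x y v hua.symm hux hxy hvy.symm hva (fun h => ha 0 h.symm) hnuy
        (fun h => hnvx h.symm) (ha 1) fun h => hnuv h.symm
  · right
    push Not at hcob
    obtain ⟨K, hK, hKc⟩ := hcob
    have hflat := fun x => h.exceptional_of_flat (t := 600) hk (by norm_num) hK hKc.le (x := x)
    set R := Finset.univ.filter fun x => nbrIn G A x ≤ m ∨ nonNbrIn G A x ≤ m with hR
    have hmem : ∀ x, x ∈ R ↔ nbrIn G A x ≤ m ∨ nonNbrIn G A x ≤ m := fun x => by
      rw [hR, Finset.mem_filter, and_iff_right (Finset.mem_univ x)]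
    refine ⟨R, A, K, fun a ha => (hmem a).2 (Or.inr ((nonNbrIn_le_one h.clique ha).trans hm)),
      fun b hb => ?_, ?_, ?_, h.clique, hK.clique, ?_⟩
    · rw [Finset.mem_compl, hmem]
      exact fun hb' => hE (hflat b hb' (Or.inr ((nonNbrIn_le_one hK.clique hb).trans (by lia))))
    · have h2 : ∀ x ∈ R, 8 * m + 1 < nbrIn G K x ∧ 8 * m + 1 < nonNbrIn G K x := fun x hx => by
        by_contra hcon
        rw [not_and_or, not_lt, not_lt] at hcon
        exact hE (hflat x ((hmem x).1 hx) hcon)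
      intro x hx y hy z hz hxy hyz hne
      by_contra hxz
      refine hE (h.exceptional_of_block_path hG hk le_rfl hK hKc.le (e := ![x, y, z])
        ⟨hne, hxy, hyz, hxz⟩ ?_ ?_)
      · intro i
        fin_cases i
        · exact (h2 x hx).1
        · exact (h2 y hy).1
        · exact (h2 z hz).1
      · intro i
        fin_cases i
        · exact (h2 x hx).2
        · exact (h2 y hy).2
        · exact (h2 z hz).2
    · have h2 : ∀ x ∈ Rᶜ, m < nbrIn G A x ∧ m < nonNbrIn G A x := fun x hx => by
        rw [Finset.mem_compl, hmem, not_or, not_le, not_le] at hx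
        exact hx
      intro x hx y hy z hz hxy hyz hne
      by_contra hxz
      refine hE (h.exceptional_of_typical_path hG hk (e := ![x, y, z]) ⟨hne, hxy, hyz, hxz⟩ ?_ ?_)
      · intro i
        fin_cases i
        · exact (h2 x hx).1
        · exact (h2 y hy).1
        · exact (h2 z hz).1
      · intro i
        fin_cases i
        · exact (h2 x hx).2
        · exact (h2 y hy).2
        · exact (h2 z hz).2
    · lia

end Structure

section CrossCount

theorem card_subtype_mem {V : Type*} {A U : Finset V} (h : A ⊆ U) : (A.subtype (· ∈ U)).card = A.card := by
  rw [Finset.card_subtype, Finset.filter_true_of_mem fun x hx => h hx]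

/-- There are `q` disjoint edges in `U`. -/
def EdgeMatching {V : Type*} (G : SimpleGraph V) (U : Finset V) (q : ℕ) : Prop :=
  ∃ M : Finset (Fin 2 → V), DisjFam M ∧ M.card = q ∧ ∀ f ∈ M, G.Adj (f 0) (f 1) ∧ ∀ a, f a ∈ U

theorem edgeMatching_one {V : Type*} {G : SimpleGraph V} {U : Finset V} {x y : V} (hx : x ∈ U) (hy : y ∈ U)
    (h : G.Adj x y) : EdgeMatching G U 1 := by
  refine ⟨{![x, y]}, ⟨?_, ?_⟩, Finset.card_singleton _, ?_⟩
  · simp only [Finset.mem_singleton, forall_eq]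
    exact injective_pair h.ne
  · simp
  · simp only [Finset.mem_singleton, forall_eq]
    exact ⟨h, fun a => by fin_cases a <;> assumption⟩

variable {V : Type*} [Fintype V]

theorem card_mul_card_compl_le (U : Finset V) : U.card * Uᶜ.card ≤ Fintype.card V ^ 2 / 4 := by
  have := four_mul_card_mul_card_compl_le U
  lia

theorem sum_two_pow_mul_bell :
    ∑ U : Finset V, 2 ^ (U.card * Uᶜ.card) * bell Uᶜ.card = scrL (Fintype.card V) := by
  have h := Finset.sum_powerset_apply_card (fun k => 2 ^ (k * (Fintype.card V - k)) *
    bell (Fintype.card V - k)) (x := (Finset.univ : Finset V))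
  rw [Finset.powerset_univ, Finset.card_univ] at h
  simp only [Finset.card_compl]
  rw [h, scrL]
  refine Finset.sum_congr rfl fun k _ => ?_
  rw [ell, smul_eq_mul, mul_assoc]

theorem cnt_exists_finset_le {P : Finset V → SimpleGraph V → Prop} {b : ℕ}
    (h : ∀ U, cnt (P U) ≤ b) :
    cnt (fun G : SimpleGraph V => ∃ U, P U G) ≤ 2 ^ Fintype.card V * b := by
  refine (cnt_exists_le P h).trans_eq ?_
  rw [Fintype.card_finset]

theorem cnt_biCluster_le (q : ℕ) :
    cnt (fun G : SimpleGraph V => ∃ R, BiCluster G q R) ≤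
      2 ^ Fintype.card V * ((Fintype.card V + 1) ^ (4 * q + 2) * 2 ^ (Fintype.card V ^ 2 / 4)) := by
  refine cnt_exists_finset_le fun R => ?_
  have h := cnt_split_true (U := R)
    (fun H => ClusterOn H Set.univ ∧ ∃ Q : Finset {x // x ∈ R},
      H.IsClique (Q : Set {x // x ∈ R}) ∧ Fintype.card {x // x ∈ R} ≤ Q.card + q)
    (fun H => ClusterOn H Set.univ ∧ ∃ Q : Finset {x // x ∈ Rᶜ},
      H.IsClique (Q : Set {x // x ∈ Rᶜ}) ∧ Fintype.card {x // x ∈ Rᶜ} ≤ Q.card + q)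
  have hcl : ∀ {G : SimpleGraph V} {A U : Finset V}, G.IsClique (A : Set V) →
      (restr G U).IsClique (A.subtype (· ∈ U) : Set {x // x ∈ U}) := by
    intro G A U hA x hx y hy hne
    rw [Finset.mem_coe, Finset.mem_subtype] at hx hy
    exact hA hx hy fun he => hne (Subtype.ext he)
  have hR : R.card + Rᶜ.card = Fintype.card V := Finset.card_add_card_compl R
  refine (cnt_mono fun G hG => ?_).trans (h.trans ?_)
  · obtain ⟨A, K, hA, hK, h1, h2, h3, h4, h5⟩ := hG
    have hA' := Finset.card_le_card hA
    have hK' := Finset.card_le_card hK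
    refine ⟨⟨h1.restr, A.subtype (· ∈ R), hcl h3, ?_⟩, h2.restr, K.subtype (· ∈ Rᶜ), hcl h4, ?_⟩
    · rw [card_subtype_mem hA, Fintype.card_coe]
      lia
    · rw [card_subtype_mem hK, Fintype.card_coe]
      lia
  · have h1 := cnt_clusterOn_clique_le (W := {x // x ∈ R}) q
    have h2 := cnt_clusterOn_clique_le (W := {x // x ∈ Rᶜ}) q
    rw [Fintype.card_coe] at h1 h2
    calc _ ≤ (R.card + 1) ^ (2 * q + 1) * (Rᶜ.card + 1) ^ (2 * q + 1) * 2 ^ (R.card * Rᶜ.card) := by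
          rw [Fintype.card_coe, Fintype.card_coe]
          exact Nat.mul_le_mul_right _ (Nat.mul_le_mul h1 h2)
      _ ≤ (Fintype.card V + 1) ^ (2 * q + 1) * (Fintype.card V + 1) ^ (2 * q + 1) *
          2 ^ (Fintype.card V ^ 2 / 4) := by
          gcongr
          · lia
          · lia
          · norm_num
          · exact card_mul_card_compl_le R
      _ = _ := by
          rw [← pow_add]
          congr 2
          ring

/-- A cluster graph that is empty after deleting `q` vertices. -/
def SparseCluster {W : Type*} [Fintype W] (q : ℕ) (H : SimpleGraph W) : Prop :=
  ClusterOn H Set.univ ∧ ∃ Q : Finset W,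
    (∀ u ∈ Q, ∀ v ∈ Q, ¬H.Adj u v) ∧ Fintype.card W ≤ Q.card + q

theorem cnt_sparseCluster_le (U : Finset V) (q : ℕ) :
    cnt (SparseCluster (W := {x // x ∈ U}) q) ≤ (Fintype.card V + 1) ^ (2 * q) := by
  have h := cnt_clusterOn_independent_le (W := {x // x ∈ U}) q
  refine h.trans (Nat.pow_le_pow_left (Nat.succ_le_succ ?_) _)
  rw [Fintype.card_coe]
  exact Finset.card_le_univ U

theorem cnt_sparseCluster_compl_le (U : Finset V) (q : ℕ) :
    cnt (fun H : SimpleGraph {x // x ∈ U} => SparseCluster q Hᶜ) ≤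
      (Fintype.card V + 1) ^ (2 * q) := by
  exact (cnt_equiv (Equiv.mk compl compl (fun _ => compl_compl _) (fun _ => compl_compl _))
    (SparseCluster (W := {x // x ∈ U}) q)).le.trans (cnt_sparseCluster_le U q)

theorem ClusterOn.sparseCluster_restr {V : Type*} {G : SimpleGraph V} {U E : Finset V} {q : ℕ}
    (h : ClusterOn G (U : Set V)) (hE : E.card ≤ q) (hi : ∀ x ∈ U \ E, ∀ y ∈ U \ E, ¬G.Adj x y) :
    SparseCluster q (_root_.restr G U) := by
  refine ⟨h.restr, (U \ E).subtype (· ∈ U), fun u hu v hv => ?_, ?_⟩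
  · rw [Finset.mem_subtype] at hu hv
    exact hi u hu v hv
  · rw [card_subtype_mem Finset.sdiff_subset, Fintype.card_coe]
    have := Finset.le_card_sdiff E U
    lia

theorem ClusterOn.sparseCluster_of_not_edgeMatching {V : Type*} {G : SimpleGraph V} {U : Finset V} {q : ℕ}
    (h : ClusterOn G (U : Set V)) (hM : ¬EdgeMatching G U q) :
    SparseCluster (2 * q) (_root_.restr G U) := by
  obtain ⟨E, hE, hi⟩ := (exists_independent_or_matching G U q).resolve_left hM
  exact h.sparseCluster_restr hE hi

theorem EdgeMatching.card_le {G : SimpleGraph V} {U : Finset V} {q : ℕ}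
    (h : EdgeMatching G U q) : q ≤ Fintype.card V := by
  obtain ⟨M, hM, rfl, -⟩ := h
  rw [← Finset.card_univ]
  refine Finset.card_le_card_of_injOn (fun e => e 0) (fun _ _ => Finset.mem_coe.2 (Finset.mem_univ _))
    fun e he e' he' h => ?_
  by_contra hne
  exact hM.disj e he e' he' hne 0 0 h

theorem cnt_crossFree_sparse_le (q : ℕ) :
    cnt (fun G : SimpleGraph V => ∃ U, CrossFree G U ∧ ¬EdgeMatching Gᶜ U q ∧
      ¬EdgeMatching G Uᶜ q) ≤
      2 ^ Fintype.card V * ((Fintype.card V + 1) ^ (8 * q) * 2 ^ (Fintype.card V ^ 2 / 4)) := by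
  refine cnt_exists_finset_le fun U => ?_
  refine (cnt_mono fun G hG => ?_).trans ((cnt_split_true (U := U)
    (fun H => SparseCluster (2 * q) Hᶜ) (SparseCluster (2 * q))).trans ?_)
  · obtain ⟨h, h1, h2⟩ := hG
    refine ⟨?_, h.cluster.sparseCluster_of_not_edgeMatching h2⟩
    rw [← restr_compl]
    exact h.cocluster.sparseCluster_of_not_edgeMatching h1
  · calc _ ≤ (Fintype.card V + 1) ^ (2 * (2 * q)) * (Fintype.card V + 1) ^ (2 * (2 * q)) *
          2 ^ (Fintype.card V ^ 2 / 4) :=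
          Nat.mul_le_mul (Nat.mul_le_mul (cnt_sparseCluster_compl_le U _)
            (cnt_sparseCluster_le Uᶜ _)) (Nat.pow_le_pow_right two_pos (card_mul_card_compl_le U))
      _ = _ := by
          rw [← pow_add]
          congr 2
          ring

theorem exists_maximal_edgeMatching {G : SimpleGraph V} {U : Finset V}
    (h : EdgeMatching G U 1) : ∃ t ∈ Finset.Icc 1 (Fintype.card V),
      EdgeMatching G U t ∧ ¬EdgeMatching G U (t + 1) := by
  by_contra hcon
  push Not at hcon
  have : ∀ t, EdgeMatching G U (t + 1) := fun t => by
    induction t with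
    | zero => exact h
    | succ t ih => exact hcon (t + 1) (Finset.mem_Icc.2 ⟨by lia, ih.card_le⟩) ih
  have := (this (Fintype.card V)).card_le
  lia

theorem cnt_crossFree_matching_le (U : Finset V) (t q : ℕ) :
    (cnt (fun G : SimpleGraph V => CrossFree G U ∧ EdgeMatching Gᶜ U t ∧
      ¬EdgeMatching Gᶜ U (t + 1) ∧ EdgeMatching G Uᶜ q) : ℝ) ≤
      ((Fintype.card V + 1) ^ (4 * t + 4) * 2 ^ (-((t * q : ℕ) : ℝ) / 64)) *
        (2 ^ (U.card * Uᶜ.card) * bell Uᶜ.card : ℕ) := by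
  set k := ⌊(2 : ℝ) ^ (((U.card * Uᶜ.card : ℕ) : ℝ) - ((t * q : ℕ) : ℝ) / 64)⌋₊ with hk
  have hkle : (k : ℝ) ≤ 2 ^ (((U.card * Uᶜ.card : ℕ) : ℝ) - ((t * q : ℕ) : ℝ) / 64) :=
    Nat.floor_le (by positivity)
  have h1 := cnt_split (U := U) (fun H => SparseCluster (2 * (t + 1)) Hᶜ)
    (fun H => ClusterOn H Set.univ) (fun G => CrossFree G U ∧ EdgeMatching Gᶜ U t ∧
      EdgeMatching G Uᶜ q) k ?_
  · have h2 : cnt (fun G : SimpleGraph V => CrossFree G U ∧ EdgeMatching Gᶜ U t ∧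
        ¬EdgeMatching Gᶜ U (t + 1) ∧ EdgeMatching G Uᶜ q) ≤
        (Fintype.card V + 1) ^ (2 * (2 * (t + 1))) * bell Uᶜ.card * k := by
      refine (cnt_mono fun G hG => ?_).trans (h1.trans (Nat.mul_le_mul_right _ (Nat.mul_le_mul
        (cnt_sparseCluster_compl_le U _) ?_)))
      · obtain ⟨h, h1, h2, h3⟩ := hG
        refine ⟨?_, h.cluster.restr, h, h1, h3⟩
        rw [← restr_compl]
        exact h.cocluster.sparseCluster_of_not_edgeMatching h2
      · rw [cnt_clusterOn, Fintype.card_coe]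
    refine (Nat.cast_le.2 h2).trans ?_
    rw [sub_eq_add_neg, Real.rpow_add two_pos, Real.rpow_natCast, ← neg_div] at hkle
    rw [show 2 * (2 * (t + 1)) = 4 * t + 4 by ring]
    push_cast at hkle ⊢
    calc ((Fintype.card V : ℝ) + 1) ^ (4 * t + 4) * bell Uᶜ.card * k
        ≤ ((Fintype.card V : ℝ) + 1) ^ (4 * t + 4) * bell Uᶜ.card * (2 ^ (U.card * Uᶜ.card) *
          2 ^ (-((t : ℝ) * q) / 64)) := by gcongr
      _ = _ := by ring
  · rintro H - - ⟨hH, ⟨P, hP, hPc, hPH⟩, M, hM, hMc, hMH⟩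
    rw [hk]
    refine Nat.le_floor ?_
    have h2 := cnt_agreeOff_avoid_product H U hP hM (fun e he => (hPH e he).2)
      (fun e he a => Finset.mem_compl.1 ((hMH e he).2 a)) (fun a b => decide (a = b)) (by norm_num)
    rw [hPc, hMc] at h2
    refine (Nat.cast_le.2 (cnt_mono ?_)).trans h2
    rintro G ⟨hGH, hG, -⟩
    refine ⟨hGH, fun e he f hf => ?_⟩
    by_contra hcon
    push Not at hcon
    have he' := hPH e he
    have hf' := hMH f hf
    rw [SimpleGraph.compl_adj, ← hGH _ _ (iff_of_true (he'.2 0) (he'.2 1))] at he'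
    rw [← hGH _ _ (iff_of_false (Finset.mem_compl.1 (hf'.2 0)) (Finset.mem_compl.1 (hf'.2 1)))] at hf'
    have h00 := hcon 0 0
    have h01 := hcon 0 1
    have h10 := hcon 1 0
    have h11 := hcon 1 1
    simp only [decide_eq_true_eq] at h00 h01 h10 h11
    exact hG.cross _ (he'.2 0) _ (he'.2 1) _ (Finset.mem_compl.1 (hf'.2 0)) _
      (Finset.mem_compl.1 (hf'.2 1)) he'.1.1 he'.1.2 hf'.1 (h00.2 trivial) (h11.2 trivial)
      (fun h => absurd (h01.1 h) (by norm_num)) fun h => absurd (h10.1 h) (by norm_num)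

theorem cnt_crossFree_dense_le (q : ℕ) {ε : ℝ} (hε : ε ≤ 1)
    (hq : ((Fintype.card V : ℝ) + 1) ^ 8 * 2 ^ (-(q : ℝ) / 64) ≤ ε) :
    (cnt (fun G : SimpleGraph V => ∃ U, CrossFree G U ∧ EdgeMatching Gᶜ U 1 ∧
      EdgeMatching G Uᶜ q) : ℝ) ≤ Fintype.card V * ε * scrL (Fintype.card V) := by
  have h1 := cnt_le_sum (Finset.univ ×ˢ Finset.Icc 1 (Fintype.card V))
    (P := fun G : SimpleGraph V => ∃ U, CrossFree G U ∧ EdgeMatching Gᶜ U 1 ∧ EdgeMatching G Uᶜ q)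
    (fun i G => CrossFree G i.1 ∧ EdgeMatching Gᶜ i.1 i.2 ∧ ¬EdgeMatching Gᶜ i.1 (i.2 + 1) ∧
      EdgeMatching G i.1ᶜ q) ?_
  · refine (Nat.cast_le.2 h1).trans ?_
    rw [Finset.sum_product]
    push_cast
    rw [← sum_two_pow_mul_bell (V := V)]
    push_cast
    rw [Finset.mul_sum]
    refine Finset.sum_le_sum fun U _ => ?_
    rw [mul_assoc, ← nsmul_eq_mul]
    conv_rhs => rw [show Fintype.card V = (Finset.Icc 1 (Fintype.card V)).card by simp]
    refine Finset.sum_le_card_nsmul _ _ _ fun t ht => ?_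
    rw [Finset.mem_Icc] at ht
    refine (cnt_crossFree_matching_le U t q).trans ?_
    push_cast
    gcongr
    have h0 : (0 : ℝ) ≤ ((Fintype.card V : ℝ) + 1) ^ 8 * 2 ^ (-(q : ℝ) / 64) := by positivity
    calc ((Fintype.card V : ℝ) + 1) ^ (4 * t + 4) * 2 ^ (-((t : ℝ) * q) / 64)
        ≤ ((Fintype.card V : ℝ) + 1) ^ (8 * t) * 2 ^ (-((t : ℝ) * q) / 64) := by
          gcongr
          · linarith [Nat.cast_nonneg (α := ℝ) (Fintype.card V)]
          · lia
      _ = (((Fintype.card V : ℝ) + 1) ^ 8 * 2 ^ (-(q : ℝ) / 64)) ^ t := by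
          rw [mul_pow, ← pow_mul, ← Real.rpow_natCast (2 ^ _), ← Real.rpow_mul two_pos.le]
          congr 2
          ring
      _ ≤ (((Fintype.card V : ℝ) + 1) ^ 8 * 2 ^ (-(q : ℝ) / 64)) ^ 1 :=
          pow_le_pow_of_le_one h0 (hq.trans hε) ht.1
      _ ≤ ε := by rwa [pow_one]
  · rintro G ⟨U, hU, h1, h2⟩
    obtain ⟨t, ht, h3, h4⟩ := exists_maximal_edgeMatching h1
    exact ⟨(U, t), Finset.mem_product.2 ⟨Finset.mem_univ _, ht⟩, hU, h3, h4, h2⟩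

theorem CrossFree.isGenSplit_or {G : SimpleGraph V} {U : Finset V} (h : CrossFree G U) (q : ℕ) :
    IsGenSplit G ∨ (¬EdgeMatching Gᶜ U q ∧ ¬EdgeMatching G Uᶜ q) ∨
      (EdgeMatching Gᶜ U 1 ∧ EdgeMatching G Uᶜ q) ∨
      (EdgeMatching Gᶜᶜ Uᶜ 1 ∧ EdgeMatching Gᶜ Uᶜᶜ q) := by
  have h1 : ¬EdgeMatching Gᶜ U 1 → IsGenSplit G := fun h1 => by
    refine Or.inl (isUnipolar_iff.2 ⟨U, fun x hx y hy hne => ?_, h.cluster⟩)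
    by_contra hxy
    exact h1 (edgeMatching_one hx hy ⟨hne, hxy⟩)
  have h2 : ¬EdgeMatching G Uᶜ 1 → IsGenSplit G := fun h2 => by
    refine Or.inr (isUnipolar_iff.2 ⟨Uᶜ, fun x hx y hy hne => ?_, ?_⟩)
    · exact ⟨hne, fun hxy => h2 (edgeMatching_one hx hy hxy)⟩
    · rw [compl_compl]
      exact h.cocluster
  rw [compl_compl, compl_compl]
  tauto

end CrossCount

section Asymptotics

theorem eventually_mul_pow_le {ε : ℝ} (hε : 0 < ε) (C : ℝ) (d : ℕ) :
    ∀ᶠ n : ℕ in atTop, C * ((n : ℝ) + 1) ^ d ≤ 2 ^ (ε * n) := by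
  have h1 : (1 : ℝ) < 2 ^ ε := Real.one_lt_rpow one_lt_two hε
  have h2 := (isLittleO_pow_const_const_pow_of_one_lt (R := ℝ) d h1).bound
    (show 0 < 1 / ((|C| + 1) * 2 ^ d) by positivity)
  filter_upwards [h2, eventually_ge_atTop 1] with n hn hn1
  have h3 : ((n : ℝ) + 1) ^ d ≤ 2 ^ d * (n : ℝ) ^ d := by
    rw [← mul_pow]
    have : (1 : ℝ) ≤ n := by exact_mod_cast hn1
    gcongr
    linarith
  rw [Real.norm_of_nonneg (by positivity), Real.norm_of_nonneg (by positivity), one_div,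
    inv_mul_eq_div, le_div_iff₀ (by positivity)] at hn
  rw [Real.rpow_mul two_pos.le, Real.rpow_natCast]
  calc C * ((n : ℝ) + 1) ^ d ≤ (|C| + 1) * (2 ^ d * (n : ℝ) ^ d) := by
        gcongr
        linarith [le_abs_self C]
    _ = (n : ℝ) ^ d * ((|C| + 1) * 2 ^ d) := by ring
    _ ≤ _ := hn

theorem two_pow_mul_pow_le {n : ℕ} (hn : 2 ^ 27 ≤ n) :
    2 ^ (2 * n + 1) * (n + 1) ^ (n / 25 + 2) ≤ (n / 4) ^ (n / 4) := by
  set r := n / 4 with hr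
  set a := n / 25 + 2 with ha
  have hra : a ≤ r := by lia
  have h24 : 2 ^ 24 ≤ r := by lia
  calc 2 ^ (2 * n + 1) * (n + 1) ^ a ≤ 2 ^ (2 * n + 1) * (2 ^ 3 * r) ^ a := by
        gcongr
        lia
    _ = 2 ^ (2 * n + 1 + 3 * a) * r ^ a := by rw [mul_pow, ← pow_mul, pow_add _ _ (3 * a)]; ring
    _ ≤ 2 ^ (24 * (r - a)) * r ^ a := by
        gcongr
        · norm_num
        · lia
    _ = (2 ^ 24) ^ (r - a) * r ^ a := by rw [← pow_mul]
    _ ≤ r ^ (r - a) * r ^ a := by gcongr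
    _ = r ^ r := by rw [← pow_add, Nat.sub_add_cancel hra]

theorem eventually_sparse_le : ∀ᶠ n : ℕ in atTop,
    (2 : ℝ) ^ n * (((n : ℝ) + 1) ^ (n / 25 + 2) * 2 ^ (n ^ 2 / 4)) ≤ 2 ^ (-(n : ℝ)) * scrL n := by
  filter_upwards [eventually_ge_atTop (2 ^ 27)] with n hn
  have h1 : (2 : ℝ) ^ (2 * n + 1) * ((n : ℝ) + 1) ^ (n / 25 + 2) ≤ (n / 4 : ℕ) ^ (n / 4) := by
    exact_mod_cast two_pow_mul_pow_le hn
  have h2 := le_scrL n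
  have h3 : (2 : ℝ) ^ (n ^ 2 / 4) ≤ 2 * 2 ^ ((n : ℝ) ^ 2 / 4 - 1 / 4) := by
    rw [← Real.rpow_natCast, ← Real.rpow_one_add' two_pos.le (by nlinarith [Nat.cast_nonneg (α := ℝ) n])]
    refine Real.rpow_le_rpow_of_exponent_le one_le_two ?_
    have : ((n ^ 2 / 4 : ℕ) : ℝ) ≤ ((n ^ 2 : ℕ) : ℝ) / 4 := Nat.cast_div_le
    push_cast at this
    linarith
  rw [Real.rpow_neg two_pos.le, Real.rpow_natCast, inv_mul_eq_div, le_div_iff₀ (by positivity)]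
  calc (2 : ℝ) ^ n * (((n : ℝ) + 1) ^ (n / 25 + 2) * 2 ^ (n ^ 2 / 4)) * 2 ^ n
      ≤ (2 : ℝ) ^ n * (((n : ℝ) + 1) ^ (n / 25 + 2) * (2 * 2 ^ ((n : ℝ) ^ 2 / 4 - 1 / 4))) * 2 ^ n := by
        gcongr
    _ = 2 ^ ((n : ℝ) ^ 2 / 4 - 1 / 4) * (2 ^ (2 * n + 1) * ((n : ℝ) + 1) ^ (n / 25 + 2)) := by
        rw [two_mul n, pow_add, pow_add]
        ring
    _ ≤ 2 ^ ((n : ℝ) ^ 2 / 4 - 1 / 4) * (n / 4 : ℕ) ^ (n / 4) := by gcongr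
    _ ≤ scrL n := h2

theorem eventually_approx_le {c : ℝ} (hc : 0 < c) : ∀ᶠ n : ℕ in atTop,
    (2 : ℝ) ^ ((n : ℝ) ^ 2 / 4 - c * n ^ 2) ≤ 2 ^ (-(n : ℝ)) * scrL n := by
  obtain ⟨n₀, hn₀⟩ := exists_nat_ge (2 / c)
  filter_upwards [eventually_ge_atTop (max n₀ (2 ^ 27))] with n hn
  have h1 : (n₀ : ℝ) ≤ n := by exact_mod_cast (le_max_left _ _).trans hn
  have h2 : 2 ≤ c * n := by
    rw [div_le_iff₀ hc] at hn₀
    nlinarith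
  have h3 : (1 : ℝ) ≤ n := by exact_mod_cast (by norm_num : 1 ≤ 2 ^ 27).trans ((le_max_right _ _).trans hn)
  have h4 : 1 ≤ n / 4 := by
    have := (le_max_right _ _).trans hn
    lia
  have h5 : (1 : ℝ) ≤ (n / 4 : ℕ) ^ (n / 4) := by exact_mod_cast Nat.one_le_pow _ _ h4
  calc (2 : ℝ) ^ ((n : ℝ) ^ 2 / 4 - c * n ^ 2) ≤ 2 ^ (-(n : ℝ) + ((n : ℝ) ^ 2 / 4 - 1 / 4)) := by
        refine Real.rpow_le_rpow_of_exponent_le one_le_two ?_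
        nlinarith
    _ = 2 ^ (-(n : ℝ)) * (2 ^ ((n : ℝ) ^ 2 / 4 - 1 / 4) * 1) := by rw [Real.rpow_add two_pos, mul_one]
    _ ≤ 2 ^ (-(n : ℝ)) * (2 ^ ((n : ℝ) ^ 2 / 4 - 1 / 4) * (n / 4 : ℕ) ^ (n / 4)) := by gcongr
    _ ≤ _ := by
        gcongr
        exact le_scrL n

theorem eventually_matching_le : ∀ᶠ n : ℕ in atTop,
    ((n : ℝ) + 1) ^ 8 * 2 ^ (-((n / 200 : ℕ) : ℝ) / 64) ≤ 2 ^ (-(1 / 25600 : ℝ) * n) := by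
  filter_upwards [eventually_mul_pow_le (show (0 : ℝ) < 1 / 25600 by norm_num) 2 8] with n hn
  have h1 : (n : ℝ) / 200 - 1 ≤ (n / 200 : ℕ) := by
    have : n ≤ 200 * (n / 200) + 200 := by lia
    have : (n : ℝ) ≤ 200 * (n / 200 : ℕ) + 200 := by exact_mod_cast this
    linarith
  calc ((n : ℝ) + 1) ^ 8 * 2 ^ (-((n / 200 : ℕ) : ℝ) / 64)
      ≤ (2 ^ ((1 / 25600 : ℝ) * n) / 2) * 2 ^ (1 + -(1 / 12800 : ℝ) * n) := by
        gcongr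
        · linarith
        · exact one_le_two
        · linarith
    _ = 2 ^ ((1 / 25600 : ℝ) * n) * 2 ^ (-(1 / 12800 : ℝ) * n) := by
        rw [Real.rpow_add two_pos, Real.rpow_one]
        ring
    _ = 2 ^ (-(1 / 25600 : ℝ) * n) := by
        rw [← Real.rpow_add two_pos]
        congr 1
        ring

theorem exists_smallParams : ∃ δ : ℝ, 0 < δ ∧ δ ≤ 1 / 4 ∧ ∀ᶠ n : ℕ in atTop,
    SmallParams n (⌊δ * n⌋₊ + 6) (30 * ⌊δ * n⌋₊ + 40) 600 ∧ 1 ≤ ⌊δ * n⌋₊ ∧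
      200 * ⌊δ * n⌋₊ + 200 ≤ n := by
  obtain ⟨μ, hμ, hvol⟩ := exists_vol_le (show (0 : ℝ) < 1 / 100000 by norm_num)
  set δ : ℝ := min (μ / 60) (1 / 1000000000) with hδ
  have hδ0 : 0 < δ := lt_min (by positivity) (by norm_num)
  have hδ1 : δ ≤ μ / 60 := min_le_left _ _
  have hδ2 : δ ≤ 1 / 1000000000 := min_le_right _ _
  refine ⟨δ, hδ0, hδ2.trans (by norm_num), ?_⟩
  obtain ⟨n₁, hn₁⟩ := exists_nat_ge (1 / δ)
  obtain ⟨n₂, hn₂⟩ := exists_nat_ge (80 / μ)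
  filter_upwards [eventually_mul_pow_le (show (0 : ℝ) < 1 / 100000 by norm_num) 64 3,
    eventually_ge_atTop n₁, eventually_ge_atTop n₂, eventually_ge_atTop (10 ^ 9)] with n h1 h2 h3 h4
  have h2 : (1 : ℝ) ≤ δ * n := by
    rw [div_le_iff₀ hδ0] at hn₁
    have : (n₁ : ℝ) ≤ n := by exact_mod_cast h2
    nlinarith
  have h3 : (80 : ℝ) ≤ μ * n := by
    rw [div_le_iff₀ hμ] at hn₂
    have : (n₂ : ℝ) ≤ n := by exact_mod_cast h3
    nlinarith
  have h4 : (10 : ℝ) ^ 9 ≤ n := by exact_mod_cast h4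
  have h5 : (⌊δ * n⌋₊ : ℝ) ≤ δ * n := Nat.floor_le (by positivity)
  have h6 : δ * n ≤ 1 / 1000000000 * n := by gcongr
  have h7 : δ * n ≤ μ / 60 * n := by gcongr
  refine ⟨⟨hvol _ _ ?_, ?_, ?_, ?_, h1⟩, Nat.le_floor (by simpa using h2), ?_⟩
  · push_cast
    linarith
  · push_cast
    linarith
  · push_cast
    linarith
  · push_cast
    linarith
  · have : (200 * ⌊δ * n⌋₊ + 200 : ℝ) ≤ n := by linarith
    exact_mod_cast this

end Asymptotics

section Induction

theorem eventually_exceptional_sum_le : ∀ᶠ n : ℕ in atTop, ∀ K : ℝ, 0 ≤ K →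
    (∀ j < n, (tameCount j : ℝ) ≤ K * scrL j) →
    ∑ s ∈ Finset.Icc 1 3, (n : ℝ) ^ s * (tameCount (n - s) *
      2 ^ ((s / 2 - 1 / 2500 : ℝ) * n)) ≤ K * 2 ^ (-(1 / 5000 : ℝ) * n) * scrL n := by
  filter_upwards [eventually_mul_pow_le (show (0 : ℝ) < 1 / 5000 by norm_num) 1024 3,
    eventually_ge_atTop 4] with n hn hn4 K hK hj
  have key : ∀ s ∈ Finset.Icc 1 3, (n : ℝ) ^ s * (tameCount (n - s) *
      2 ^ ((s / 2 - 1 / 2500 : ℝ) * n)) ≤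
      ((n : ℝ) + 1) ^ 3 * 256 * K * 2 ^ (-(1 / 2500 : ℝ) * n) * scrL n := fun s hs => by
    rw [Finset.mem_Icc] at hs
    have h1 := scrL_growth_iterate (n - s) s
    rw [Nat.sub_add_cancel (by lia), Nat.cast_sub (by lia)] at h1
    have h2 : (2 : ℝ) ^ ((s / 2 - 1 / 2500 : ℝ) * n) ≤
        2 ^ ((s : ℝ) * (n - s) / 2) * 2 ^ (5 : ℝ) * 2 ^ (-(1 / 2500 : ℝ) * n) := by
      rw [← Real.rpow_add two_pos, ← Real.rpow_add two_pos]
      refine Real.rpow_le_rpow_of_exponent_le one_le_two ?_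
      have : (s : ℝ) ≤ 3 := by exact_mod_cast hs.2
      nlinarith [Nat.cast_nonneg (α := ℝ) s]
    have h3 : (n : ℝ) ^ s ≤ ((n : ℝ) + 1) ^ 3 :=
      (pow_le_pow_left₀ (Nat.cast_nonneg n) (by linarith) s).trans
        (pow_le_pow_right₀ (by linarith [Nat.cast_nonneg (α := ℝ) n]) hs.2)
    have h4 : (2 : ℝ) ^ s ≤ 2 ^ 3 := pow_le_pow_right₀ one_le_two hs.2
    calc (n : ℝ) ^ s * (tameCount (n - s) * 2 ^ ((s / 2 - 1 / 2500 : ℝ) * n))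
        ≤ ((n : ℝ) + 1) ^ 3 * ((K * scrL (n - s)) *
          (2 ^ ((s : ℝ) * (n - s) / 2) * 2 ^ (5 : ℝ) * 2 ^ (-(1 / 2500 : ℝ) * n))) := by
          gcongr
          exact hj _ (by lia)
      _ = ((n : ℝ) + 1) ^ 3 * K * 2 ^ (5 : ℝ) * 2 ^ (-(1 / 2500 : ℝ) * n) *
          (scrL (n - s) * 2 ^ ((s : ℝ) * (n - s) / 2)) := by ring
      _ ≤ ((n : ℝ) + 1) ^ 3 * K * 2 ^ (5 : ℝ) * 2 ^ (-(1 / 2500 : ℝ) * n) *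
          (2 ^ 3 * scrL n) := by
          exact mul_le_mul_of_nonneg_left
            (h1.trans (mul_le_mul_of_nonneg_right h4 (Nat.cast_nonneg _))) (by positivity)
      _ = _ := by
          rw [show (2 : ℝ) ^ (5 : ℝ) = 32 by norm_num]
          ring
  refine (Finset.sum_le_card_nsmul _ _ _ key).trans ?_
  have h5 : (2 : ℝ) ^ (-(1 / 5000 : ℝ) * n) = 2 ^ ((1 / 5000 : ℝ) * n) * 2 ^ (-(1 / 2500 : ℝ) * n) := by
    rw [← Real.rpow_add two_pos]
    congr 1
    ring
  rw [h5, Nat.card_Icc, nsmul_eq_mul]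
  push_cast
  calc _ = (768 * ((n : ℝ) + 1) ^ 3) * (K * 2 ^ (-(1 / 2500 : ℝ) * n) * scrL n) := by ring
    _ ≤ 2 ^ ((1 / 5000 : ℝ) * n) * (K * 2 ^ (-(1 / 2500 : ℝ) * n) * scrL n) := by
        gcongr
        refine le_trans ?_ hn
        gcongr
        norm_num
    _ = _ := by ring

end Induction

section Induction

theorem isGenSplit_compl {V : Type*} {G : SimpleGraph V} : IsGenSplit Gᶜ ↔ IsGenSplit G := by
  unfold IsGenSplit IsCoUnipolar
  rw [compl_compl, or_comm]

theorem cnt_compl {V : Type*} [Finite V] (P : SimpleGraph V → Prop) :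
    cnt (fun G => P Gᶜ) = cnt P :=
  cnt_equiv (Equiv.mk compl compl (fun _ => compl_compl _) (fun _ => compl_compl _)) P

/-- Under the inductive hypothesis on smaller tame graphs, structured tame graphs which are not
generalised split are rare. -/
theorem cnt_str_not_isGenSplit_le {V : Type*} [Fintype V] {n m : ℕ} {K : ℝ}
    (hV : Fintype.card V = n)
    (hs : SmallParams n (m + 6) (30 * m + 40) 600) (hm : 1 ≤ m) (hn : 200 * m + 200 ≤ n)
    (h1 : (2 : ℝ) ^ n * (((n : ℝ) + 1) ^ (n / 25 + 2) * 2 ^ (n ^ 2 / 4)) ≤ 2 ^ (-(n : ℝ)) * scrL n)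
    (h2 : ((n : ℝ) + 1) ^ 8 * 2 ^ (-((n / 200 : ℕ) : ℝ) / 64) ≤ 2 ^ (-(1 / 25600 : ℝ) * n))
    (h3 : ∑ s ∈ Finset.Icc 1 3, (n : ℝ) ^ s * (tameCount (n - s) *
      2 ^ ((s / 2 - 1 / 2500 : ℝ) * n)) ≤ K * 2 ^ (-(1 / 5000 : ℝ) * n) * scrL n) :
    (cnt (fun G : SimpleGraph V => (Tame G ∧ ∃ A B, Str G A B m) ∧ ¬IsGenSplit G) : ℝ) ≤
      K * 2 ^ (-(1 / 5000 : ℝ) * n) * scrL n + (2 ^ (-(n : ℝ)) * scrL n + (2 ^ (-(n : ℝ)) * scrL n +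
        (n * 2 ^ (-(1 / 25600 : ℝ) * n) * scrL n + n * 2 ^ (-(1 / 25600 : ℝ) * n) * scrL n))) := by
  have hε : (2 : ℝ) ^ (-(1 / 25600 : ℝ) * n) ≤ 1 :=
    Real.rpow_le_one_of_one_le_of_nonpos one_le_two (by nlinarith [Nat.cast_nonneg (α := ℝ) n])
  have e1 := cnt_exceptional_le (V := V) (m := m + 6) (k := 30 * m + 40) (t := 600)
    (by rwa [hV]) (by lia)
  have e2 := cnt_biCluster_le (V := V) (n / 100)
  have e3 := cnt_crossFree_sparse_le (V := V) (n / 200)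
  have e4 := cnt_crossFree_dense_le (V := V) (n / 200) hε (by rwa [hV])
  have e5 := (cnt_compl (fun G : SimpleGraph V =>
    ∃ U, CrossFree G U ∧ EdgeMatching Gᶜ U 1 ∧ EdgeMatching G Uᶜ (n / 200))).le
  have e5 := (Nat.cast_le (α := ℝ)).2 e5 |>.trans e4
  rw [hV] at e1 e2 e3 e4 e5
  have e2' : (cnt (fun G : SimpleGraph V => ∃ R, BiCluster G (n / 100) R) : ℝ) ≤
      2 ^ (-(n : ℝ)) * scrL n := by
    refine le_trans ?_ h1
    refine (Nat.cast_le.2 e2).trans ?_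
    push_cast
    gcongr
    · linarith [Nat.cast_nonneg (α := ℝ) n]
    · lia
  have e3' : (cnt (fun G : SimpleGraph V => ∃ U, CrossFree G U ∧
      ¬EdgeMatching Gᶜ U (n / 200) ∧ ¬EdgeMatching G Uᶜ (n / 200)) : ℝ) ≤
      2 ^ (-(n : ℝ)) * scrL n := by
    refine le_trans ?_ h1
    refine (Nat.cast_le.2 e3).trans ?_
    push_cast
    gcongr
    · linarith [Nat.cast_nonneg (α := ℝ) n]
    · lia
  have e := cast_cnt_or_le (e1.trans h3) (cast_cnt_or_le e2' (cast_cnt_or_le e3'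
    (cast_cnt_or_le e4 e5)))
  refine le_trans (Nat.cast_le.2 (cnt_mono fun G hG => ?_)) e
  obtain ⟨⟨hG, A, B, h⟩, hgs⟩ := hG
  by_cases hE : Exceptional G (m + 6) (30 * m + 40) 600
  · exact Or.inl ⟨hG, hE⟩
  right
  obtain ⟨U, hU⟩ | hR := h.crossFree_or hG hE le_rfl hm (by rwa [hV])
  · right
    obtain h | h | h | h := hU.isGenSplit_or (n / 200)
    · exact absurd h hgs
    · exact Or.inl ⟨U, hU, h⟩
    · exact Or.inr (Or.inl ⟨U, hU, h⟩)
    · exact Or.inr (Or.inr ⟨Uᶜ, hU.compl, h⟩)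
  · rw [hV] at hR
    exact Or.inl hR

theorem eventually_cnt_not_isGenSplit_le : ∀ᶠ n : ℕ in atTop, ∀ K : ℝ, 1 ≤ K →
    (∀ j < n, (tameCount j : ℝ) ≤ K * scrL j) →
    (cnt (fun G : SimpleGraph (Fin n) => Tame G ∧ ¬IsGenSplit G) : ℝ) ≤
      K * 2 ^ (-(1 / 51200 : ℝ) * n) * scrL n := by
  obtain ⟨δ, hδ, hδ1, hsp⟩ := exists_smallParams
  obtain ⟨c, hc, n₀, hstr⟩ := cnt_tame_not_str_le hδ hδ1
  filter_upwards [hsp, eventually_ge_atTop n₀, eventually_approx_le hc, eventually_sparse_le,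
    eventually_matching_le, eventually_exceptional_sum_le,
    eventually_mul_pow_le (show (0 : ℝ) < 1 / 51200 by norm_num) 7 1]
    with n ⟨hs, hm, hn⟩ hn0 h1 h2 h3 h4 h5 K hK hj
  have b1 := (hstr n hn0).trans h1
  have b2 := cnt_str_not_isGenSplit_le (Fintype.card_fin n) hs hm hn h2 h3 (h4 K (by linarith) hj)
  have b3 := (Nat.cast_le (α := ℝ)).2 (cnt_compl (fun G : SimpleGraph (Fin n) =>
    (Tame G ∧ ∃ A B, Str G A B ⌊δ * n⌋₊) ∧ ¬IsGenSplit G)).le |>.trans b2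
  have b := cast_cnt_or_le b1 (cast_cnt_or_le b2 b3)
  have hx : ∀ a : ℝ, 1 / 25600 ≤ a → (2 : ℝ) ^ (-a * n) ≤ 2 ^ (-(1 / 25600 : ℝ) * n) :=
    fun a ha => Real.rpow_le_rpow_of_exponent_le one_le_two
      (by nlinarith [Nat.cast_nonneg (α := ℝ) n])
  have x1 := hx 1 (by norm_num)
  rw [neg_one_mul] at x1
  have x2 := hx (1 / 5000) (by norm_num)
  refine le_trans (Nat.cast_le.2 (cnt_mono fun G hG => ?_)) (b.trans ?_)
  · by_cases h : ∃ A B, Str G A B ⌊δ * n⌋₊ ∨ Str Gᶜ A B ⌊δ * n⌋₊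
    · obtain ⟨A, B, h | h⟩ := h
      · exact Or.inr (Or.inl ⟨⟨hG.1, A, B, h⟩, hG.2⟩)
      · exact Or.inr (Or.inr ⟨⟨hG.1.compl, A, B, h⟩, fun h' => hG.2 (isGenSplit_compl.1 h')⟩)
    · exact Or.inl ⟨hG.1, h⟩
  · have hL : (0 : ℝ) ≤ scrL n := Nat.cast_nonneg _
    set ε := (2 : ℝ) ^ (-(1 / 25600 : ℝ) * n) with hε
    have hε0 : 0 ≤ ε := by positivity
    have x3 : 7 * ((n : ℝ) + 1) * ε ≤ 2 ^ (-(1 / 51200 : ℝ) * n) := by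
      rw [pow_one] at h5
      calc 7 * ((n : ℝ) + 1) * ε ≤ 2 ^ ((1 / 51200 : ℝ) * n) * ε := by gcongr
        _ = _ := by
          rw [hε, ← Real.rpow_add two_pos]
          congr 1
          ring
    have hn0 : (0 : ℝ) ≤ n := Nat.cast_nonneg _
    calc _ ≤ ε * scrL n + ((K * ε * scrL n + (ε * scrL n + (ε * scrL n + (n * ε * scrL n +
          n * ε * scrL n)))) + (K * ε * scrL n + (ε * scrL n + (ε * scrL n + (n * ε * scrL n +
          n * ε * scrL n))))) := by gcongr
      _ = ((5 + 4 * n) * 1 + 2 * K) * (ε * scrL n) := by ring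
      _ ≤ ((5 + 4 * n) * K + 2 * K) * (ε * scrL n) := by gcongr
      _ ≤ (K * (7 * (n + 1))) * (ε * scrL n) := by
        gcongr
        nlinarith
      _ = K * (7 * (n + 1) * ε) * scrL n := by ring
      _ ≤ _ := by gcongr

theorem cnt_isUnipolar_le (n : ℕ) : cnt (fun G : SimpleGraph (Fin n) => IsUnipolar G) ≤ scrL n := by
  refine (cnt_le_sum (Finset.univ : Finset (Finset (Fin n))) (fun C G => UniOn G C)
    fun G hG => ?_).trans_eq ?_
  · obtain ⟨C, hC⟩ := isUnipolar_iff.1 hG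
    exact ⟨C, Finset.mem_univ _, hC⟩
  · rw [Finset.sum_congr rfl fun C _ => cnt_uniOn C, sum_two_pow_mul_bell, Fintype.card_fin]

theorem cnt_isGenSplit_le (n : ℕ) :
    cnt (fun G : SimpleGraph (Fin n) => IsGenSplit G) ≤ 2 * scrL n := by
  refine (cnt_or_le _ _).trans ?_
  have h := cnt_isUnipolar_le n
  have h' := (cnt_compl (fun G : SimpleGraph (Fin n) => IsUnipolar G)).le
  unfold IsCoUnipolar
  lia

theorem one_le_scrL (n : ℕ) : 1 ≤ scrL n := by
  refine le_trans ?_ (ell_le_scrL le_rfl)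
  unfold ell
  rw [Nat.choose_self, Nat.sub_self, mul_zero, pow_zero, one_mul, one_mul]
  exact bell_pos _

/-- Up to a constant factor, there are as many tame graphs as unipolar arrangements. -/
theorem exists_tameCount_le : ∃ K : ℝ, 1 ≤ K ∧ ∀ n, (tameCount n : ℝ) ≤ K * scrL n := by
  have h1 : ∀ᶠ n : ℕ in atTop, (2 : ℝ) ^ (-(1 / 51200 : ℝ) * n) ≤ 1 / 2 := by
    filter_upwards [eventually_ge_atTop 51200] with n hn
    rw [show (1 / 2 : ℝ) = 2 ^ (-1 : ℝ) by rw [Real.rpow_neg_one]; norm_num]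
    refine Real.rpow_le_rpow_of_exponent_le one_le_two ?_
    have : (51200 : ℝ) ≤ n := by exact_mod_cast hn
    linarith
  obtain ⟨n₀, hn₀⟩ := eventually_atTop.1 (eventually_cnt_not_isGenSplit_le.and h1)
  set K : ℝ := 4 + ∑ j ∈ Finset.range n₀, (tameCount j : ℝ) with hK
  have hsum : (0 : ℝ) ≤ ∑ j ∈ Finset.range n₀, (tameCount j : ℝ) := by positivity
  refine ⟨K, by linarith, fun n => ?_⟩
  induction n using Nat.strong_induction_on with
  | h n ih =>
    have hL : (1 : ℝ) ≤ scrL n := by exact_mod_cast one_le_scrL n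
    by_cases hn : n < n₀
    · have := Finset.single_le_sum (f := fun j => (tameCount j : ℝ)) (fun j _ => Nat.cast_nonneg _)
        (Finset.mem_range.2 hn)
      have : (tameCount n : ℝ) ≤ K := by
        rw [hK]
        linarith
      nlinarith
    · obtain ⟨h2, h3⟩ := hn₀ n (not_lt.1 hn)
      have h4 := h2 K (by linarith) ih
      have h5 : (cnt (fun G : SimpleGraph (Fin n) => IsGenSplit G) : ℝ) ≤ 2 * scrL n := by
        exact_mod_cast cnt_isGenSplit_le n
      have h6 := cast_cnt_or_le h5 h4
      refine le_trans (Nat.cast_le.2 (cnt_mono fun G hG => ?_)) (h6.trans ?_)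
      · by_cases h : IsGenSplit G
        · exact Or.inl h
        · exact Or.inr ⟨hG, h⟩
      · have h7 : K * 2 ^ (-(1 / 51200 : ℝ) * n) * scrL n ≤ K * (1 / 2) * scrL n := by
          have : 0 ≤ K := by linarith
          gcongr
        nlinarith

/-- Almost all tame graphs are generalised split graphs. -/
theorem eventually_cnt_tame_not_isGenSplit_le : ∀ᶠ n : ℕ in atTop,
    (cnt (fun G : SimpleGraph (Fin n) => Tame G ∧ ¬IsGenSplit G) : ℝ) ≤
      2 ^ (-(1 / 102400 : ℝ) * n) * scrL n := by
  obtain ⟨K, hK, h⟩ := exists_tameCount_le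
  filter_upwards [eventually_cnt_not_isGenSplit_le,
    eventually_mul_pow_le (show (0 : ℝ) < 1 / 102400 by norm_num) K 0] with n h1 h2
  refine (h1 K hK fun j _ => h j).trans ?_
  rw [pow_zero, mul_one] at h2
  refine mul_le_mul_of_nonneg_right ?_ (Nat.cast_nonneg _)
  calc K * 2 ^ (-(1 / 51200 : ℝ) * n) ≤
        2 ^ ((1 / 102400 : ℝ) * n) * 2 ^ (-(1 / 51200 : ℝ) * n) := by gcongr
    _ = _ := by
      rw [← Real.rpow_add two_pos]
      congr 1
      ring

end Induction

section GoodArrangement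

/-- A unipolar arrangement whose central clique is the unique clique of at least its size, and
exceeds the independence number. -/
def GoodArr {V : Type*} [Fintype V] (G : SimpleGraph V) (C : Finset V) : Prop :=
  UniOn G C ∧ (∀ Q : Finset V, G.IsClique (Q : Set V) → C.card ≤ Q.card → Q = C) ∧
    ∀ Q : Finset V, (∀ u ∈ Q, ∀ v ∈ Q, ¬G.Adj u v) → Q.card < C.card

variable {V : Type*} [Fintype V]

theorem cnt_uniOn_complete_le {C S T : Finset V} (hS : S ⊆ Cᶜ) (hT : T ⊆ C) :
    cnt (fun G : SimpleGraph V => UniOn G C ∧ ∀ s ∈ S, ∀ t ∈ T, G.Adj t s) * 2 ^ (T.card * S.card) ≤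
      cnt (fun G : SimpleGraph V => UniOn G C) := by
  have hle : T.card * S.card ≤ C.card * Cᶜ.card :=
    Nat.mul_le_mul (Finset.card_le_card hT) (Finset.card_le_card hS)
  have h := cnt_split (U := C) (fun H => H = ⊤) (fun H => ClusterOn H Set.univ)
    (fun G => ∀ s ∈ S, ∀ t ∈ T, G.Adj t s) (2 ^ (C.card * Cᶜ.card - T.card * S.card))
    fun H _ _ _ => ?_
  · have h1 : cnt (fun H : SimpleGraph {x // x ∈ C} => H = ⊤) ≤ 1 :=
      cnt_le_one fun x y hx hy => hx.trans hy.symm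
    rw [cnt_clusterOn, Fintype.card_coe] at h
    have h2 : cnt (fun G : SimpleGraph V => UniOn G C ∧ ∀ s ∈ S, ∀ t ∈ T, G.Adj t s) ≤
        bell Cᶜ.card * 2 ^ (C.card * Cᶜ.card - T.card * S.card) := by
      refine (cnt_mono fun G hG => ?_).trans (h.trans (Nat.mul_le_mul_right _
        ((Nat.mul_le_mul_right _ h1).trans_eq (one_mul _))))
      exact ⟨isClique_restr_iff.2 hG.1.1, hG.1.2.restr, hG.2⟩
    rw [cnt_uniOn]
    refine (Nat.mul_le_mul_right _ h2).trans_eq ?_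
    rw [mul_assoc, ← pow_add, Nat.sub_add_cancel hle, mul_comm]
  · have h1 := cnt_agreeOff_avoid H C (T ×ˢ S) (r := 1) (fun i _ => i) (fun _ _ => false) ?_ ?_ ?_
    · rw [Finset.card_product, pow_one, show 2 - 1 = 1 from rfl, one_pow, mul_one] at h1
      refine Nat.le_of_mul_le_mul_right ?_ (pow_pos two_pos (T.card * S.card))
      rw [← pow_add, Nat.sub_add_cancel hle]
      refine (Nat.mul_le_mul_right _ (cnt_mono fun G hG => ?_)).trans h1
      refine ⟨hG.1, fun i hi => ⟨0, ?_⟩⟩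
      rw [Finset.mem_product] at hi
      simpa using hG.2 _ hi.2 _ hi.1
    · intro i hi _
      rw [Finset.mem_product] at hi
      exact ⟨hT hi.1, Finset.mem_compl.1 (hS hi.2)⟩
    · exact fun _ _ a b _ => Subsingleton.elim a b
    · exact fun i _ j _ hne _ _ => hne

theorem UniOn.bad_cases {G : SimpleGraph V} {C : Finset V} (h : UniOn G C) (hG : ¬GoodArr G C)
    (a b : ℕ) :
    SparseCluster (Cᶜ.card + 1 - C.card) (restr G Cᶜ) ∨
    (∃ Q : Finset {x // x ∈ Cᶜ}, (restr G Cᶜ).IsClique (Q : Set {x // x ∈ Cᶜ}) ∧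
      Fintype.card {x // x ∈ Cᶜ} ≤ Q.card + (Cᶜ.card + b - C.card)) ∨
    (∃ v ∈ Cᶜ, ∃ E : Finset V, E.card ≤ a ∧ ∀ t ∈ C \ E, G.Adj t v) ∨
    ∃ S ⊆ Cᶜ, ∃ T ⊆ C, a < S.card ∧ b < T.card ∧ ∀ s ∈ S, ∀ t ∈ T, G.Adj t s := by
  by_cases hind : ∃ Q : Finset V, (∀ u ∈ Q, ∀ v ∈ Q, ¬G.Adj u v) ∧ C.card ≤ Q.card
  · left
    obtain ⟨Q, hQ, hc⟩ := hind
    have h1 : (Q ∩ C).card ≤ 1 := Finset.card_le_one.2 fun x hx y hy => by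
      rw [Finset.mem_inter] at hx hy
      by_contra hne
      exact hQ x hx.1 y hy.1 (h.1 hx.2 hy.2 hne)
    have h2 := Finset.card_inter_add_card_sdiff Q C
    have h3 : Q \ C ⊆ Cᶜ := fun x hx => Finset.mem_compl.2 (Finset.mem_sdiff.1 hx).2
    refine h.2.sparseCluster_restr (E := Cᶜ \ (Q \ C)) ?_ fun x hx y hy => ?_
    · rw [Finset.card_sdiff_of_subset h3]
      lia
    · rw [Finset.sdiff_sdiff_eq_self h3, Finset.mem_sdiff] at hx hy
      exact hQ x hx.1 y hy.1
  right
  have hQ : ∃ Q : Finset V, G.IsClique (Q : Set V) ∧ C.card ≤ Q.card ∧ Q ≠ C := by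
    by_contra hcon
    push Not at hcon hind
    exact hG ⟨h, hcon, hind⟩
  obtain ⟨Q, hQ, hc, hne⟩ := hQ
  set S := Q \ C with hS
  set T := Q ∩ C with hT
  have h2 : T.card + S.card = Q.card := Finset.card_inter_add_card_sdiff Q C
  have h3 : S ⊆ Cᶜ := fun x hx => Finset.mem_compl.2 (Finset.mem_sdiff.1 hx).2
  have h4 : T ⊆ C := Finset.inter_subset_right
  have hadj : ∀ s ∈ S, ∀ t ∈ T, G.Adj t s := fun s hs t ht => by
    rw [hS, Finset.mem_sdiff] at hs
    rw [hT, Finset.mem_inter] at ht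
    exact hQ ht.1 hs.1 fun he => hs.2 (he ▸ ht.2)
  by_cases hSa : a < S.card
  · by_cases hTb : b < T.card
    · exact Or.inr (Or.inr ⟨S, h3, T, h4, hSa, hTb, hadj⟩)
    · left
      refine ⟨S.subtype (· ∈ Cᶜ), fun x hx y hy hxy => ?_, ?_⟩
      · rw [Finset.mem_coe, Finset.mem_subtype, hS, Finset.mem_sdiff] at hx hy
        exact hQ hx.1 hy.1 fun he => hxy (Subtype.ext he)
      · rw [card_subtype_mem h3, Fintype.card_coe]
        lia
  · right
    left
    have hne : S.Nonempty := by
      rw [Finset.nonempty_iff_ne_empty]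
      intro he
      have h5 : Q ⊆ C := Finset.sdiff_eq_empty_iff_subset.1 he
      exact hne (Finset.eq_of_subset_of_card_le h5 hc)
    obtain ⟨v, hv⟩ := hne
    refine ⟨v, h3 hv, C \ T, ?_, fun t ht => hadj v hv t ?_⟩
    · rw [Finset.card_sdiff_of_subset h4]
      lia
    · rwa [Finset.sdiff_sdiff_eq_self h4] at ht

theorem cnt_sparseCluster_uniOn_le (C : Finset V) (q : ℕ) :
    cnt (fun G : SimpleGraph V => UniOn G C ∧ SparseCluster q (restr G Cᶜ)) ≤
      (Fintype.card V + 1) ^ (2 * q) * 2 ^ (Fintype.card V ^ 2 / 4) := by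
  have h := cnt_split_true (U := C) (fun H => H = ⊤) (SparseCluster q)
  have h1 : cnt (fun H : SimpleGraph {x // x ∈ C} => H = ⊤) ≤ 1 :=
    cnt_le_one fun x y hx hy => hx.trans hy.symm
  refine (cnt_mono fun G hG => ?_).trans (h.trans (Nat.mul_le_mul ?_ ?_))
  · exact ⟨isClique_restr_iff.2 hG.1.1, hG.2⟩
  · exact (Nat.mul_le_mul h1 (cnt_sparseCluster_le Cᶜ q)).trans_eq (one_mul _)
  · exact Nat.pow_le_pow_right two_pos (card_mul_card_compl_le C)

theorem cnt_cliqueCore_uniOn_le (C : Finset V) (q : ℕ) :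
    cnt (fun G : SimpleGraph V => UniOn G C ∧
      ∃ Q : Finset {x // x ∈ Cᶜ}, (restr G Cᶜ).IsClique (Q : Set {x // x ∈ Cᶜ}) ∧
        Fintype.card {x // x ∈ Cᶜ} ≤ Q.card + q) ≤
      (Fintype.card V + 1) ^ (2 * q + 1) * 2 ^ (Fintype.card V ^ 2 / 4) := by
  have h := cnt_split_true (U := C) (fun H => H = ⊤) (fun H => ClusterOn H Set.univ ∧
    ∃ Q : Finset {x // x ∈ Cᶜ}, H.IsClique (Q : Set {x // x ∈ Cᶜ}) ∧
      Fintype.card {x // x ∈ Cᶜ} ≤ Q.card + q)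
  have h1 : cnt (fun H : SimpleGraph {x // x ∈ C} => H = ⊤) ≤ 1 :=
    cnt_le_one fun x y hx hy => hx.trans hy.symm
  have h2 := cnt_clusterOn_clique_le (W := {x // x ∈ Cᶜ}) q
  have h3 : Fintype.card {x // x ∈ Cᶜ} + 1 ≤ Fintype.card V + 1 := by
    rw [Fintype.card_coe]
    exact Nat.succ_le_succ (Finset.card_le_univ _)
  refine (cnt_mono fun G hG => ?_).trans (h.trans (Nat.mul_le_mul ?_ ?_))
  · exact ⟨isClique_restr_iff.2 hG.1.1, hG.1.2.restr, hG.2⟩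
  · exact (Nat.mul_le_mul h1 (h2.trans (Nat.pow_le_pow_left h3 _))).trans_eq (one_mul _)
  · exact Nat.pow_le_pow_right two_pos (card_mul_card_compl_le C)

theorem cnt_vertex_uniOn_le (C : Finset V) (a : ℕ) :
    cnt (fun G : SimpleGraph V => UniOn G C ∧
      ∃ v ∈ Cᶜ, ∃ E : Finset V, E.card ≤ a ∧ ∀ t ∈ C \ E, G.Adj t v) * 2 ^ (C.card - a) ≤
      Fintype.card V * vol (Fintype.card V) a * cnt (fun G : SimpleGraph V => UniOn G C) := by
  have h1 := cnt_le_sum (Cᶜ ×ˢ (Finset.univ.filter fun E : Finset V => E.card ≤ a))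
    (P := fun G : SimpleGraph V => UniOn G C ∧
      ∃ v ∈ Cᶜ, ∃ E : Finset V, E.card ≤ a ∧ ∀ t ∈ C \ E, G.Adj t v)
    (fun i G => UniOn G C ∧ ∀ s ∈ ({i.1} : Finset V), ∀ t ∈ C \ i.2, G.Adj t s) ?_
  · refine (Nat.mul_le_mul_right _ h1).trans ?_
    rw [Finset.sum_mul]
    refine (Finset.sum_le_card_nsmul _ _ (cnt (fun G : SimpleGraph V => UniOn G C))
      fun i hi => ?_).trans ?_
    · rw [Finset.mem_product, Finset.mem_filter] at hi
      have h2 := cnt_uniOn_complete_le (C := C) (S := {i.1}) (T := C \ i.2)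
        (Finset.singleton_subset_iff.2 hi.1) Finset.sdiff_subset
      refine (Nat.mul_le_mul_left _ (Nat.pow_le_pow_right two_pos ?_)).trans h2
      rw [Finset.card_singleton, mul_one]
      have := Finset.le_card_sdiff i.2 C
      lia
    · rw [smul_eq_mul, Finset.card_product, ← cnt_eq_card_filter, cnt_card_le]
      exact Nat.mul_le_mul_right _ (Nat.mul_le_mul_right _ (Finset.card_le_univ _))
  · rintro G ⟨hG, v, hv, E, hE, h⟩
    refine ⟨(v, E), ?_, hG, ?_⟩
    · rw [Finset.mem_product, Finset.mem_filter]
      exact ⟨hv, Finset.mem_univ _, hE⟩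
    · simpa using h

theorem cnt_complete_uniOn_le (C : Finset V) (a b : ℕ) :
    cnt (fun G : SimpleGraph V => UniOn G C ∧
      ∃ S ⊆ Cᶜ, ∃ T ⊆ C, a < S.card ∧ b < T.card ∧ ∀ s ∈ S, ∀ t ∈ T, G.Adj t s) * 2 ^ (a * b) ≤
      2 ^ (2 * Fintype.card V) * cnt (fun G : SimpleGraph V => UniOn G C) := by
  have h1 := cnt_le_sum ((Finset.univ ×ˢ Finset.univ).filter fun i : Finset V × Finset V =>
      i.1 ⊆ Cᶜ ∧ i.2 ⊆ C ∧ a < i.1.card ∧ b < i.2.card)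
    (P := fun G : SimpleGraph V => UniOn G C ∧
      ∃ S ⊆ Cᶜ, ∃ T ⊆ C, a < S.card ∧ b < T.card ∧ ∀ s ∈ S, ∀ t ∈ T, G.Adj t s)
    (fun i G => UniOn G C ∧ ∀ s ∈ i.1, ∀ t ∈ i.2, G.Adj t s) ?_
  · refine (Nat.mul_le_mul_right _ h1).trans ?_
    rw [Finset.sum_mul]
    refine (Finset.sum_le_card_nsmul _ _ (cnt (fun G : SimpleGraph V => UniOn G C))
      fun i hi => ?_).trans ?_
    · obtain ⟨-, hS, hT, ha, hb⟩ := Finset.mem_filter.1 hi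
      refine (Nat.mul_le_mul_left _ (Nat.pow_le_pow_right two_pos ?_)).trans
        (cnt_uniOn_complete_le hS hT)
      rw [mul_comm]
      exact Nat.mul_le_mul hb.le ha.le
    · rw [smul_eq_mul]
      refine Nat.mul_le_mul_right _ ((Finset.card_filter_le _ _).trans_eq ?_)
      rw [Finset.card_product, Finset.card_univ, Fintype.card_finset, two_mul, pow_add]
  · rintro G ⟨hG, S, hS, T, hT, ha, hb, h⟩
    refine ⟨(S, T), ?_, hG, h⟩
    rw [Finset.mem_filter, Finset.mem_product]
    exact ⟨⟨Finset.mem_univ _, Finset.mem_univ _⟩, hS, hT, ha, hb⟩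

end GoodArrangement

section BadArrangements

variable {V : Type*} [Fintype V]

theorem bell_le_pow (w : ℕ) : bell w ≤ (w + 1) ^ (2 * w) := by
  have h1 := cnt_clusterOn (W := Fin w)
  have h2 := cnt_clusterOn_independent_le (W := Fin w) w
  rw [Fintype.card_fin] at h1 h2
  rw [← h1]
  refine (cnt_mono fun H hH => ?_).trans h2
  exact ⟨hH, ∅, by simp, by simp⟩

theorem cnt_uniOn_unbalanced_le {n : ℕ} (hV : Fintype.card V = n) {C : Finset V}
    (hC : 100 * C.card + n < 100 * Cᶜ.card ∨ 100 * Cᶜ.card + n < 100 * C.card) :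
    (cnt (fun G : SimpleGraph V => UniOn G C) : ℝ) ≤
      ((n : ℝ) + 1) ^ (2 * n) * 2 ^ ((n : ℝ) ^ 2 / 4 - 1 / 40000 * n ^ 2) := by
  have h1 := Finset.card_add_card_compl C
  rw [hV] at h1
  have h1' : (C.card : ℝ) + Cᶜ.card = n := by exact_mod_cast h1
  have h2 : ((C.card * Cᶜ.card : ℕ) : ℝ) ≤ (n : ℝ) ^ 2 / 4 - 1 / 40000 * n ^ 2 := by
    push_cast
    have h3 : (n : ℝ) ^ 2 ≤ (100 * (Cᶜ.card - C.card)) ^ 2 := by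
      rw [sq_le_sq, abs_of_nonneg (Nat.cast_nonneg n)]
      obtain h | h := hC
      · have : (100 * C.card + n : ℝ) < 100 * Cᶜ.card := by exact_mod_cast h
        exact le_trans (by linarith) (le_abs_self _)
      · have : (100 * Cᶜ.card + n : ℝ) < 100 * C.card := by exact_mod_cast h
        exact le_trans (by linarith) (neg_le_abs _)
    have h4 : (n : ℝ) ^ 2 = (C.card + Cᶜ.card) ^ 2 := by rw [h1']
    nlinarith
  have h3 : bell Cᶜ.card ≤ (n + 1) ^ (2 * n) :=
    (bell_le_pow _).trans ((Nat.pow_le_pow_left (by lia) _).trans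
      (Nat.pow_le_pow_right (by lia) (by lia)))
  have h3' : (bell Cᶜ.card : ℝ) ≤ ((n : ℝ) + 1) ^ (2 * n) := by exact_mod_cast h3
  rw [cnt_uniOn, Nat.cast_mul, mul_comm, Nat.cast_pow, Nat.cast_ofNat, ← Real.rpow_natCast 2]
  gcongr
  exact one_le_two

theorem cnt_bad_uniOn_le {n a : ℕ} (hV : Fintype.card V = n) (C : Finset V) (hn : 200 ≤ n)
    (ha : 1200 ≤ a) (ha' : 100 * a ≤ n) (h2 : (n : ℝ) ≤ 2 ^ ((1 / 10 : ℝ) * n))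
    (hvol : (vol n a : ℝ) ≤ 2 ^ ((1 / 10 : ℝ) * n)) :
    (cnt (fun G : SimpleGraph V => UniOn G C ∧ ¬GoodArr G C) : ℝ) ≤
      2 * (((n : ℝ) + 1) ^ (n / 25 + 2) * 2 ^ (n ^ 2 / 4)) +
      ((n : ℝ) + 1) ^ (2 * n) * 2 ^ ((n : ℝ) ^ 2 / 4 - 1 / 40000 * n ^ 2) +
      2 * 2 ^ (-(1 / 10 : ℝ) * n) * cnt (fun G : SimpleGraph V => UniOn G C) := by
  have hn0 : (0 : ℝ) ≤ n := Nat.cast_nonneg n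
  have hpos1 : (0 : ℝ) ≤ ((n : ℝ) + 1) ^ (n / 25 + 2) * 2 ^ (n ^ 2 / 4) := by positivity
  have hpos2 : (0 : ℝ) ≤ ((n : ℝ) + 1) ^ (2 * n) * 2 ^ ((n : ℝ) ^ 2 / 4 - 1 / 40000 * n ^ 2) := by
    positivity
  have hpos3 : (0 : ℝ) ≤ 2 ^ (-(1 / 10 : ℝ) * n) * cnt (fun G : SimpleGraph V => UniOn G C) := by
    positivity
  have h1 := Finset.card_add_card_compl C
  rw [hV] at h1
  by_cases hC : 100 * C.card + n < 100 * Cᶜ.card ∨ 100 * Cᶜ.card + n < 100 * C.card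
  · refine (Nat.cast_le.2 (cnt_mono fun G hG => hG.1)).trans
      ((cnt_uniOn_unbalanced_le hV hC).trans ?_)
    linarith
  push Not at hC
  set U := cnt (fun G : SimpleGraph V => UniOn G C) with hU
  have e1 := cnt_sparseCluster_uniOn_le C (Cᶜ.card + 1 - C.card)
  have e2 := cnt_cliqueCore_uniOn_le C (Cᶜ.card + n / 200 - C.card)
  have e3 := cnt_vertex_uniOn_le C a
  have e4 := cnt_complete_uniOn_le C a (n / 200)
  rw [hV] at e1 e2 e3 e4
  have e1' := (Nat.cast_le (α := ℝ)).2 (e1.trans (Nat.mul_le_mul_right _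
    (Nat.pow_le_pow_right (Nat.succ_pos n) (show _ ≤ n / 25 + 2 by lia))))
  have e2' := (Nat.cast_le (α := ℝ)).2 (e2.trans (Nat.mul_le_mul_right _
    (Nat.pow_le_pow_right (Nat.succ_pos n) (show _ ≤ n / 25 + 2 by lia))))
  push_cast at e1' e2'
  have e3' : (cnt (fun G : SimpleGraph V => UniOn G C ∧
      ∃ v ∈ Cᶜ, ∃ E : Finset V, E.card ≤ a ∧ ∀ t ∈ C \ E, G.Adj t v) : ℝ) ≤
      2 ^ (-(1 / 10 : ℝ) * n) * U := by
    have e : (_ : ℝ) ≤ _ := Nat.cast_le.2 e3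
    push_cast at e
    have h3 : (2 : ℝ) ^ ((3 / 10 : ℝ) * n) ≤ 2 ^ (C.card - a) := by
      rw [← Real.rpow_natCast]
      refine Real.rpow_le_rpow_of_exponent_le one_le_two ?_
      have : 3 * n ≤ 10 * (C.card - a) := by lia
      have : (3 * n : ℝ) ≤ 10 * (C.card - a : ℕ) := by exact_mod_cast this
      linarith
    refine le_of_mul_le_mul_right (e.trans ?_) (pow_pos two_pos (C.card - a))
    calc (n : ℝ) * vol n a * U ≤ 2 ^ ((1 / 10 : ℝ) * n) * 2 ^ ((1 / 10 : ℝ) * n) * U := by gcongr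
      _ = 2 ^ (-(1 / 10 : ℝ) * n) * U * 2 ^ ((3 / 10 : ℝ) * n) := by
        rw [← Real.rpow_add two_pos, mul_right_comm _ (U : ℝ), ← Real.rpow_add two_pos]
        congr 2
        ring
      _ ≤ _ := by gcongr
  have e4' : (cnt (fun G : SimpleGraph V => UniOn G C ∧
      ∃ S ⊆ Cᶜ, ∃ T ⊆ C, a < S.card ∧ n / 200 < T.card ∧ ∀ s ∈ S, ∀ t ∈ T, G.Adj t s) : ℝ) ≤
      2 ^ (-(1 / 10 : ℝ) * n) * U := by
    have e : (_ : ℝ) ≤ _ := Nat.cast_le.2 e4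
    push_cast at e
    have h3 : (2 : ℝ) ^ ((1 / 10 : ℝ) * n) * 2 ^ (2 * n) ≤ 2 ^ (a * (n / 200)) := by
      rw [← Real.rpow_natCast, ← Real.rpow_natCast, ← Real.rpow_add two_pos]
      refine Real.rpow_le_rpow_of_exponent_le one_le_two ?_
      have h4 : 3 * n ≤ a * (n / 200) :=
        (show 3 * n ≤ 1200 * (n / 200) by lia).trans (Nat.mul_le_mul_right _ ha)
      have h4 : (3 * n : ℝ) ≤ (a * (n / 200) : ℕ) := by exact_mod_cast h4
      push_cast at h4 ⊢
      linarith
    refine le_of_mul_le_mul_right (e.trans ?_) (pow_pos two_pos (a * (n / 200)))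
    have h5 : (2 : ℝ) ^ (2 * n) * U =
        2 ^ (-(1 / 10 : ℝ) * n) * U * (2 ^ ((1 / 10 : ℝ) * n) * 2 ^ (2 * n)) := by
      rw [mul_right_comm _ (U : ℝ), ← mul_assoc, ← Real.rpow_add two_pos,
        show -(1 / 10 : ℝ) * n + 1 / 10 * n = 0 by ring, Real.rpow_zero, one_mul]
    exact h5.trans_le (mul_le_mul_of_nonneg_left h3 hpos3)
  have e := cast_cnt_or_le e1' (cast_cnt_or_le e2' (cast_cnt_or_le e3' e4'))
  refine (Nat.cast_le.2 (cnt_mono fun G hG => ?_)).trans (e.trans ?_)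
  · obtain h | h | h | h := hG.1.bad_cases hG.2 a (n / 200)
    · exact Or.inl ⟨hG.1, h⟩
    · exact Or.inr (Or.inl ⟨hG.1, h⟩)
    · exact Or.inr (Or.inr (Or.inl ⟨hG.1, h⟩))
    · exact Or.inr (Or.inr (Or.inr ⟨hG.1, h⟩))
  · linarith

theorem eventually_unbalanced_le : ∀ᶠ n : ℕ in atTop,
    (2 : ℝ) ^ n * (((n : ℝ) + 1) ^ (2 * n) * 2 ^ ((n : ℝ) ^ 2 / 4 - 1 / 40000 * n ^ 2)) ≤
      2 ^ (-(n : ℝ)) * scrL n := by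
  filter_upwards [eventually_mul_pow_le (show (0 : ℝ) < 1 / 160000 by norm_num) 2 1,
    eventually_approx_le (show (0 : ℝ) < 1 / 80000 by norm_num)] with n h1 h2
  refine le_trans ?_ h2
  rw [pow_one] at h1
  have h3 : (2 : ℝ) ^ n ≤ 2 ^ (2 * n) := pow_le_pow_right₀ one_le_two (by lia)
  calc (2 : ℝ) ^ n * (((n : ℝ) + 1) ^ (2 * n) * 2 ^ ((n : ℝ) ^ 2 / 4 - 1 / 40000 * n ^ 2))
      ≤ 2 ^ (2 * n) * (((n : ℝ) + 1) ^ (2 * n) * 2 ^ ((n : ℝ) ^ 2 / 4 - 1 / 40000 * n ^ 2)) := by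
        gcongr
    _ = (2 * ((n : ℝ) + 1)) ^ (2 * n) * 2 ^ ((n : ℝ) ^ 2 / 4 - 1 / 40000 * n ^ 2) := by
        rw [mul_pow, mul_assoc]
    _ ≤ (2 ^ ((1 / 160000 : ℝ) * n)) ^ (2 * n) * 2 ^ ((n : ℝ) ^ 2 / 4 - 1 / 40000 * n ^ 2) := by
        gcongr
    _ = _ := by
        rw [← Real.rpow_mul_natCast two_pos.le, ← Real.rpow_add two_pos]
        congr 1
        push_cast
        ring

/-- Almost all unipolar arrangements are good. -/
theorem eventually_sum_cnt_bad_le : ∀ᶠ n : ℕ in atTop,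
    (∑ C : Finset (Fin n), cnt (fun G : SimpleGraph (Fin n) => UniOn G C ∧ ¬GoodArr G C) : ℝ) ≤
      5 * 2 ^ (-(1 / 10 : ℝ) * n) * scrL n := by
  obtain ⟨μ, hμ, hvol⟩ := exists_vol_le (show (0 : ℝ) < 1 / 10 by norm_num)
  set δ : ℝ := min μ (1 / 100) with hδ
  have hδ0 : 0 < δ := lt_min hμ (by norm_num)
  obtain ⟨n₁, hn₁⟩ := exists_nat_ge (1200 / δ)
  filter_upwards [eventually_ge_atTop n₁, eventually_ge_atTop 200, eventually_sparse_le,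
    eventually_unbalanced_le, eventually_mul_pow_le (show (0 : ℝ) < 1 / 10 by norm_num) 1 1]
    with n h1 h2 h3 h4 h5
  have hn0 : (0 : ℝ) ≤ n := Nat.cast_nonneg n
  have h6 : (1200 : ℝ) ≤ δ * n := by
    rw [div_le_iff₀ hδ0] at hn₁
    have : (n₁ : ℝ) ≤ n := by exact_mod_cast h1
    nlinarith
  have h7 : (⌊δ * n⌋₊ : ℝ) ≤ δ * n := Nat.floor_le (by positivity)
  have h8 : δ * n ≤ 1 / 100 * n := mul_le_mul_of_nonneg_right (min_le_right _ _) hn0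
  have h9 : δ * n ≤ μ * n := mul_le_mul_of_nonneg_right (min_le_left _ _) hn0
  have key := fun C : Finset (Fin n) => cnt_bad_uniOn_le (Fintype.card_fin n) C h2
    (a := ⌊δ * n⌋₊) (Nat.le_floor (by exact_mod_cast h6)) (by
      have : (100 * ⌊δ * n⌋₊ : ℝ) ≤ n := by linarith
      exact_mod_cast this) (by linarith) (hvol _ _ (by linarith))
  refine (Finset.sum_le_sum fun C _ => key C).trans ?_
  rw [Finset.sum_add_distrib, Finset.sum_const, ← Finset.mul_sum, ← Nat.cast_sum,
    Finset.sum_congr rfl fun C _ => cnt_uniOn C, sum_two_pow_mul_bell, Fintype.card_fin,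
    Finset.card_univ, Fintype.card_finset, Fintype.card_fin, nsmul_eq_mul]
  push_cast
  have h10 : (2 : ℝ) ^ (-(n : ℝ)) * scrL n ≤ 2 ^ (-(1 / 10 : ℝ) * n) * scrL n := by
    gcongr
    · exact one_le_two
    · linarith
  linarith

end BadArrangements

section TotalVariation

theorem sum_cnt_le {α ι : Type*} [Finite α] {R : α → Prop} (s : Finset ι) (Q : ι → α → Prop)
    (hd : ∀ i ∈ s, ∀ j ∈ s, ∀ x, Q i x → Q j x → i = j) (h : ∀ i ∈ s, ∀ x, Q i x → R x) :
    ∑ i ∈ s, cnt (Q i) ≤ cnt R := by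
  have := Fintype.ofFinite α
  simp only [cnt_eq_card_filter]
  rw [← Finset.card_biUnion fun i hi j hj hij => Finset.disjoint_filter.2
    fun x _ hx hx' => hij (hd i hi j hj x hx hx')]
  refine Finset.card_le_card fun x hx => ?_
  obtain ⟨i, hi, hx⟩ := Finset.mem_biUnion.1 hx
  exact Finset.mem_filter.2 ⟨Finset.mem_univ _, h i hi x (Finset.mem_filter.1 hx).2⟩

section Graphs

variable {V : Type*} [Fintype V] {G : SimpleGraph V} {C : Finset V}

theorem GoodArr.cliqueNum_eq (h : GoodArr G C) : G.cliqueNum = C.card := by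
  obtain ⟨s, hs⟩ := G.exists_isNClique_cliqueNum
  have h1 : C.card ≤ G.cliqueNum := SimpleGraph.IsClique.card_le_cliqueNum (t := C) (tc := h.1.1)
  rw [← hs.card_eq] at h1 ⊢
  rw [h.2.1 s hs.isClique h1]

theorem GoodArr.indepNum_lt (h : GoodArr G C) : indepNum G < C.card := by
  obtain ⟨s, hs⟩ := Gᶜ.exists_isNClique_cliqueNum
  unfold indepNum
  rw [← hs.card_eq]
  refine h.2.2 s fun u hu v hv huv => ?_
  exact ((SimpleGraph.compl_adj _ _ _).1 (hs.isClique hu hv huv.ne)).2 huv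

theorem GoodArr.hNum_eq (h : GoodArr G C) : HNum G = C.card := by
  unfold HNum
  rw [h.cliqueNum_eq]
  exact max_eq_right h.indepNum_lt.le

theorem hNum_compl {V : Type*} (G : SimpleGraph V) : HNum Gᶜ = HNum G := by
  unfold HNum indepNum
  rw [compl_compl, max_comm]

theorem two_mul_sum_cnt_goodArr_le (k : ℕ) :
    2 * ∑ C ∈ (Finset.univ : Finset V).powersetCard k, cnt (fun G => GoodArr G C) ≤
      cnt (fun G : SimpleGraph V => IsPerfect G ∧ HNum G = k) := by
  have h1 : ∑ C ∈ (Finset.univ : Finset V).powersetCard k, cnt (fun G => GoodArr G C) ≤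
      cnt (fun G : SimpleGraph V => ∃ C : Finset V, C.card = k ∧ GoodArr G C) := by
    refine sum_cnt_le _ _ (fun C hC C' hC' G h h' => ?_) fun C hC G h =>
      ⟨C, (Finset.mem_powersetCard.1 hC).2, h⟩
    exact h'.2.1 C h.1.1
      ((Finset.mem_powersetCard.1 hC').2.trans (Finset.mem_powersetCard.1 hC).2.symm).le
  have h2 := cnt_compl (fun G : SimpleGraph V => ∃ C : Finset V, C.card = k ∧ GoodArr G C)
  have h3 : cnt (fun G : SimpleGraph V => ∃ C : Finset V, C.card = k ∧ GoodArr G C) +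
      cnt (fun G : SimpleGraph V => ∃ C : Finset V, C.card = k ∧ GoodArr Gᶜ C) ≤
      cnt (fun G : SimpleGraph V => IsPerfect G ∧ HNum G = k) := by
    refine cnt_add_le ?_ ?_ ?_
    · rintro G ⟨C, hC, h⟩ ⟨C', hC', h'⟩
      have h4 := h.indepNum_lt
      have h5 : indepNum G = C'.card := h'.cliqueNum_eq
      lia
    · rintro G ⟨C, hC, h⟩
      exact ⟨(isUnipolar_iff.2 ⟨C, h.1⟩).isPerfect, h.hNum_eq.trans hC⟩
    · rintro G ⟨C, hC, h⟩
      refine ⟨IsCoUnipolar.isPerfect (isUnipolar_iff.2 ⟨C, h.1⟩), ?_⟩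
      rw [← hNum_compl, h.hNum_eq, hC]
  lia

theorem ell_le_sum_cnt_add (k : ℕ) : ell (Fintype.card V) k ≤
    ∑ C ∈ (Finset.univ : Finset V).powersetCard k, cnt (fun G => GoodArr G C) +
    ∑ C ∈ (Finset.univ : Finset V).powersetCard k,
      cnt (fun G => UniOn G C ∧ ¬GoodArr G C) := by
  rw [← sum_cnt_uniOn, ← Finset.sum_add_distrib]
  refine Finset.sum_le_sum fun C _ => ?_
  refine (cnt_mono fun G h => ?_).trans (cnt_or_le _ _)
  by_cases h' : GoodArr G C
  · exact Or.inl h'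
  · exact Or.inr ⟨h, h'⟩

theorem sum_powersetCard_eq {n : ℕ} (hV : Fintype.card V = n) (f : Finset V → ℕ) :
    ∑ k ∈ Finset.range (n + 1), ∑ C ∈ (Finset.univ : Finset V).powersetCard k, f C =
      ∑ C, f C := by
  rw [← Finset.powerset_univ, Finset.sum_powerset, Finset.card_univ, hV]

theorem perfectCount_pos (n : ℕ) : 0 < perfectCount n := by
  have h : IsPerfect (⊤ : SimpleGraph (Fin n)) := by
    refine IsUnipolar.isPerfect ⟨Set.univ, fun u _ v _ h => h, ?_⟩
    intro u
    exact absurd (Set.mem_univ _) u.2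
  have : Nonempty {G : SimpleGraph (Fin n) // IsPerfect G} := ⟨⟨_, h⟩⟩
  exact Nat.card_pos

theorem perfectCount_le (n : ℕ) : perfectCount n ≤
    2 * scrL n + cnt (fun G : SimpleGraph (Fin n) => Tame G ∧ ¬IsGenSplit G) := by
  refine (cnt_mono fun G (h : IsPerfect G) => ?_).trans
    ((cnt_or_le _ _).trans (Nat.add_le_add_right (cnt_isGenSplit_le n) _))
  by_cases h' : IsGenSplit G
  · exact Or.inl h'
  · exact Or.inr ⟨h.tame, h'⟩

end Graphs

theorem half_sum_abs_sub_le {ι : Type*} (s : Finset ι) (N g d l : ι → ℝ) {P L e D : ℝ}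
    (hP : 0 < P) (hL : 0 < L) (he : 0 ≤ e) (hN0 : ∀ k ∈ s, 0 ≤ N k) (hd : ∀ k ∈ s, 0 ≤ d k)
    (hl : ∀ k ∈ s, 0 ≤ l k) (hN : ∀ k ∈ s, 2 * g k ≤ N k) (hg : ∀ k ∈ s, l k ≤ g k + d k)
    (hNP : ∑ k ∈ s, N k ≤ P) (hPL : P ≤ 2 * L + e * L) (hlL : ∑ k ∈ s, l k = L)
    (hD : ∑ k ∈ s, d k ≤ D * L) :
    1 / 2 * ∑ k ∈ s, |N k / P - l k / L| ≤ e + D := by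
  have key : ∀ k ∈ s, |N k / P - l k / L| ≤
      N k / P - l k / L + 2 * (e * (l k / L) + d k / L) := by
    intro k hk
    have h0 := hN0 k hk
    have h1 := hd k hk
    have h2 := hl k hk
    have h3 := hN k hk
    have h4 := hg k hk
    have h5 : ((1 - e) * l k - d k) / L ≤ N k / P := by
      rw [div_le_div_iff₀ hL hP]
      obtain h | h := le_total ((1 - e) * l k - d k) 0
      · exact (mul_nonpos_of_nonpos_of_nonneg h hP.le).trans (mul_nonneg h0 hL.le)
      · refine (mul_le_mul_of_nonneg_left hPL h).trans ?_
        rw [← add_mul, ← mul_assoc]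
        refine mul_le_mul_of_nonneg_right ?_ hL.le
        nlinarith [mul_nonneg he h2, mul_nonneg he h1, mul_nonneg he (mul_nonneg he h2)]
    have h6 : ((1 - e) * l k - d k) / L = l k / L - (e * (l k / L) + d k / L) := by ring
    have h7 : 0 ≤ e * (l k / L) + d k / L := by positivity
    exact abs_le.2 ⟨by linarith, by linarith⟩
  have h1 := Finset.sum_le_sum key
  rw [Finset.sum_add_distrib, Finset.sum_sub_distrib, ← Finset.mul_sum, Finset.sum_add_distrib,
    ← Finset.mul_sum, ← Finset.sum_div, ← Finset.sum_div, ← Finset.sum_div, hlL,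
    div_self hL.ne'] at h1
  have h2 : (∑ k ∈ s, N k) / P ≤ 1 := (div_le_one hP).2 hNP
  have h3 : (∑ k ∈ s, d k) / L ≤ D := (div_le_iff₀ hL).2 hD
  linarith

theorem eventually_error_le : ∀ᶠ n : ℕ in atTop,
    (2 : ℝ) ^ (-(1 / 102400 : ℝ) * n) + 5 * 2 ^ (-(1 / 10 : ℝ) * n) ≤
      Real.exp (-(Real.log 2 / 204800 * n)) := by
  filter_upwards [eventually_mul_pow_le (show (0 : ℝ) < 1 / 204800 by norm_num) 6 0] with n h
  rw [pow_zero, mul_one] at h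
  have h1 : (2 : ℝ) ^ (-(1 / 10 : ℝ) * n) ≤ 2 ^ (-(1 / 102400 : ℝ) * n) := by
    refine Real.rpow_le_rpow_of_exponent_le one_le_two ?_
    have : (0 : ℝ) ≤ n := n.cast_nonneg
    linarith
  have h2 : Real.exp (-(Real.log 2 / 204800 * n)) = 2 ^ (-(1 / 204800 : ℝ) * n) := by
    rw [Real.rpow_def_of_pos two_pos]
    congr 1
    ring
  have h3 : (2 : ℝ) ^ (-(1 / 204800 : ℝ) * n) =
      2 ^ ((1 / 204800 : ℝ) * n) * 2 ^ (-(1 / 102400 : ℝ) * n) := by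
    rw [← Real.rpow_add two_pos]
    congr 1
    ring
  rw [h2, h3]
  have h4 := mul_le_mul_of_nonneg_right h
    (Real.rpow_nonneg zero_le_two (-(1 / 102400 : ℝ) * n))
  linarith

end TotalVariation

/-- The total variation distance between the distribution of `H(P_n) = max{α(P_n), ω(P_n)}`
for a uniformly random perfect graph `P_n` on `{1,…,n}` and the distribution `L(n)`
is `e^{−Ω(n)}`. -/
theorem tv_HNum_L :
    ∃ c : ℝ, 0 < c ∧ ∃ n₀ : ℕ, ∀ n : ℕ, n₀ ≤ n →
      (1 / 2) * ∑ k ∈ Finset.range (n + 1),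
          |(Nat.card {G : SimpleGraph (Fin n) // IsPerfect G ∧ HNum G = k} : ℝ) /
              (perfectCount n : ℝ) - (ell n k : ℝ) / (scrL n : ℝ)| ≤
        Real.exp (-(c * n)) := by

  refine ⟨Real.log 2 / 204800, div_pos (Real.log_pos one_lt_two) (by norm_num),
    eventually_atTop.1 ?_⟩
  filter_upwards [eventually_cnt_tame_not_isGenSplit_le, eventually_sum_cnt_bad_le,
    eventually_error_le] with n h1 h2 h3
  refine le_trans ?_ h3
  refine half_sum_abs_sub_le (Finset.range (n + 1)) _
    (fun k => ((∑ C ∈ (Finset.univ : Finset (Fin n)).powersetCard k,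
      cnt (fun G => GoodArr G C) : ℕ) : ℝ))
    (fun k => ((∑ C ∈ (Finset.univ : Finset (Fin n)).powersetCard k,
      cnt (fun G => UniOn G C ∧ ¬GoodArr G C) : ℕ) : ℝ)) _
    (Nat.cast_pos.2 (perfectCount_pos n)) (Nat.cast_pos.2 (one_le_scrL n))
    (Real.rpow_nonneg zero_le_two _) (fun _ _ => Nat.cast_nonneg _) (fun _ _ => Nat.cast_nonneg _)
    (fun _ _ => Nat.cast_nonneg _) (fun k _ => ?_) (fun k _ => ?_) ?_ ?_ ?_ ?_
  · exact_mod_cast two_mul_sum_cnt_goodArr_le (V := Fin n) k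
  · have h := ell_le_sum_cnt_add (V := Fin n) k
    rw [Fintype.card_fin] at h
    exact_mod_cast h
  · have h : ∑ k ∈ Finset.range (n + 1),
        cnt (fun G : SimpleGraph (Fin n) => IsPerfect G ∧ HNum G = k) ≤ perfectCount n :=
      sum_cnt_le _ _ (fun i _ j _ G hi hj => hi.2.symm.trans hj.2) fun i _ G h => h.1
    exact_mod_cast h
  · have h : (perfectCount n : ℝ) ≤ _ := Nat.cast_le.2 (perfectCount_le n)
    push_cast at h
    linarith
  · rw [scrL, Nat.cast_sum]
  · rw [← Nat.cast_sum, sum_powersetCard_eq (Fintype.card_fin n)]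
    push_cast
    exact h2
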